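/- arXiv:1410.1835 — 2 statements merged into one kernel-verified Lean document; each statement's English description precedes it below -/
import Mathlib

section
/- Let E be a finite directed graph and K any field. Then the Leavitt path algebra L_K(E) is a simple ring (its only two-sided ideals are {0} and L_K(E)) if and only if the only hereditary saturated subsets of E^0 are the empty set and E^0, and every cycle in E has an exit. -/
/-- Generators of the Leavitt path algebra: vertices, edges, and ghost edges. -/
inductive LPAGen (V E : Type) : Type
  | vertex : V → LPAGen V E
  | edge : E → LPAGen V E
  | ghost : E → LPAGen V E

/-- The defining relations of the Leavitt path algebra of a finite graph
(including the relation `∑ v = 1`, which presents the honest unital Leavitt path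
algebra of a graph with finitely many vertices). -/
inductive LPARel (K : Type) [Field K] {V E : Type} [Fintype V] (s r : E → V) :
    FreeAlgebra K (LPAGen V E) → FreeAlgebra K (LPAGen V E) → Prop
  | vertex_self (v : V) :
      LPARel K s r (FreeAlgebra.ι K (LPAGen.vertex v) * FreeAlgebra.ι K (LPAGen.vertex v))
        (FreeAlgebra.ι K (LPAGen.vertex v))
  | vertex_ne {v w : V} (h : v ≠ w) :
      LPARel K s r (FreeAlgebra.ι K (LPAGen.vertex v) * FreeAlgebra.ι K (LPAGen.vertex w)) 0
  | edge_left (e : E) :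
      LPARel K s r (FreeAlgebra.ι K (LPAGen.vertex (s e)) * FreeAlgebra.ι K (LPAGen.edge e))
        (FreeAlgebra.ι K (LPAGen.edge e))
  | edge_right (e : E) :
      LPARel K s r (FreeAlgebra.ι K (LPAGen.edge e) * FreeAlgebra.ι K (LPAGen.vertex (r e)))
        (FreeAlgebra.ι K (LPAGen.edge e))
  | ghost_left (e : E) :
      LPARel K s r (FreeAlgebra.ι K (LPAGen.vertex (r e)) * FreeAlgebra.ι K (LPAGen.ghost e))
        (FreeAlgebra.ι K (LPAGen.ghost e))
  | ghost_right (e : E) :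
      LPARel K s r (FreeAlgebra.ι K (LPAGen.ghost e) * FreeAlgebra.ι K (LPAGen.vertex (s e)))
        (FreeAlgebra.ι K (LPAGen.ghost e))
  | ck1_self (e : E) :
      LPARel K s r (FreeAlgebra.ι K (LPAGen.ghost e) * FreeAlgebra.ι K (LPAGen.edge e))
        (FreeAlgebra.ι K (LPAGen.vertex (r e)))
  | ck1_ne {e f : E} (h : e ≠ f) :
      LPARel K s r (FreeAlgebra.ι K (LPAGen.ghost e) * FreeAlgebra.ι K (LPAGen.edge f)) 0
  | ck2 (v : V) (h : {e : E | s e = v}.Finite) (hne : {e : E | s e = v}.Nonempty) :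
      LPARel K s r (FreeAlgebra.ι K (LPAGen.vertex v))
        (h.toFinset.sum fun e => FreeAlgebra.ι K (LPAGen.edge e) * FreeAlgebra.ι K (LPAGen.ghost e))
  | unit :
      LPARel K s r (∑ v : V, FreeAlgebra.ι K (LPAGen.vertex v)) 1

/-- The Leavitt path algebra of a finite graph with coefficients in `K`. -/
abbrev LPA (K : Type) [Field K] {V E : Type} [Fintype V] (s r : E → V) : Type :=
  RingQuot (LPARel K s r)

variable (K : Type) [Field K] {V E : Type} [Fintype V] (s r : E → V)

/-- The canonical image of a generator in the Leavitt path algebra. -/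
def gen (g : LPAGen V E) : LPA K s r :=
  RingQuot.mkAlgHom K (LPARel K s r) (FreeAlgebra.ι K g)

/-- Paths in a directed graph: `IsPathFrom s r v w es` means that the list of edges `es`
is a directed path from `v` to `w` (vertices are paths of length `0`). -/
inductive IsPathFrom {V E : Type} (s r : E → V) : V → V → List E → Prop
  | nil (v : V) : IsPathFrom s r v v []
  | cons (e : E) {w : V} {es : List E} :
      IsPathFrom s r (r e) w es → IsPathFrom s r (s e) w (e :: es)

/-- `v ≥ w` : there is a path from `v` to `w`. -/
def Geq {V E : Type} (s r : E → V) (v w : V) : Prop :=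
  ∃ es : List E, IsPathFrom s r v w es

/-- A cycle based at `v` : a nonempty closed path whose sources are pairwise distinct. -/
def IsCycle {V E : Type} (s r : E → V) (v : V) (es : List E) : Prop :=
  es ≠ [] ∧ IsPathFrom s r v v es ∧ (es.map s).Nodup

/-- A path (given by its list of edges) has an exit. -/
def HasExit {V E : Type} (s : E → V) (es : List E) : Prop :=
  ∃ f : E, ∃ e ∈ es, s f = s e ∧ f ≠ e

/-- A set of vertices is hereditary. -/
def Hereditary {V E : Type} (s r : E → V) (X : Set V) : Prop :=
  ∀ v ∈ X, ∀ w : V, Geq s r v w → w ∈ X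

/-- A set of vertices is saturated. -/
def Saturated {V E : Type} (s r : E → V) (X : Set V) : Prop :=
  ∀ v : V, {e : E | s e = v}.Finite → {e : E | s e = v}.Nonempty →
    (∀ e : E, s e = v → r e ∈ X) → v ∈ X

/-- A subset of a ring is a two-sided ideal. -/
def IsTwoSidedIdealSet {R : Type} [Zero R] [Add R] [Neg R] [Mul R] (I : Set R) : Prop :=
  (0 : R) ∈ I ∧ (∀ a ∈ I, ∀ b ∈ I, a + b ∈ I) ∧ (∀ a ∈ I, -a ∈ I) ∧
    ∀ x : R, ∀ a ∈ I, x * a ∈ I ∧ a * x ∈ I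

namespace LPA

local notation "vtx" v:max => gen K s r (LPAGen.vertex v)
local notation "edg" e:max => gen K s r (LPAGen.edge e)
local notation "gho" e:max => gen K s r (LPAGen.ghost e)

section Relations

lemma mkAlgHom_eq_of_rel {x y : FreeAlgebra K (LPAGen V E)} (h : LPARel K s r x y) :
    RingQuot.mkAlgHom K (LPARel K s r) x = RingQuot.mkAlgHom K (LPARel K s r) y :=
  RingQuot.mkAlgHom_rel K h

lemma vertex_mul_self (v : V) : vtx v * vtx v = vtx v := by
  simpa [gen] using mkAlgHom_eq_of_rel K s r (.vertex_self v)

lemma vertex_mul_of_ne {v w : V} (h : v ≠ w) : vtx v * vtx w = 0 := by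
  simpa [gen] using mkAlgHom_eq_of_rel K s r (.vertex_ne h)

lemma source_mul_edge (e : E) : vtx (s e) * edg e = edg e := by
  simpa [gen] using mkAlgHom_eq_of_rel K s r (.edge_left e)

lemma edge_mul_range (e : E) : edg e * vtx (r e) = edg e := by
  simpa [gen] using mkAlgHom_eq_of_rel K s r (.edge_right e)

lemma range_mul_ghost (e : E) : vtx (r e) * gho e = gho e := by
  simpa [gen] using mkAlgHom_eq_of_rel K s r (.ghost_left e)

lemma ghost_mul_source (e : E) : gho e * vtx (s e) = gho e := by
  simpa [gen] using mkAlgHom_eq_of_rel K s r (.ghost_right e)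

lemma ghost_mul_edge_self (e : E) : gho e * edg e = vtx (r e) := by
  simpa [gen] using mkAlgHom_eq_of_rel K s r (.ck1_self e)

lemma ghost_mul_edge_of_ne {e f : E} (h : e ≠ f) : gho e * edg f = 0 := by
  simpa [gen] using mkAlgHom_eq_of_rel K s r (.ck1_ne h)

lemma vertex_eq_sum (v : V) (h : {e : E | s e = v}.Finite) (hne : {e : E | s e = v}.Nonempty) :
    vtx v = ∑ e ∈ h.toFinset, edg e * gho e := by
  simpa [gen] using mkAlgHom_eq_of_rel K s r (.ck2 v h hne)

lemma sum_vertex : ∑ v : V, vtx v = 1 := by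
  simpa [gen] using mkAlgHom_eq_of_rel K s r .unit

lemma vertex_mul_edge_of_ne {v : V} {e : E} (h : v ≠ s e) : vtx v * edg e = 0 := by
  rw [← source_mul_edge, ← mul_assoc, vertex_mul_of_ne K s r h, zero_mul]

lemma ghost_mul_vertex_of_ne {v : V} {e : E} (h : s e ≠ v) : gho e * vtx v = 0 := by
  rw [← ghost_mul_source, mul_assoc, vertex_mul_of_ne K s r h, mul_zero]

end Relations

section Paths

/-- The product of a list of edges, followed by a vertex. -/
def pathElt (p : List E) (w : V) : LPA K s r := (p.map fun e => edg e).prod * vtx w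

/-- The product of the ghost edges of a list of edges, in reverse order. -/
def ghostElt (p : List E) : LPA K s r := (p.map fun e => gho e).reverse.prod

@[simp] lemma pathElt_nil (w : V) : pathElt K s r [] w = vtx w := by simp [pathElt]

@[simp] lemma pathElt_cons (e : E) (p : List E) (w : V) :
    pathElt K s r (e :: p) w = edg e * pathElt K s r p w := by simp [pathElt, mul_assoc]

@[simp] lemma ghostElt_nil : ghostElt K s r [] = 1 := by simp [ghostElt]

@[simp] lemma ghostElt_cons (e : E) (p : List E) :
    ghostElt K s r (e :: p) = ghostElt K s r p * gho e := by simp [ghostElt]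

lemma ghostElt_append (p q : List E) :
    ghostElt K s r (p ++ q) = ghostElt K s r q * ghostElt K s r p := by simp [ghostElt]

lemma pathElt_mul_vertex_self (p : List E) (w : V) :
    pathElt K s r p w * vtx w = pathElt K s r p w := by
  rw [pathElt, mul_assoc, vertex_mul_self]

lemma pathElt_mul_vertex_of_ne (p : List E) {w u : V} (h : w ≠ u) :
    pathElt K s r p w * vtx u = 0 := by
  rw [pathElt, mul_assoc, vertex_mul_of_ne K s r h, mul_zero]

variable {s r} in
lemma source_mul_pathElt {p : List E} {v w : V} (h : IsPathFrom s r v w p) :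
    vtx v * pathElt K s r p w = pathElt K s r p w := by
  cases h with
  | nil => simp [vertex_mul_self]
  | cons e _ => rw [pathElt_cons, ← mul_assoc, source_mul_edge]

lemma vertex_mul_pathElt (v : V) (p : List E) (w : V) :
    vtx v * pathElt K s r p w = 0 ∨
      IsPathFrom s r v w p ∧ vtx v * pathElt K s r p w = pathElt K s r p w := by
  suffices vtx v * pathElt K s r p w = 0 ∨ IsPathFrom s r v w p from
    this.imp_right fun h => ⟨h, source_mul_pathElt K h⟩
  induction p generalizing v with
  | nil =>
    by_cases h : v = w
    · subst h; exact .inr (.nil v)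
    · left; simpa using vertex_mul_of_ne K s r h
  | cons e p ih =>
    by_cases h : v = s e
    · subst h
      rcases ih (r e) with h | h
      · left
        rw [pathElt_cons, ← edge_mul_range, mul_assoc, h, mul_zero, mul_zero]
      · exact .inr (.cons e h)
    · left
      rw [pathElt_cons, ← mul_assoc, vertex_mul_edge_of_ne K s r h, zero_mul]

variable {s r} in
lemma pathElt_append {p q : List E} {w u : V} (hq : IsPathFrom s r w u q) :
    pathElt K s r (p ++ q) u = pathElt K s r p w * pathElt K s r q u := by
  induction p with
  | nil => simp [source_mul_pathElt K hq]
  | cons e p ih => simp [ih, mul_assoc]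

end Paths

section Graph

variable {s r}

omit [Fintype V] in
lemma isPathFrom_cons_iff {v w : V} {e : E} {p : List E} :
    IsPathFrom s r v w (e :: p) ↔ s e = v ∧ IsPathFrom s r (r e) w p := by
  constructor
  · intro h; cases h with
    | cons _ h => exact ⟨rfl, h⟩
  · rintro ⟨rfl, h⟩; exact .cons e h

omit [Fintype V] in
lemma isPathFrom_append_iff {v w : V} {p q : List E} :
    IsPathFrom s r v w (p ++ q) ↔ ∃ u, IsPathFrom s r v u p ∧ IsPathFrom s r u w q := by
  induction p generalizing v with
  | nil =>
    constructor
    · exact fun h => ⟨v, .nil v, h⟩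
    · rintro ⟨u, h, h'⟩; cases h; exact h'
  | cons e p ih =>
    simp only [List.cons_append, isPathFrom_cons_iff, ih]
    constructor
    · rintro ⟨h, u, h1, h2⟩; exact ⟨u, ⟨h, h1⟩, h2⟩
    · rintro ⟨u, ⟨h, h1⟩, h2⟩; exact ⟨h, u, h1, h2⟩

omit [Fintype V] in
lemma exists_eq_append_of_not_nodup_map {c : List E} (h : ¬(c.map s).Nodup) :
    ∃ x e y e' z, c = x ++ (e :: y) ++ (e' :: z) ∧ s e = s e' := by
  induction c with
  | nil => simp at h
  | cons a t ih =>
    by_cases ha : s a ∈ t.map s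
    · obtain ⟨e', he', hs⟩ := List.mem_map.1 ha
      obtain ⟨y, z, rfl⟩ := List.append_of_mem he'
      exact ⟨[], a, y, e', z, by simp, hs.symm⟩
    · rw [List.map_cons, List.nodup_cons] at h
      obtain ⟨x, e, y, e', z, rfl, hs⟩ := ih fun ht => h ⟨ha, ht⟩
      exact ⟨a :: x, e, y, e', z, by simp, hs⟩

omit [Fintype V] in
lemma hasExit_of_subset {p c : List E} (h : HasExit s p) (hpc : p ⊆ c) : HasExit s c := by
  obtain ⟨f, e, he, h⟩ := h
  exact ⟨f, e, hpc he, h⟩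

omit [Fintype V] in
lemma hasExit_of_closed (hL : ∀ (v : V) (es : List E), IsCycle s r v es → HasExit s es)
    {v : V} {c : List E} (hc : c ≠ []) (h : IsPathFrom s r v v c) : HasExit s c := by
  induction hn : c.length using Nat.strong_induction_on generalizing v c with
  | _ n ih =>
  by_cases hnd : (c.map s).Nodup
  · exact hL v c ⟨hc, h, hnd⟩
  · obtain ⟨x, e, y, e', z, rfl, hs⟩ := exists_eq_append_of_not_nodup_map hnd
    rw [isPathFrom_append_iff] at h
    obtain ⟨u, h1, h2⟩ := h
    rw [isPathFrom_append_iff] at h1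
    obtain ⟨u', -, h3⟩ := h1
    have hu := (isPathFrom_cons_iff.1 h2).1
    have hu' := (isPathFrom_cons_iff.1 h3).1
    obtain rfl : u' = u := by rw [← hu, ← hu', hs]
    refine hasExit_of_subset (ih (e :: y).length ?_ (by simp) h3 rfl) ?_
    · simp only [List.length_append, List.length_cons] at hn ⊢; omega
    · intro a ha; simp only [List.mem_append]; exact .inl (.inr ha)

end Graph

section Span

lemma ghostElt_mul_vertex (q : List E) (hq : q ≠ []) (v : V) :
    ghostElt K s r q * vtx v = 0 ∨ ghostElt K s r q * vtx v = ghostElt K s r q := by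
  obtain ⟨e, q, rfl⟩ := List.exists_cons_of_ne_nil hq
  rw [ghostElt_cons, mul_assoc]
  by_cases h : s e = v
  · subst h; rw [ghost_mul_source]; exact .inr rfl
  · rw [ghost_mul_vertex_of_ne K s r h]; simp

/-- The span of the monomials of ghost degree at most `n`. -/
def ghostFiltration (n : ℕ) : Submodule K (LPA K s r) :=
  Submodule.span K {x | ∃ p w q, q.length ≤ n ∧ x = pathElt K s r p w * ghostElt K s r q}

lemma monomial_mem {p : List E} {w : V} {q : List E} {n : ℕ} (h : q.length ≤ n) :
    pathElt K s r p w * ghostElt K s r q ∈ ghostFiltration K s r n :=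
  Submodule.subset_span ⟨p, w, q, h, rfl⟩

lemma ghostFiltration_mono : Monotone (ghostFiltration K s r) := fun m n h => by
  refine Submodule.span_mono ?_
  rintro _ ⟨p, w, q, hq, rfl⟩
  exact ⟨p, w, q, hq.trans h, rfl⟩

variable {K} in
lemma map_mem_of_mem_span {A B : Type} [AddCommGroup A] [Module K A] [AddCommGroup B]
    [Module K B] (f : A →ₗ[K] B) {S : Set A} {T : Submodule K B} (h : ∀ x ∈ S, f x ∈ T) {x : A}
    (hx : x ∈ Submodule.span K S) : f x ∈ T :=
  (Submodule.span_le (p := T.comap f)).2 h hx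

lemma gen_mul_mem (g : LPAGen V E) {n : ℕ} {x : LPA K s r} (hx : x ∈ ghostFiltration K s r n) :
    gen K s r g * x ∈ ghostFiltration K s r (n + 1) := by
  refine map_mem_of_mem_span (LinearMap.mulLeft K (gen K s r g)) ?_ hx
  rintro _ ⟨p, w, q, hq, rfl⟩
  rw [LinearMap.mulLeft_apply, ← mul_assoc]
  have hv : ∀ v : V, vtx v * pathElt K s r p w * ghostElt K s r q ∈
      ghostFiltration K s r (n + 1) := fun v => by
    rcases vertex_mul_pathElt K s r v p w with h | ⟨-, h⟩ <;> rw [h]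
    · simp
    · exact monomial_mem K s r (by omega)
  match g with
  | .vertex v => exact hv v
  | .edge e =>
    rw [← pathElt_cons]
    exact monomial_mem K s r (by omega)
  | .ghost e =>
    match p with
    | [] =>
      rw [pathElt_nil]
      by_cases h : s e = w
      · subst h
        rw [ghost_mul_source, ← range_mul_ghost, mul_assoc]
        have : gho e * ghostElt K s r q = ghostElt K s r (q ++ [e]) := by simp [ghostElt_append]
        rw [this, ← pathElt_nil]
        exact monomial_mem K s r (by simpa using hq)
      · simp [ghost_mul_vertex_of_ne K s r h]
    | f :: p =>
      rw [pathElt_cons, ← mul_assoc]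
      by_cases h : e = f
      · subst h
        rw [ghost_mul_edge_self]
        rcases vertex_mul_pathElt K s r (r e) p w with h | ⟨-, h⟩ <;> rw [h]
        · simp
        · exact monomial_mem K s r (by omega)
      · simp [ghost_mul_edge_of_ne K s r h]

lemma exists_mem_ghostFiltration (a : LPA K s r) : ∃ n, a ∈ ghostFiltration K s r n := by
  suffices H : ∀ (a : FreeAlgebra K (LPAGen V E)) (n : ℕ), ∀ x ∈ ghostFiltration K s r n,
      ∃ m, RingQuot.mkAlgHom K (LPARel K s r) a * x ∈ ghostFiltration K s r m by
    obtain ⟨a, rfl⟩ := RingQuot.mkAlgHom_surjective K (LPARel K s r) a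
    have h1 : (1 : LPA K s r) ∈ ghostFiltration K s r 0 := by
      rw [← sum_vertex]
      refine Submodule.sum_mem _ fun v _ => ?_
      simpa using monomial_mem K s r (p := []) (w := v) (q := []) le_rfl
    simpa using H a 0 1 h1
  intro a
  induction a with
  | grade0 k =>
    intro n x hx
    refine ⟨n, ?_⟩
    rw [AlgHom.commutes, ← Algebra.smul_def]
    exact Submodule.smul_mem _ _ hx
  | grade1 g => exact fun n x hx => ⟨n + 1, gen_mul_mem K s r g hx⟩
  | mul a b iha ihb =>
    intro n x hx
    obtain ⟨m, hm⟩ := ihb n x hx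
    obtain ⟨l, hl⟩ := iha m _ hm
    exact ⟨l, by rwa [map_mul, mul_assoc]⟩
  | add a b iha ihb =>
    intro n x hx
    obtain ⟨m, hm⟩ := iha n x hx
    obtain ⟨l, hl⟩ := ihb n x hx
    refine ⟨max m l, ?_⟩
    rw [map_add, add_mul]
    exact add_mem (ghostFiltration_mono K s r (le_max_left _ _) hm)
      (ghostFiltration_mono K s r (le_max_right _ _) hl)

lemma mul_edge_mem {n : ℕ} {a : LPA K s r} (ha : a ∈ ghostFiltration K s r (n + 1)) (e : E) :
    a * vtx (s e) * edg e ∈ ghostFiltration K s r n := by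
  rw [mul_assoc, source_mul_edge]
  refine map_mem_of_mem_span (LinearMap.mulRight K (edg e)) ?_ ha
  rintro _ ⟨p, w, q, hq, rfl⟩
  rw [LinearMap.mulRight_apply]
  match q with
  | [] =>
    rw [ghostElt_nil, mul_one, ← source_mul_edge, ← edge_mul_range]
    by_cases h : w = s e
    · have : IsPathFrom s r w (r e) [e] := isPathFrom_cons_iff.2 ⟨h.symm, .nil _⟩
      have := pathElt_append K (p := p) this
      rw [← mul_assoc (vtx (s e)), source_mul_edge, ← pathElt_nil, ← pathElt_cons, ← this]
      simpa using monomial_mem K s r (p := p ++ [e]) (w := r e) (q := []) (Nat.zero_le n)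
    · rw [← mul_assoc, pathElt_mul_vertex_of_ne K s r _ h, zero_mul]; simp
  | f :: q =>
    rw [ghostElt_cons, mul_assoc, mul_assoc]
    by_cases h : f = e
    · subst h
      rw [ghost_mul_edge_self]
      simp only [List.length_cons, add_le_add_iff_right] at hq
      rcases eq_or_ne q [] with rfl | hq'
      · rw [ghostElt_nil, one_mul]
        by_cases h : w = r f
        · subst h
          rw [pathElt_mul_vertex_self]
          simpa using monomial_mem K s r (p := p) (w := r f) (q := []) (Nat.zero_le n)
        · rw [pathElt_mul_vertex_of_ne K s r _ h]; simp
      · rcases ghostElt_mul_vertex K s r q hq' (r f) with h | h <;> rw [h]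
        · simp
        · exact monomial_mem K s r hq
    · simp [ghost_mul_edge_of_ne K s r h]

end Span

section Reduction

variable {K s r}

lemma exists_mul_vertex_ne_zero {a : LPA K s r} (ha : a ≠ 0) : ∃ v, a * vtx v ≠ 0 := by
  by_contra! h
  apply ha
  rw [← mul_one a, ← sum_vertex, Finset.mul_sum]
  exact Finset.sum_eq_zero fun v _ => h v

lemma exists_vertex_mul_ne_zero {a : LPA K s r} (ha : a ≠ 0) : ∃ v, vtx v * a ≠ 0 := by
  by_contra! h
  apply ha
  rw [← one_mul a, ← sum_vertex, Finset.sum_mul]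
  exact Finset.sum_eq_zero fun v _ => h v

lemma exists_mul_edge_ne_zero [Finite E] {a : LPA K s r} {v : V} (ha : a * vtx v ≠ 0)
    (hv : ∃ e, s e = v) : ∃ e, s e = v ∧ a * vtx v * edg e ≠ 0 := by
  by_contra! h
  apply ha
  rw [← vertex_mul_self, ← mul_assoc]
  nth_rewrite 2 [vertex_eq_sum K s r v (Set.toFinite _) hv]
  rw [Finset.mul_sum]
  refine Finset.sum_eq_zero fun e he => ?_
  rw [← mul_assoc, h e (by simpa using he), zero_mul]

lemma exists_ghost_mul_ne_zero [Finite E] {a : LPA K s r} {v : V} (ha : vtx v * a ≠ 0)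
    (hv : ∃ e, s e = v) : ∃ e, s e = v ∧ gho e * a ≠ 0 := by
  by_contra! h
  apply ha
  rw [vertex_eq_sum K s r v (Set.toFinite _) hv, Finset.sum_mul]
  refine Finset.sum_eq_zero fun e he => ?_
  rw [mul_assoc, h e (by simpa using he), mul_zero]

variable {I : Set (LPA K s r)}

lemma exists_mem_span_pathElt [Finite E] (hI : IsTwoSidedIdealSet I) {a : LPA K s r} (haI : a ∈ I)
    (ha : a ≠ 0) :
    ∃ w, ∃ b ∈ I, b ≠ 0 ∧ b ∈ Submodule.span K (Set.range fun p => pathElt K s r p w) := by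
  obtain ⟨n, hn⟩ := exists_mem_ghostFiltration K s r a
  induction n generalizing a with
  | zero =>
    obtain ⟨v, hv⟩ := exists_mul_vertex_ne_zero ha
    refine ⟨v, _, (hI.2.2.2 (vtx v) a haI).2, hv, ?_⟩
    refine map_mem_of_mem_span (LinearMap.mulRight K (vtx v)) ?_ hn
    rintro _ ⟨p, w, q, hq, rfl⟩
    obtain rfl : q = [] := List.length_eq_zero_iff.1 (Nat.le_zero.1 hq)
    rw [LinearMap.mulRight_apply, ghostElt_nil, mul_one]
    by_cases h : w = v
    · subst h
      rw [pathElt_mul_vertex_self]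
      exact Submodule.subset_span ⟨p, rfl⟩
    · rw [pathElt_mul_vertex_of_ne K s r _ h]; simp
  | succ n ih =>
    obtain ⟨v, hv⟩ := exists_mul_vertex_ne_zero ha
    by_cases hreg : ∃ e, s e = v
    · obtain ⟨e, rfl, he⟩ := exists_mul_edge_ne_zero hv hreg
      exact ih (hI.2.2.2 _ _ (hI.2.2.2 _ _ haI).2).2 he (mul_edge_mem K s r hn e)
    · refine ⟨v, _, (hI.2.2.2 (vtx v) a haI).2, hv, ?_⟩
      refine map_mem_of_mem_span (LinearMap.mulRight K (vtx v)) ?_ hn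
      rintro _ ⟨p, w, q, -, rfl⟩
      rw [LinearMap.mulRight_apply, mul_assoc]
      match q with
      | [] =>
        rw [ghostElt_nil, one_mul]
        by_cases h : w = v
        · subst h
          rw [pathElt_mul_vertex_self]
          exact Submodule.subset_span ⟨p, rfl⟩
        · rw [pathElt_mul_vertex_of_ne K s r _ h]; simp
      | f :: q =>
        rw [ghostElt_cons, mul_assoc, ghost_mul_vertex_of_ne K s r fun h => hreg ⟨f, h⟩]
        simp

variable (K) in
/-- The span of the paths from `v` to `w` of length less than `n`. -/
def pathFiltration (s r : E → V) (n : ℕ) (v w : V) : Submodule K (LPA K s r) :=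
  Submodule.span K {x | ∃ p, IsPathFrom s r v w p ∧ p.length < n ∧ x = pathElt K s r p w}

lemma pathFiltration_mono (v w : V) : Monotone fun n => pathFiltration K s r n v w :=
  fun m n h => by
    refine Submodule.span_mono ?_
    rintro _ ⟨p, hp, hl, rfl⟩
    exact ⟨p, hp, hl.trans_le h, rfl⟩

lemma exists_mem_pathFiltration {b : LPA K s r} {w : V}
    (hb : b ∈ Submodule.span K (Set.range fun p => pathElt K s r p w)) (v : V) :
    ∃ n, vtx v * b ∈ pathFiltration K s r n v w := by
  induction hb using Submodule.span_induction with
  | mem x hx =>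
    obtain ⟨p, rfl⟩ := hx
    refine ⟨p.length + 1, ?_⟩
    rcases vertex_mul_pathElt K s r v p w with h | ⟨hp, h⟩ <;> rw [h]
    · simp
    · exact Submodule.subset_span ⟨p, hp, by simp, rfl⟩
  | zero => exact ⟨0, by simp⟩
  | add x y _ _ ihx ihy =>
    obtain ⟨m, hm⟩ := ihx
    obtain ⟨l, hl⟩ := ihy
    refine ⟨max m l, ?_⟩
    rw [mul_add]
    exact add_mem (pathFiltration_mono v w (le_max_left _ _) hm)
      (pathFiltration_mono v w (le_max_right _ _) hl)
  | smul k x _ ih =>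
    obtain ⟨m, hm⟩ := ih
    exact ⟨m, by rw [mul_smul_comm]; exact Submodule.smul_mem _ _ hm⟩

variable (K) in
/-- The span of the nonempty paths from `v` to `w` of length at most `n`. -/
def posPathFiltration (s r : E → V) (n : ℕ) (v w : V) : Submodule K (LPA K s r) :=
  Submodule.span K
    {x | ∃ p, IsPathFrom s r v w p ∧ p ≠ [] ∧ p.length ≤ n ∧ x = pathElt K s r p w}

lemma exists_eq_smul_vertex_add {b : LPA K s r} {n : ℕ} {v w : V}
    (hb : b ∈ pathFiltration K s r (n + 1) v w) :
    ∃ k : K, (v = w ∨ k = 0) ∧ ∃ y ∈ posPathFiltration K s r n v w, b = k • vtx w + y := by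
  induction hb using Submodule.span_induction with
  | mem x hx =>
    obtain ⟨p, hp, hl, rfl⟩ := hx
    rcases eq_or_ne p [] with rfl | hne
    · cases hp
      exact ⟨1, .inl rfl, 0, by simp, by simp⟩
    · exact ⟨0, .inr rfl, _, Submodule.subset_span ⟨p, hp, hne, by omega, rfl⟩, by simp⟩
  | zero => exact ⟨0, .inr rfl, 0, by simp, by simp⟩
  | add x y _ _ ihx ihy =>
    obtain ⟨k, hk, x', hx', rfl⟩ := ihx
    obtain ⟨l, hl, y', hy', rfl⟩ := ihy
    refine ⟨k + l, ?_, _, add_mem hx' hy', by module⟩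
    rcases hk with h | rfl
    · exact .inl h
    · simpa using hl
  | smul c x _ ih =>
    obtain ⟨k, hk, x', hx', rfl⟩ := ih
    refine ⟨c * k, ?_, _, Submodule.smul_mem _ c hx', by module⟩
    rcases hk with h | rfl
    · exact .inl h
    · simp

lemma ghost_mul_mem {y : LPA K s r} {n : ℕ} {e : E} {w : V}
    (hy : y ∈ posPathFiltration K s r n (s e) w) :
    gho e * y ∈ pathFiltration K s r n (r e) w := by
  refine map_mem_of_mem_span (LinearMap.mulLeft K (gho e)) ?_ hy
  rintro _ ⟨p, hp, hne, hl, rfl⟩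
  obtain ⟨f, p, rfl⟩ := List.exists_cons_of_ne_nil hne
  rw [LinearMap.mulLeft_apply, pathElt_cons, ← mul_assoc]
  by_cases h : e = f
  · subst h
    have hp' := (isPathFrom_cons_iff.1 hp).2
    rw [ghost_mul_edge_self, source_mul_pathElt K hp']
    exact Submodule.subset_span ⟨p, hp', by simpa using hl, rfl⟩
  · simp [ghost_mul_edge_of_ne K s r h]

lemma vertex_mul_of_mem {y : LPA K s r} {n : ℕ} {v w : V}
    (hy : y ∈ posPathFiltration K s r n v w) : vtx v * y = y := by
  induction hy using Submodule.span_induction with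
  | mem x hx =>
    obtain ⟨p, hp, -, -, rfl⟩ := hx
    exact source_mul_pathElt K hp
  | zero => simp
  | add x y _ _ ihx ihy => rw [mul_add, ihx, ihy]
  | smul k x _ ih => rw [mul_smul_comm, ih]

lemma exists_source_eq_of_mem {y : LPA K s r} {n : ℕ} {v w : V}
    (hy : y ∈ posPathFiltration K s r n v w) (h0 : y ≠ 0) : ∃ e, s e = v := by
  by_contra! h
  apply h0
  induction hy using Submodule.span_induction with
  | mem x hx =>
    obtain ⟨p, hp, hne, -, rfl⟩ := hx
    obtain ⟨f, p, rfl⟩ := List.exists_cons_of_ne_nil hne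
    exact absurd (isPathFrom_cons_iff.1 hp).1 (h f)
  | zero => rfl
  | add x y _ _ ihx ihy => simp_all
  | smul k x _ ih => simp_all

lemma exists_smul_vertex_add_mem [Finite E] (hI : IsTwoSidedIdealSet I) {n : ℕ} {v w : V}
    {b : LPA K s r} (hb : b ∈ pathFiltration K s r n v w) (hbI : b ∈ I) (h0 : b ≠ 0) :
    ∃ k : K, k ≠ 0 ∧ ∃ m, ∃ y ∈ posPathFiltration K s r m w w, k • vtx w + y ∈ I := by
  induction n generalizing v b with
  | zero => exact absurd (by simpa [pathFiltration] using hb) h0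
  | succ n ih =>
    obtain ⟨k, hk, y, hy, rfl⟩ := exists_eq_smul_vertex_add hb
    by_cases hk0 : k = 0
    · subst hk0
      simp only [zero_smul, zero_add] at hbI h0
      have hvy : vtx v * y ≠ 0 := by rwa [vertex_mul_of_mem hy]
      obtain ⟨e, rfl, he⟩ := exists_ghost_mul_ne_zero hvy (exists_source_eq_of_mem hy h0)
      exact ih (ghost_mul_mem hy) (hI.2.2.2 _ _ hbI).1 he
    · obtain rfl := hk.resolve_right hk0
      exact ⟨k, hk0, n, y, hy, hbI⟩

variable (K) in
/-- An element is zero or a nonempty closed path based at `v`. -/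
def IsZeroOrClosed (s r : E → V) (v : V) (x : LPA K s r) : Prop :=
  x = 0 ∨ ∃ c, c ≠ [] ∧ IsPathFrom s r v v c ∧ x = pathElt K s r c v

lemma ghostElt_mul_pathElt {v w : V} {q : List E} (hq : IsPathFrom s r v w q) :
    ghostElt K s r q * pathElt K s r q w = vtx w := by
  induction q generalizing v with
  | nil => simp
  | cons e q ih =>
    have hq' := (isPathFrom_cons_iff.1 hq).2
    rw [ghostElt_cons, pathElt_cons, mul_assoc, ← mul_assoc (gho e), ghost_mul_edge_self,
      source_mul_pathElt K hq', ih hq']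

lemma IsZeroOrClosed.ghost_mul_edge {e : E} {x : LPA K s r}
    (hx : IsZeroOrClosed K s r (s e) x) : IsZeroOrClosed K s r (r e) (gho e * x * edg e) := by
  rcases hx with rfl | ⟨c, hne, hc, rfl⟩
  · simp [IsZeroOrClosed]
  · obtain ⟨f, p, rfl⟩ := List.exists_cons_of_ne_nil hne
    by_cases h : e = f
    · subst h
      have he : IsPathFrom s r (s e) (r e) [e] := .cons e (.nil _)
      have hp := (isPathFrom_cons_iff.1 hc).2
      refine .inr ⟨p ++ [e], by simp, isPathFrom_append_iff.2 ⟨_, hp, he⟩, ?_⟩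
      rw [pathElt_append K he, pathElt_cons, ← mul_assoc (gho e), ghost_mul_edge_self,
        source_mul_pathElt K hp, pathElt_cons, pathElt_nil, edge_mul_range]
    · left
      rw [pathElt_cons, ← mul_assoc, ghost_mul_edge_of_ne K s r h, zero_mul, zero_mul]

lemma IsZeroOrClosed.mul_vertex {v : V} {x : LPA K s r} (hx : IsZeroOrClosed K s r v x) :
    x * vtx v = x := by
  rcases hx with rfl | ⟨c, -, -, rfl⟩
  · simp
  · exact pathElt_mul_vertex_self K s r c v

lemma IsZeroOrClosed.ghostElt_mul_pathElt {v w : V} {q : List E} {x : LPA K s r}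
    (hx : IsZeroOrClosed K s r v x) (hq : IsPathFrom s r v w q) :
    IsZeroOrClosed K s r w (ghostElt K s r q * x * pathElt K s r q w) := by
  induction q generalizing v x with
  | nil =>
    cases hq
    rw [ghostElt_nil, one_mul, pathElt_nil, hx.mul_vertex]
    exact hx
  | cons e q ih =>
    obtain ⟨rfl, hq'⟩ := isPathFrom_cons_iff.1 hq
    simpa [mul_assoc] using ih hx.ghost_mul_edge hq'

lemma IsZeroOrClosed.exists_ghostElt_mul_eq_zero
    (hL : ∀ (v : V) (es : List E), IsCycle s r v es → HasExit s es) {v : V} {x : LPA K s r}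
    (hx : IsZeroOrClosed K s r v x) :
    ∃ w q, IsPathFrom s r v w q ∧ ghostElt K s r q * x = 0 := by
  rcases hx with rfl | ⟨c, hne, hc, rfl⟩
  · exact ⟨v, [], .nil v, by simp⟩
  · obtain ⟨f, e, he, hs, hfe⟩ := hasExit_of_closed hL hne hc
    obtain ⟨x, y, rfl⟩ := List.append_of_mem he
    obtain ⟨u, hx, hy⟩ := isPathFrom_append_iff.1 hc
    obtain ⟨rfl, -⟩ := isPathFrom_cons_iff.1 hy
    refine ⟨r f, x ++ [f], isPathFrom_append_iff.2 ⟨_, hx, hs ▸ .cons f (.nil _)⟩, ?_⟩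
    rw [pathElt_append K hy, ghostElt_append, ghostElt_cons, ghostElt_nil, one_mul, mul_assoc,
      ← mul_assoc (ghostElt K s r x), LPA.ghostElt_mul_pathElt hx, source_mul_pathElt K hy,
      pathElt_cons, ← mul_assoc, ghost_mul_edge_of_ne K s r hfe, zero_mul]

lemma smul_mem_ideal (hI : IsTwoSidedIdealSet I) (k : K) {x : LPA K s r} (hx : x ∈ I) :
    k • x ∈ I := by
  rw [Algebra.smul_def]
  exact (hI.2.2.2 _ _ hx).1

lemma exists_vertex_mem_of_sum_mem (hI : IsTwoSidedIdealSet I)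
    (hL : ∀ (v : V) (es : List E), IsCycle s r v es → HasExit s es) {k : K} (hk : k ≠ 0)
    (n : ℕ) (w : V) (f : Fin n → K) (x : Fin n → LPA K s r)
    (hx : ∀ i, IsZeroOrClosed K s r w (x i)) (h : k • vtx w + ∑ i, f i • x i ∈ I) :
    ∃ u, vtx u ∈ I := by
  induction n generalizing w with
  | zero =>
    refine ⟨w, ?_⟩
    simpa [smul_smul, hk] using smul_mem_ideal hI k⁻¹ h
  | succ n ih =>
    obtain ⟨u, q, hq, h0⟩ := (hx 0).exists_ghostElt_mul_eq_zero hL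
    refine ih u (fun i => f i.succ)
      (fun i => ghostElt K s r q * x i.succ * pathElt K s r q u)
      (fun i => (hx i.succ).ghostElt_mul_pathElt hq) ?_
    have := (hI.2.2.2 (pathElt K s r q u) _ (hI.2.2.2 (ghostElt K s r q) _ h).1).2
    simpa [Fin.sum_univ_succ, mul_add, add_mul, Finset.mul_sum, Finset.sum_mul, h0, mul_assoc,
      source_mul_pathElt K hq, ghostElt_mul_pathElt hq] using this

lemma exists_vertex_mem [Finite E] (hI : IsTwoSidedIdealSet I)
    (hL : ∀ (v : V) (es : List E), IsCycle s r v es → HasExit s es) (h0 : I ≠ {0}) :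
    ∃ u, vtx u ∈ I := by
  obtain ⟨a, haI, ha⟩ : ∃ a ∈ I, a ≠ 0 := by
    by_contra! h
    exact h0 (Set.eq_singleton_iff_unique_mem.2 ⟨hI.1, h⟩)
  obtain ⟨w, b, hbI, hb, hbs⟩ := exists_mem_span_pathElt hI haI ha
  obtain ⟨v, hv⟩ := exists_vertex_mul_ne_zero hb
  obtain ⟨n, hn⟩ := exists_mem_pathFiltration hbs v
  obtain ⟨k, hk, m, y, hy, h⟩ := exists_smul_vertex_add_mem hI hn (hI.2.2.2 _ _ hbI).1 hv
  obtain ⟨l, f, g, rfl⟩ := Submodule.mem_span_set'.1 hy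
  refine exists_vertex_mem_of_sum_mem hI hL hk l w f (fun i => g i) (fun i => ?_) h
  obtain ⟨p, hp, hne, -, hg⟩ := (g i).2
  exact .inr ⟨p, hne, hp, hg⟩

lemma hereditary_vertex_mem (hI : IsTwoSidedIdealSet I) : Hereditary s r {v | vtx v ∈ I} := by
  rintro v hv w ⟨p, hp⟩
  have := (hI.2.2.2 (pathElt K s r p w) _ (hI.2.2.2 (ghostElt K s r p) _ hv).1).2
  rwa [mul_assoc, source_mul_pathElt K hp, ghostElt_mul_pathElt hp] at this

lemma sum_mem_ideal (hI : IsTwoSidedIdealSet I) {ι : Type} (t : Finset ι) (f : ι → LPA K s r)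
    (h : ∀ i ∈ t, f i ∈ I) : ∑ i ∈ t, f i ∈ I :=
  Finset.sum_induction f (· ∈ I) (fun a b ha hb => hI.2.1 a ha b hb) hI.1 h

lemma saturated_vertex_mem (hI : IsTwoSidedIdealSet I) : Saturated s r {v | vtx v ∈ I} := by
  intro v hfin hne h
  rw [Set.mem_ofPred_eq, vertex_eq_sum K s r v hfin hne]
  refine sum_mem_ideal hI _ _ fun e he => ?_
  rw [← edge_mul_range]
  exact (hI.2.2.2 _ _ (hI.2.2.2 _ _ (h e (by simpa using he))).1).2

lemma ideal_eq_zero_or_univ [Finite E] (hI : IsTwoSidedIdealSet I)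
    (hX : ∀ X : Set V, Hereditary s r X → Saturated s r X → X = ∅ ∨ X = Set.univ)
    (hL : ∀ (v : V) (es : List E), IsCycle s r v es → HasExit s es) :
    I = {0} ∨ I = Set.univ := by
  refine or_iff_not_imp_left.2 fun h0 => ?_
  obtain ⟨u, hu⟩ := exists_vertex_mem hI hL h0
  have h := (hX _ (hereditary_vertex_mem hI) (saturated_vertex_mem hI)).resolve_left
    (Set.Nonempty.ne_empty ⟨u, hu⟩)
  have h1 : (1 : LPA K s r) ∈ I := by
    rw [← sum_vertex]
    exact sum_mem_ideal hI _ _ fun v _ => (Set.eq_univ_iff_forall.1 h v :)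
  exact Set.eq_univ_of_forall fun x => by simpa using (hI.2.2.2 x 1 h1).1

end Reduction

section Representation

/-- A set of points over the vertices, in which the points over each vertex with an outgoing edge
form the disjoint union of the images under `push e`, for `e` an outgoing edge, of the points over
`r e`. The map `pull e` sends a point over `s e` to the edge whose image contains it together with
its preimage. -/
structure Branching (P : Type) (s r : E → V) where
  base : P → V
  push : E → P → P
  pull : E → P → E × P
  base_push : ∀ e a, base a = r e → base (push e a) = s e
  source_pull : ∀ e a, base a = s e → s (pull e a).1 = s e
  base_pull : ∀ e a, base a = s e → base (pull e a).2 = r (pull e a).1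
  push_pull : ∀ e a, base a = s e → push (pull e a).1 (pull e a).2 = a
  pull_push : ∀ e f a, s f = s e → base a = r e → pull f (push e a) = (e, a)

variable {s r} {X : Set V}

omit [Fintype V] in
lemma exists_branching [Finite E] (hH : Hereditary s r X) (hX : Saturated s r X) (k : ℤ) :
    ∃ B : Branching {a : V × ℤ // a.1 ∉ X} s r, (∀ a, B.base a = a.1.1) ∧
      ∀ e a, a.1.1 = r e → (∀ f, s f = s e → f = e) → (B.push e a).1 = (s e, a.1.2 + k) := by
  classical
  have key (v : V) (hv : v ∉ X ∧ ∃ e, s e = v) :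
      ∃ Θ : ({e // s e = v ∧ r e ∉ X} × ℤ) ≃ ℤ,
        ∀ e : {e // s e = v ∧ r e ∉ X}, (∀ f, s f = v → f = e) → ∀ n, Θ (e, n) = n + k := by
    obtain ⟨e, he⟩ : ∃ e, s e = v ∧ r e ∉ X := by
      by_contra! h
      exact hv.1 (hX v (Set.toFinite _) hv.2 h)
    by_cases hu : ∀ f, s f = v → f = e
    · have : Unique {e // s e = v ∧ r e ∉ X} := ⟨⟨⟨e, he⟩⟩, fun f => Subtype.ext (hu f f.2.1)⟩
      exact ⟨(Equiv.uniqueProd ℤ _).trans (Equiv.addRight k), fun e _ n => by simp⟩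
    · have : Nonempty {e // s e = v ∧ r e ∉ X} := ⟨⟨e, he⟩⟩
      obtain ⟨Θ⟩ := nonempty_equiv_of_countable (α := {e // s e = v ∧ r e ∉ X} × ℤ) (β := ℤ)
      exact ⟨Θ, fun e' h => absurd (fun f hf => (h f hf).trans (h e he.1).symm) hu⟩
  choose Θ hΘ using key
  have hs (e : E) (he : r e ∉ X) : s e ∉ X := fun h =>
    he (hH _ h _ ⟨[e], .cons e (.nil _)⟩)
  let push (e : E) (a : {a : V × ℤ // a.1 ∉ X}) : {a : V × ℤ // a.1 ∉ X} :=
    if he : r e ∉ X then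
      ⟨(s e, Θ (s e) ⟨hs e he, e, rfl⟩ (⟨e, rfl, he⟩, a.1.2)), hs e he⟩
    else a
  let pull (e : E) (a : {a : V × ℤ // a.1 ∉ X}) : E × {a : V × ℤ // a.1 ∉ X} :=
    if he : s e ∉ X then
      let x := (Θ (s e) ⟨he, e, rfl⟩).symm a.1.2
      (x.1, ⟨(r x.1, x.2), x.1.2.2⟩)
    else (e, a)
  have hpush (v : V) (hv : v ∉ X ∧ ∃ e, s e = v) (x : {e // s e = v ∧ r e ∉ X} × ℤ)
      (a : {a : V × ℤ // a.1 ∉ X}) (ha : a.1.2 = x.2) :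
      push x.1 a = ⟨(v, Θ v hv x), hv.1⟩ := by
    obtain ⟨⟨e, rfl, he⟩, n⟩ := x
    subst ha
    simp [push, he]
  have hpull (v : V) (hv : v ∉ X ∧ ∃ e, s e = v) (f : E) (hf : s f = v)
      (a : {a : V × ℤ // a.1 ∉ X}) (x : {e // s e = v ∧ r e ∉ X} × ℤ) (ha : Θ v hv x = a.1.2) :
      pull f a = (x.1.1, ⟨(r x.1, x.2), x.1.2.2⟩) := by
    subst hf
    simp [pull, hv.1, ← ha]
  have hex (e : E) (a : {a : V × ℤ // a.1 ∉ X}) (h : a.1.1 = s e) :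
      ∃ hv : s e ∉ X ∧ ∃ f, s f = s e, ∃ x, Θ (s e) hv x = a.1.2 :=
    ⟨⟨h ▸ a.2, e, rfl⟩, (Θ (s e) _).surjective _⟩
  have hr {e : E} {a : {a : V × ℤ // a.1 ∉ X}} (h : a.1.1 = r e) : r e ∉ X := h ▸ a.2
  have hpush' (e : E) (a : {a : V × ℤ // a.1 ∉ X}) (h : a.1.1 = r e) :=
    hpush (s e) ⟨hs e (hr h), e, rfl⟩ (⟨e, rfl, hr h⟩, a.1.2) a rfl
  refine ⟨⟨fun a => a.1.1, push, pull, fun e a h => ?_, fun e a h => ?_, fun e a h => ?_,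
    fun e a h => ?_, fun e f a hf h => ?_⟩, fun _ => rfl, fun e a h hu => ?_⟩
  · rw [hpush' e a h]
  · obtain ⟨hv, x, hx⟩ := hex e a h
    rw [hpull _ hv e rfl a x hx]
    exact x.1.2.1
  · obtain ⟨hv, x, hx⟩ := hex e a h
    rw [hpull _ hv e rfl a x hx]
  · obtain ⟨hv, x, hx⟩ := hex e a h
    rw [hpull _ hv e rfl a x hx, hpush _ hv x _ rfl]
    exact Subtype.ext (Prod.ext h.symm hx)
  · rw [hpush' e a h, hpull _ ⟨hs e (hr h), e, rfl⟩ f hf _ (⟨e, rfl, hr h⟩, a.1.2) rfl]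
    exact Prod.ext rfl (Subtype.ext (Prod.ext h.symm rfl))
  · exact (congrArg Subtype.val (hpush' e a h)).trans (Prod.ext rfl (hΘ _ _ _ hu _))

open Classical in
/-- Substitution along `g`, cut off outside `P`. -/
noncomputable def substOn {α : Type} (P : α → Prop) (g : α → α) : Module.End K (α → K) where
  toFun f a := if P a then f (g a) else 0
  map_add' f f' := by ext a; by_cases h : P a <;> simp [h]
  map_smul' k f := by ext a; by_cases h : P a <;> simp [h]

open Classical in
lemma substOn_apply {α : Type} (P : α → Prop) (g : α → α) (f : α → K) (a : α) :
    substOn K P g f a = if P a then f (g a) else 0 := rfl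

lemma substOn_mul {α : Type} (P Q : α → Prop) (g h : α → α) :
    substOn K P g * substOn K Q h = substOn K (fun a => P a ∧ Q (g a)) (h ∘ g) := by
  ext f a
  by_cases hP : P a <;> by_cases hQ : Q (g a) <;>
    simp [Module.End.mul_apply, substOn_apply, hP, hQ]

lemma substOn_congr {α : Type} {P Q : α → Prop} {g h : α → α} (hPQ : ∀ a, P a ↔ Q a)
    (hgh : ∀ a, P a → g a = h a) : substOn K P g = substOn K Q h := by
  ext f a
  by_cases hP : P a
  · simp [substOn_apply, hP, (hPQ a).1 hP, hgh a hP]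
  · simp [substOn_apply, hP, (hPQ a).not.1 hP]

lemma substOn_eq_zero {α : Type} {P : α → Prop} {g : α → α} (h : ∀ a, ¬P a) :
    substOn K P g = 0 := by
  ext f a
  simp [substOn_apply, h a]

namespace Branching

variable {P : Type} (B : Branching P s r)

/-- The operator by which a generator acts. -/
noncomputable def op : LPAGen V E → Module.End K (P → K)
  | .vertex v => substOn K (fun a => B.base a = v) id
  | .edge e => substOn K (fun a => B.base a = s e ∧ (B.pull e a).1 = e) fun a => (B.pull e a).2
  | .ghost e => substOn K (fun a => B.base a = r e) (B.push e)

lemma op_rel {x y : FreeAlgebra K (LPAGen V E)} (h : LPARel K s r x y) :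
    FreeAlgebra.lift K (B.op K) x = FreeAlgebra.lift K (B.op K) y := by
  cases h with
  | vertex_self v =>
    simp only [map_mul, FreeAlgebra.lift_ι_apply, op, substOn_mul]
    exact substOn_congr K (by simp) (by simp)
  | vertex_ne h =>
    simp only [map_mul, FreeAlgebra.lift_ι_apply, op, substOn_mul, map_zero]
    exact substOn_eq_zero K (by grind)
  | edge_left e =>
    simp only [map_mul, FreeAlgebra.lift_ι_apply, op, substOn_mul]
    exact substOn_congr K (by grind) (by simp)
  | edge_right e =>
    have := B.base_pull e
    simp only [map_mul, FreeAlgebra.lift_ι_apply, op, substOn_mul]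
    exact substOn_congr K (by grind) (by simp)
  | ghost_left e =>
    simp only [map_mul, FreeAlgebra.lift_ι_apply, op, substOn_mul]
    exact substOn_congr K (by grind) (by simp)
  | ghost_right e =>
    have := B.base_push e
    simp only [map_mul, FreeAlgebra.lift_ι_apply, op, substOn_mul]
    exact substOn_congr K (by grind) (by simp)
  | ck1_self e =>
    have := B.base_push e
    have := fun a => B.pull_push e e a rfl
    simp only [map_mul, FreeAlgebra.lift_ι_apply, op, substOn_mul]
    exact substOn_congr K (by grind) (by grind)
  | @ck1_ne e f h =>
    have := B.base_push e
    have := B.pull_push e f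
    simp only [map_mul, FreeAlgebra.lift_ι_apply, op, substOn_mul, map_zero]
    exact substOn_eq_zero K (by grind)
  | ck2 v hfin hne =>
    simp only [map_mul, map_sum, FreeAlgebra.lift_ι_apply, op, substOn_mul]
    ext f a
    rw [LinearMap.sum_apply, Finset.sum_apply]
    simp only [substOn_apply]
    obtain ⟨e₀, rfl⟩ := hne
    by_cases ha : B.base a = s e₀
    · have h1 := B.source_pull e₀ a ha
      have h2 := B.base_pull e₀ a ha
      have h3 := B.push_pull e₀ a ha
      have h4 (f : E) (hf : s f = s e₀) : B.pull f a = B.pull e₀ a := by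
        have := B.pull_push _ f (B.pull e₀ a).2 (hf.trans h1.symm) h2
        rwa [h3] at this
      rw [Finset.sum_eq_single (B.pull e₀ a).1]
      · simp [h1, h2, h3, h4, ha]
      · intro b hb hne
        have hb : s b = s e₀ := by simpa using hb
        simp [h4 b hb, hne.symm]
      · simp [h1]
    · rw [if_neg ha, Finset.sum_eq_zero]
      intro e he
      have : s e = s e₀ := by simpa using he
      rw [if_neg]
      grind
  | unit =>
    classical
    simp only [map_sum, FreeAlgebra.lift_ι_apply, op, map_one]
    ext f a
    rw [LinearMap.sum_apply, Finset.sum_apply]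
    simp [substOn_apply]

/-- The representation attached to a branching. -/
noncomputable def rep : LPA K s r →ₐ[K] Module.End K (P → K) :=
  RingQuot.liftAlgHom K ⟨FreeAlgebra.lift K (B.op K), fun _ _ h => B.op_rel K h⟩

lemma rep_gen (g : LPAGen V E) : B.rep K (gen K s r g) = B.op K g := by
  simp [rep, gen]

lemma rep_vertex_eq_zero {v : V} (h : ∀ a, B.base a ≠ v) : B.rep K (vtx v) = 0 := by
  rw [rep_gen]
  exact substOn_eq_zero K h

lemma rep_vertex_apply {v : V} {a : P} (h : B.base a = v) (f : P → K) :
    B.rep K (vtx v) f a = f a := by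
  simp [rep_gen, op, substOn_apply, h]

lemma rep_vertex_ne_zero {a : P} : B.rep K (vtx (B.base a)) ≠ 0 := fun h => by
  simpa [h] using B.rep_vertex_apply K rfl (a := a) (fun _ => 1)

end Branching

variable (s r) in
omit [Fintype V] in
lemma exists_branching_univ [Finite E] (k : ℤ) :
    ∃ B : Branching {a : V × ℤ // a.1 ∉ (∅ : Set V)} s r, (∀ a, B.base a = a.1.1) ∧
      ∀ e a, a.1.1 = r e → (∀ f, s f = s e → f = e) → (B.push e a).1 = (s e, a.1.2 + k) :=
  exists_branching (fun _ h => h.elim) (fun _ _ ⟨e, he⟩ h => (h e he).elim) k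

variable (s r) in
lemma vertex_ne_zero [Finite E] (v : V) : vtx v ≠ 0 := fun h => by
  obtain ⟨B, hB, -⟩ := exists_branching_univ s r 0
  refine B.rep_vertex_ne_zero K (a := ⟨(v, 0), by simp⟩) ?_
  rw [hB, h, map_zero]

lemma isTwoSidedIdealSet_ker {A : Type} [Ring A] [Algebra K A] (φ : LPA K s r →ₐ[K] A) :
    IsTwoSidedIdealSet {a | φ a = 0} := by
  refine ⟨map_zero φ, fun a ha b hb => ?_, fun a ha => ?_, fun x a ha => ⟨?_, ?_⟩⟩ <;>
    simp_all

lemma rep_path_apply {X : Set V} {B : Branching {a : V × ℤ // a.1 ∉ X} s r} {k : ℤ}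
    (hbase : ∀ a, B.base a = a.1.1)
    (hB : ∀ e a, a.1.1 = r e → (∀ f, s f = s e → f = e) → (B.push e a).1 = (s e, a.1.2 + k))
    {v w : V} {p : List E} (hp : IsPathFrom s r v w p) (hne : ¬HasExit s p)
    {a : {a : V × ℤ // a.1 ∉ X}} (ha : a.1.1 = v) :
    ∃ b : {a : V × ℤ // a.1 ∉ X}, b.1 = (w, a.1.2 - k * p.length) ∧
      ∀ f, B.rep K (pathElt K s r p w) f a = f b := by
  induction p generalizing v a with
  | nil =>
    cases hp
    refine ⟨a, by simp [← ha], fun f => ?_⟩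
    rw [pathElt_nil, B.rep_vertex_apply K ((hbase a).trans ha)]
  | cons e p ih =>
    obtain ⟨rfl, hp'⟩ := isPathFrom_cons_iff.1 hp
    have hu (f : E) (hf : s f = s e) : f = e := by
      by_contra h
      exact hne ⟨f, e, by simp, hf, h⟩
    have ha' := (hbase a).trans ha
    have he : (B.pull e a).1 = e := hu _ (B.source_pull e a ha')
    have h2 := B.base_pull e a ha'
    have h3 := B.push_pull e a ha'
    rw [he, hbase] at h2
    rw [he] at h3
    have h4 := congrArg Prod.snd (hB e _ h2 hu)
    rw [h3] at h4
    obtain ⟨b, hb, hf⟩ := ih hp' (fun h => hne (hasExit_of_subset h (by simp))) h2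
    refine ⟨b, ?_, fun f => ?_⟩
    · rw [hb, h4]
      push_cast [List.length_cons]
      ring_nf
    · rw [pathElt_cons, map_mul, Module.End.mul_apply, B.rep_gen K, ← hf f]
      simp [Branching.op, substOn_apply, ha', he]

lemma eq_empty_or_univ_of_simple [Finite E]
    (h : ∀ I : Set (LPA K s r), IsTwoSidedIdealSet I → I = {0} ∨ I = Set.univ)
    (hH : Hereditary s r X) (hX : Saturated s r X) : X = ∅ ∨ X = Set.univ := by
  by_contra! hne
  obtain ⟨⟨v, hv⟩, hne⟩ := hne
  obtain ⟨w, hw⟩ := (Set.ne_univ_iff_exists_notMem X).1 hne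
  obtain ⟨B, hB, -⟩ := exists_branching hH hX 0
  rcases h _ (isTwoSidedIdealSet_ker K (B.rep K)) with hI | hI
  · have hv0 : vtx v ∈ {a | B.rep K a = 0} :=
      B.rep_vertex_eq_zero K fun a ha => a.2 (by rwa [← hB, ha])
    rw [hI] at hv0
    exact vertex_ne_zero K s r v hv0
  · have := B.rep_vertex_ne_zero K (a := ⟨(w, 0), hw⟩)
    exact this (Set.eq_univ_iff_forall.1 hI (vtx _))

lemma hasExit_of_simple [Finite E]
    (h : ∀ I : Set (LPA K s r), IsTwoSidedIdealSet I → I = {0} ∨ I = Set.univ)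
    {v : V} {c : List E} (hc : IsCycle s r v c) : HasExit s c := by
  by_contra hne
  obtain ⟨B, hbase, hB⟩ := exists_branching_univ s r 0
  rcases h _ (isTwoSidedIdealSet_ker K (B.rep K)) with hI | hI
  · have hmem : pathElt K s r c v - vtx v ∈ {a | B.rep K a = 0} := by
      change B.rep K (pathElt K s r c v - vtx v) = 0
      have : pathElt K s r c v - vtx v = vtx v * (pathElt K s r c v - vtx v) := by
        rw [mul_sub, source_mul_pathElt K hc.2.1, vertex_mul_self]
      ext f a
      by_cases ha : B.base a = v
      · obtain ⟨b, hb, hf⟩ := rep_path_apply K hbase hB hc.2.1 hne ((hbase a).symm.trans ha)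
        have : b = a := Subtype.ext (by rw [hb, ← ha, hbase]; simp)
        simp [hf, B.rep_vertex_apply K ha, this]
      · rw [this, map_mul, Module.End.mul_apply, B.rep_gen K]
        simp [Branching.op, substOn_apply, ha]
    rw [hI, Set.mem_singleton_iff, sub_eq_zero] at hmem
    obtain ⟨B', hbase', hB'⟩ := exists_branching_univ s r 1
    let a : {a : V × ℤ // a.1 ∉ (∅ : Set V)} := ⟨(v, 0), by simp⟩
    obtain ⟨b, hb, hf⟩ := rep_path_apply K hbase' hB' hc.2.1 hne (a := a) rfl
    have hba : b ≠ a := fun hab => by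
      have := congrArg Prod.snd hb
      simp [hab, a, hc.1] at this
    classical
    have := hf (Pi.single a 1)
    rw [hmem, B'.rep_vertex_apply K (hbase' a)] at this
    simp [hba] at this
  · have := B.rep_vertex_ne_zero K (a := ⟨(v, 0), by simp⟩)
    exact this (Set.eq_univ_iff_forall.1 hI (vtx _))

end Representation

end LPA

/-- **The Abrams / Aranda Pino Simplicity Theorem.**  For a finite graph `E` and any field
`K`, the Leavitt path algebra `L_K(E)` is simple (its only two-sided ideals are `{0}` and
`L_K(E)`) if and only if the only hereditary saturated subsets of `E⁰` are trivial and
every cycle in `E` has an exit. -/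
theorem simplicity_theorem (K V E : Type) [Field K] [Fintype V] [Fintype E] (s r : E → V) :
    (∀ I : Set (LPA K s r), IsTwoSidedIdealSet I → I = {0} ∨ I = Set.univ) ↔
      ((∀ X : Set V, Hereditary s r X → Saturated s r X → X = ∅ ∨ X = Set.univ) ∧
        (∀ (v : V) (es : List E), IsCycle s r v es → HasExit s es)) := by
  constructor
  · exact fun h => ⟨fun X => LPA.eq_empty_or_univ_of_simple K h,
      fun v es => LPA.hasExit_of_simple K h⟩
  · exact fun ⟨hX, hL⟩ I hI => LPA.ideal_eq_zero_or_univ hI hX hL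
end

section
/- Let E be a finite directed graph and K any field. Then there is a monoid isomorphism V(L_K(E)) ≅ M_E, where V(L_K(E)) is the monoid of Murray–von Neumann equivalence classes of idempotent matrices over L_K(E) and M_E is the graph monoid of E. -/
variable (K : Type) [Field K] {V E : Type} [Fintype V] (s r : E → V)

def vertexEl (v : V) : LPA K s r := gen K s r (LPAGen.vertex v)
def edgeEl (e : E) : LPA K s r := gen K s r (LPAGen.edge e)
def ghostEl (e : E) : LPA K s r := gen K s r (LPAGen.ghost e)

/-- The defining relations of the graph monoid `M_E`: for each non-sink `v`,
`a_v = ∑_{s(e) = v} a_{r(e)}`, as a relation on the free commutative monoid `V →₀ ℕ`. -/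
inductive GMRel {V E : Type} (s r : E → V) : (V →₀ ℕ) → (V →₀ ℕ) → Prop
  | ck (v : V) (h : {e : E | s e = v}.Finite) (hne : {e : E | s e = v}.Nonempty) :
      GMRel s r (Finsupp.single v 1) (h.toFinset.sum fun e => Finsupp.single (r e) 1)

/-- The graph monoid `M_E`: the free commutative monoid on the vertices of `E`, modulo
the relations `a_v = ∑_{s(e) = v} a_{r(e)}` for each non-sink `v`. -/
abbrev GraphMonoid {V E : Type} (s r : E → V) : Type :=
  (addConGen (GMRel s r)).Quotient

/-- The type of idempotent square matrices (of arbitrary finite size) over a ring. -/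
def IdemMat (A : Type) [Ring A] : Type :=
  Σ k : ℕ, {e : Matrix (Fin k) (Fin k) A // e * e = e}

/-- Murray–von Neumann equivalence of idempotent matrices: `e ∼ f` iff there are
rectangular matrices `x, y` with `x y = e` and `y x = f`. -/
def MvNEq {A : Type} [Ring A] (p q : IdemMat A) : Prop :=
  ∃ (x : Matrix (Fin p.1) (Fin q.1) A) (y : Matrix (Fin q.1) (Fin p.1) A),
    x * y = p.2.1 ∧ y * x = q.2.1

/-- The block-diagonal sum `diag(e, f)` of two square matrices. -/
def blockSum {A : Type} [Ring A] {k l : ℕ}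
    (e : Matrix (Fin k) (Fin k) A) (f : Matrix (Fin l) (Fin l) A) :
    Matrix (Fin (k + l)) (Fin (k + l)) A :=
  Matrix.reindex finSumFinEquiv finSumFinEquiv (Matrix.fromBlocks e 0 0 f)

namespace LeavittPath

open scoped Classical

section Relations

local notation "𝓛" => LPA K s r
local notation "vx" => vertexEl K s r
local notation "ed" => edgeEl K s r
local notation "gh" => ghostEl K s r

lemma vertex_mul_self (v : V) : vx v * vx v = vx v := by
  simpa [vertexEl, gen] using RingQuot.mkAlgHom_rel K (LPARel.vertex_self (K := K) (s := s) (r := r) v)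

lemma vertex_mul_ne {v w : V} (h : v ≠ w) : vx v * vx w = 0 := by
  simpa [vertexEl, gen] using
    RingQuot.mkAlgHom_rel K (LPARel.vertex_ne (K := K) (s := s) (r := r) h)

lemma vertex_mul (v w : V) : vx v * vx w = if v = w then vx v else 0 := by
  split_ifs with h
  · subst h
    exact vertex_mul_self K s r v
  · exact vertex_mul_ne K s r h

lemma source_mul_edge (e : E) : vx (s e) * ed e = ed e := by
  simpa [vertexEl, edgeEl, gen] using
    RingQuot.mkAlgHom_rel K (LPARel.edge_left (K := K) (s := s) (r := r) e)

lemma edge_mul_range (e : E) : ed e * vx (r e) = ed e := by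
  simpa [vertexEl, edgeEl, gen] using
    RingQuot.mkAlgHom_rel K (LPARel.edge_right (K := K) (s := s) (r := r) e)

lemma range_mul_ghost (e : E) : vx (r e) * gh e = gh e := by
  simpa [vertexEl, ghostEl, gen] using
    RingQuot.mkAlgHom_rel K (LPARel.ghost_left (K := K) (s := s) (r := r) e)

lemma ghost_mul_source (e : E) : gh e * vx (s e) = gh e := by
  simpa [vertexEl, ghostEl, gen] using
    RingQuot.mkAlgHom_rel K (LPARel.ghost_right (K := K) (s := s) (r := r) e)

lemma ghost_mul_edge_self (e : E) : gh e * ed e = vx (r e) := by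
  simpa [vertexEl, ghostEl, edgeEl, gen] using
    RingQuot.mkAlgHom_rel K (LPARel.ck1_self (K := K) (s := s) (r := r) e)

lemma ghost_mul_edge_ne {e f : E} (h : e ≠ f) : gh e * ed f = 0 := by
  simpa [vertexEl, ghostEl, edgeEl, gen] using
    RingQuot.mkAlgHom_rel K (LPARel.ck1_ne (K := K) (s := s) (r := r) h)

lemma vertex_eq_sum (v : V) (h : {e : E | s e = v}.Finite) (hne : {e : E | s e = v}.Nonempty) :
    vx v = ∑ e ∈ h.toFinset, ed e * gh e := by
  simpa [vertexEl, ghostEl, edgeEl, gen] using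
    RingQuot.mkAlgHom_rel K (LPARel.ck2 (K := K) (s := s) (r := r) v h hne)

lemma sum_vertex : ∑ v, vx v = 1 := by
  simpa [vertexEl, gen] using
    RingQuot.mkAlgHom_rel K (LPARel.unit (K := K) (s := s) (r := r))

lemma vertex_mul_edge (v : V) (e : E) : vx v * ed e = if v = s e then ed e else 0 := by
  rw [← source_mul_edge K s r e, ← mul_assoc, vertex_mul]
  split_ifs with h <;> simp [h]

lemma ghost_mul_vertex (v : V) (e : E) : gh e * vx v = if s e = v then gh e else 0 := by
  rw [← ghost_mul_source K s r e, mul_assoc, vertex_mul]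
  split_ifs with h <;> simp

/-- An induction principle for the Leavitt path algebra. -/
lemma lpa_induction {P : 𝓛 → Prop} (hs : ∀ c : K, P (algebraMap K _ c)) (hv : ∀ v, P (vx v))
    (he : ∀ e, P (ed e)) (hg : ∀ e, P (gh e)) (hadd : ∀ x y, P x → P y → P (x + y))
    (hmul : ∀ x y, P x → P y → P (x * y)) (x : 𝓛) : P x := by
  obtain ⟨a, rfl⟩ := RingQuot.mkAlgHom_surjective K (LPARel K s r) x
  induction a using FreeAlgebra.induction with
  | grade0 c => simpa using hs c
  | grade1 g => cases g with
    | vertex v => exact hv v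
    | edge e => exact he e
    | ghost e => exact hg e
  | mul a b ha hb => simpa using hmul _ _ ha hb
  | add a b ha hb => simpa using hadd _ _ ha hb

/-! ### Words in the edges -/

/-- The product in the Leavitt path algebra of the edges of a word. -/
def word : FreeMonoid E →* 𝓛 := FreeMonoid.lift (edgeEl K s r)

local notation "wd" => word K s r

@[simp] lemma word_of (e : E) : wd (FreeMonoid.of e) = ed e := by simp [word]

/-- A word of edges is a path from `u` to `v`. -/
def IsPath {V E : Type} (s r : E → V) : V → V → List E → Prop
  | u, v, [] => u = v
  | u, v, e :: l => s e = u ∧ IsPath s r (r e) v l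

lemma IsPath.append {V E : Type} {s r : E → V} {u v w : V} {p q : List E} (hp : IsPath s r u v p) (hq : IsPath s r v w q) :
    IsPath s r u w (p ++ q) := by
  induction p generalizing u with
  | nil => cases hp; exact hq
  | cons e p ih => exact ⟨hp.1, ih hp.2⟩

lemma IsPath.of_append_right {V E : Type} {s r : E → V} {u v w : V} {p q : List E} (h : IsPath s r u w (p ++ q))
    (hq : IsPath s r v w q) (hne : q ≠ [] ∨ v = w) : IsPath s r u v p := by
  induction p generalizing u with
  | nil =>
    cases q with
    | nil =>
      have h' : u = w := h
      have hq' : v = w := hq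
      exact h'.trans hq'.symm
    | cons e q => exact h.1.symm.trans hq.1
  | cons e p ih => exact ⟨h.1, ih h.2⟩

lemma vertex_mul_word_mul_vertex (u v : V) (w : FreeMonoid E) :
    vx u * wd w * vx v = if IsPath s r u v w.toList then vx u * wd w else 0 := by
  induction w using FreeMonoid.inductionOn' generalizing u with
  | one => simp [IsPath, vertex_mul]
  | of_mul e w ih =>
    have h := ih (r e)
    rw [map_mul, word_of, ← mul_assoc (vx u), vertex_mul_edge]
    by_cases hu : u = s e
    · subst hu
      rw [if_pos rfl]
      have h1 : ed e * wd w = ed e * (vx (r e) * wd w) := by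
        rw [← mul_assoc, edge_mul_range]
      rw [h1, mul_assoc, h]
      simp only [FreeMonoid.toList_of_mul, IsPath, true_and]
      split_ifs <;> simp
    · simp [hu, IsPath, Ne.symm hu]

lemma vertex_mul_word_of_isPath {u v : V} {w : FreeMonoid E} (h : IsPath s r u v w.toList) :
    vx u * wd w = wd w * vx v := by
  induction w using FreeMonoid.inductionOn' generalizing u with
  | one => cases h; simp
  | of_mul e w ih =>
    have h1 : s e = u := h.1
    have h2 := ih (u := r e) h.2
    subst h1
    rw [map_mul, word_of, ← mul_assoc, source_mul_edge, mul_assoc, ← h2, ← mul_assoc,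
      edge_mul_range]

lemma ghost_mul_edge (e f : E) : gh e * ed f = if e = f then vx (r e) else 0 := by
  split_ifs with h
  · subst h
    exact ghost_mul_edge_self K s r e
  · exact ghost_mul_edge_ne K s r h

/-! ### The span of the paths and its ideals -/

/-- A vertex emitting no edges. -/
def IsSink {V E : Type} (s : E → V) (v : V) : Prop := ∀ e, s e ≠ v

/-- The span of the paths that have length at least `n` or end at a sink. -/
def longPaths (n : ℕ) : Submodule K 𝓛 :=
  Submodule.span K {x | ∃ (w : FreeMonoid E) (u : V), (n ≤ w.length ∨ IsSink s u) ∧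
    wd w * vx u = x}

/-- The span of the paths of positive length. -/
def posPaths : Submodule K 𝓛 :=
  Submodule.span K {x | ∃ (w : FreeMonoid E) (u : V), 1 ≤ w.length ∧ wd w * vx u = x}

local notation "𝓙" => longPaths K s r

lemma word_mul_vertex_mem {n : ℕ} {w : FreeMonoid E} {u : V} (h : n ≤ w.length ∨ IsSink s u) :
    wd w * vx u ∈ 𝓙 n :=
  Submodule.subset_span ⟨w, u, h, rfl⟩

lemma longPaths_anti {m n : ℕ} (h : m ≤ n) : 𝓙 n ≤ 𝓙 m := by
  refine Submodule.span_mono ?_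
  rintro x ⟨w, u, hw, rfl⟩
  exact ⟨w, u, hw.imp_left h.trans, rfl⟩

lemma posPaths_le : posPaths K s r ≤ 𝓙 1 := by
  refine Submodule.span_mono ?_
  rintro x ⟨w, u, hw, rfl⟩
  exact ⟨w, u, .inl hw, rfl⟩

lemma vertex_mul_word_mem {n : ℕ} (u v : V) {w : FreeMonoid E} (h : n ≤ w.length ∨ IsSink s v) :
    vx u * (wd w * vx v) ∈ 𝓙 n := by
  rw [← mul_assoc, vertex_mul_word_mul_vertex]
  split_ifs with hp
  · rw [vertex_mul_word_of_isPath K s r hp]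
    exact word_mul_vertex_mem K s r h
  · exact zero_mem _

lemma mul_mem_of_span {S T U : Submodule K 𝓛} {A B : Set 𝓛} (hS : S = Submodule.span K A)
    (hT : T = Submodule.span K B) (h : ∀ a ∈ A, ∀ b ∈ B, a * b ∈ U) {x y : 𝓛} (hx : x ∈ S)
    (hy : y ∈ T) : x * y ∈ U := by
  have h1 : S * T ≤ U := by
    rw [hS, hT, Submodule.span_mul_span, Submodule.span_le]
    rintro _ ⟨a, ha, b, hb, rfl⟩
    exact h a ha b hb
  exact h1 (Submodule.mul_mem_mul hx hy)

lemma word_mul_word_mem {k : ℕ} {w w' : FreeMonoid E} {u u' : V}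
    (hk : k ≤ w.length + w'.length ∨ IsSink s u') :
    wd w * vx u * (wd w' * vx u') ∈ 𝓙 k := by
  rw [mul_assoc, ← mul_assoc (vx u), vertex_mul_word_mul_vertex]
  split_ifs with hp
  · rw [vertex_mul_word_of_isPath K s r hp, ← mul_assoc, ← map_mul]
    refine word_mul_vertex_mem K s r ?_
    simpa using hk
  · simp

lemma paths_mul_longPaths {n : ℕ} {x y : 𝓛} (hx : x ∈ 𝓙 0) (hy : y ∈ 𝓙 n) : x * y ∈ 𝓙 n := by
  refine mul_mem_of_span K s r rfl rfl ?_ hx hy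
  rintro _ ⟨w, u, -, rfl⟩ _ ⟨w', u', h, rfl⟩
  exact word_mul_word_mem K s r (h.imp_left fun h => by omega)

lemma posPaths_mul_longPaths {n : ℕ} {x y : 𝓛} (hx : x ∈ posPaths K s r) (hy : y ∈ 𝓙 n) :
    x * y ∈ 𝓙 (n + 1) := by
  refine mul_mem_of_span K s r rfl rfl ?_ hx hy
  rintro _ ⟨w, u, h', rfl⟩ _ ⟨w', u', h, rfl⟩
  exact word_mul_word_mem K s r (h.imp_left fun h => by omega)

lemma longPaths_mul_edge {n : ℕ} {x : 𝓛} (hx : x ∈ 𝓙 n) (e : E) : x * ed e ∈ 𝓙 (n + 1) := by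
  have hy : ed e ∈ Submodule.span K {ed e} := Submodule.subset_span rfl
  refine mul_mem_of_span K s r rfl rfl ?_ hx hy
  rintro _ ⟨w, u, h, rfl⟩ _ rfl
  rw [mul_assoc, vertex_mul_edge]
  split_ifs with hu
  · rw [← edge_mul_range, ← word_of, ← mul_assoc, ← map_mul]
    refine word_mul_vertex_mem K s r (.inl ?_)
    rcases h with h | h
    · simpa using h
    · exact absurd hu.symm (h e)
  · simp

lemma one_mem_paths : (1 : 𝓛) ∈ 𝓙 0 := by
  rw [← sum_vertex]
  exact Submodule.sum_mem _ fun v _ => by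
    simpa using word_mul_vertex_mem K s r (n := 0) (w := 1) (u := v) (.inl (by simp))

lemma vertex_mem_paths (v : V) : vx v ∈ 𝓙 0 := by
  simpa using word_mul_vertex_mem K s r (n := 0) (w := 1) (u := v) (.inl (by simp))

lemma edge_mem_paths (e : E) : ed e ∈ 𝓙 0 := by
  have := longPaths_anti K s r (Nat.zero_le 1)
    (longPaths_mul_edge K s r (one_mem_paths K s r) e)
  simpa using this

lemma sink_vertex_mem {v : V} (h : IsSink s v) (n : ℕ) : vx v ∈ 𝓙 n := by
  simpa using word_mul_vertex_mem K s r (n := n) (w := 1) (u := v) (.inr h)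

lemma paths_mul_sink {v : V} (h : IsSink s v) (n : ℕ) {x : 𝓛} (hx : x ∈ 𝓙 0) :
    x * vx v ∈ 𝓙 n :=
  paths_mul_longPaths K s r hx (sink_vertex_mem K s r h n)

/-- The ghost edges strip the first edge of a path. -/
lemma ghost_mul_longPaths (e : E) {n : ℕ} {x : 𝓛} (hx : x ∈ 𝓙 (n + 1)) : gh e * x ∈ 𝓙 n := by
  have hy : gh e ∈ Submodule.span K {gh e} := Submodule.subset_span rfl
  refine mul_mem_of_span K s r rfl rfl ?_ hy hx
  rintro _ rfl _ ⟨w, u, h, rfl⟩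
  induction w using FreeMonoid.casesOn with
  | one =>
    have hu : IsSink s u := by simpa using h
    simp [ghost_mul_vertex, hu e]
  | of_mul f w =>
    rw [map_mul, word_of, mul_assoc, ← mul_assoc, ghost_mul_edge]
    split_ifs with hef
    · exact vertex_mul_word_mem K s r _ _ (h.imp_left fun h => by simpa [add_comm] using h)
    · simp

/-- `x` multiplies all sufficiently long paths into the span of the paths. -/
def Den (n : ℕ) (x : 𝓛) : Prop := ∀ y ∈ 𝓙 n, x * y ∈ 𝓙 0

variable {K s r} in
lemma Den.mono {m n : ℕ} (h : m ≤ n) {x : 𝓛} (hx : Den K s r m x) : Den K s r n x :=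
  fun y hy => hx y (longPaths_anti K s r h hy)

variable {K s r} in
lemma Den.add {n : ℕ} {x y : 𝓛} (hx : Den K s r n x) (hy : Den K s r n y) :
    Den K s r n (x + y) := fun z hz => by
  rw [add_mul]
  exact add_mem (hx z hz) (hy z hz)

lemma den_of_mem {x : 𝓛} (hx : x ∈ 𝓙 0) : Den K s r 0 x :=
  fun _ hy => paths_mul_longPaths K s r hx hy

variable {K s r} in
lemma Den.mem {x : 𝓛} (hx : Den K s r 0 x) : x ∈ 𝓙 0 := by
  simpa using hx 1 (one_mem_paths K s r)

lemma mem_of_den_mul_vertex {n : ℕ} {x : 𝓛} {u : V} (hx : Den K s r n x) (hu : x * vx u = x)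
    (h : n = 0 ∨ IsSink s u) : x ∈ 𝓙 0 := by
  rcases h with rfl | h
  · exact hx.mem
  · rw [← hu]
    exact hx _ (sink_vertex_mem K s r h n)

variable {K s r} in
lemma Den.mul {m n : ℕ} {x y : 𝓛} (hx : Den K s r n x) (hy : Den K s r m y) :
    Den K s r (m + n) (x * y) := by
  have key : ∀ z ∈ 𝓙 (m + n), y * z ∈ 𝓙 n := by
    intro z hz
    have h1 : y ∈ Submodule.span K {y} := Submodule.subset_span rfl
    refine mul_mem_of_span K s r rfl rfl ?_ h1 hz
    rintro y' hy' _ ⟨w, u, h, rfl⟩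
    rw [Set.mem_singleton_iff.1 hy']
    rcases h with h | h
    · obtain ⟨w₁, w₂, rfl, h₁, h₂⟩ : ∃ w₁ w₂ : FreeMonoid E,
          w = w₁ * w₂ ∧ m ≤ w₁.length ∧ n ≤ w₂.length := by
        refine ⟨FreeMonoid.ofList (w.toList.take m), FreeMonoid.ofList (w.toList.drop m), ?_, ?_, ?_⟩
        · apply FreeMonoid.toList.injective
          simp
        · have : m ≤ w.toList.length := (Nat.le_add_right m n).trans h
          simp [FreeMonoid.length, this]
        · have : m + n ≤ w.toList.length := h
          simp only [FreeMonoid.length, FreeMonoid.toList_ofList, List.length_drop]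
          omega
      have h3 : _ := word_mul_vertex_mem K s r (n := n) (w := w₂) (u := u) (.inl h₂)
      have h4 : y * wd w₁ = ∑ v, y * (wd w₁ * vx v) := by
        rw [← Finset.mul_sum, ← Finset.mul_sum, sum_vertex, mul_one]
      rw [map_mul, mul_assoc, ← mul_assoc y, h4]
      refine paths_mul_longPaths K s r (Submodule.sum_mem _ fun v _ => ?_) h3
      exact hy _ (word_mul_vertex_mem K s r (.inl h₁))
    · have h3 := hy _ (word_mul_vertex_mem K s r (n := m) (w := w) (u := u) (.inr h))
      have := paths_mul_sink K s r h n h3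
      rwa [mul_assoc, mul_assoc, vertex_mul_self] at this
  intro z hz
  rw [mul_assoc]
  exact hx _ (key z hz)

lemma exists_den (x : 𝓛) : ∃ n, Den K s r n x := by
  induction x using lpa_induction K s r with
  | hs c =>
    refine ⟨0, den_of_mem K s r ?_⟩
    rw [Algebra.algebraMap_eq_smul_one]
    exact Submodule.smul_mem _ _ (one_mem_paths K s r)
  | hv v => exact ⟨0, den_of_mem K s r (vertex_mem_paths K s r v)⟩
  | he e => exact ⟨0, den_of_mem K s r (edge_mem_paths K s r e)⟩
  | hg e => exact ⟨1, fun y hy => ghost_mul_longPaths K s r e hy⟩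
  | hadd x y hx hy =>
    obtain ⟨m, hm⟩ := hx
    obtain ⟨n, hn⟩ := hy
    exact ⟨max m n, (hm.mono (le_max_left _ _)).add (hn.mono (le_max_right _ _))⟩
  | hmul x y hx hy =>
    obtain ⟨m, hm⟩ := hx
    obtain ⟨n, hn⟩ := hy
    exact ⟨_, hm.mul hn⟩

end Relations

section Representation

local notation "𝓛" => LPA K s r
local notation "vx" => vertexEl K s r
local notation "ed" => edgeEl K s r
local notation "gh" => ghostEl K s r
local notation "wd" => word K s r
local notation "𝓙" => longPaths K s r

/-- A bijection that extends prepending a letter out of a nonempty set of letters. -/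
lemma exists_prepend_equiv {E : Type} [Countable E] (S : E → Prop) [Nonempty {e // S e}] :
    ∃ θ : {e // S e} × (List E ⊕ ℕ) ≃ List E ⊕ ℕ, ∀ e w, θ (e, .inl w) = .inl (e.1 :: w) := by
  let f : {x : {e // S e} × (List E ⊕ ℕ) | ∃ w, x.2 = .inl w} ↪ List E ⊕ ℕ :=
    ⟨fun x => .inl (x.1.1.1 :: x.2.choose), by
      rintro ⟨⟨e, x⟩, hx⟩ ⟨⟨e', x'⟩, hx'⟩ h
      have h1 : x = .inl hx.choose := hx.choose_spec
      have h2 : x' = .inl hx'.choose := hx'.choose_spec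
      simp only [Sum.inl.injEq, List.cons.injEq] at h
      ext1
      refine Prod.ext (Subtype.ext h.1) ?_
      change x = x'
      rw [h1, h2]
      exact congrArg _ h.2⟩
  have hf : ∀ (e : {e // S e}) (w : List E), f ⟨(e, .inl w), w, rfl⟩ = .inl (e.1 :: w) := by
    intro e w
    have h : ∃ w', (e, (Sum.inl w : List E ⊕ ℕ)).2 = Sum.inl w' := ⟨w, rfl⟩
    have h' : w = h.choose := Sum.inl_injective h.choose_spec
    change Sum.inl (e.1 :: h.choose) = _
    rw [← h']
  obtain ⟨e₀⟩ := ‹Nonempty {e // S e}›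
  have i1 : Infinite ({x : {e // S e} × (List E ⊕ ℕ) | ∃ w, x.2 = .inl w}ᶜ : Set _) :=
    Infinite.of_injective (fun n : ℕ => ⟨(e₀, .inr n), by simp⟩) fun m n h => by simpa using h
  have i2 : Infinite ((Set.range f)ᶜ : Set (List E ⊕ ℕ)) :=
    Infinite.of_injective (fun n : ℕ => ⟨.inr n, by rintro ⟨x, hx⟩; cases hx⟩)
      fun m n h => by simpa using h
  obtain ⟨g, hg⟩ := Cardinal.extend_function f (nonempty_equiv_of_countable)
  exact ⟨g, fun e w => (hg ⟨(e, .inl w), w, rfl⟩).trans (hf e w)⟩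

/-- The Leavitt path algebra acts on a vector space containing all words in the edges. -/
lemma exists_representation [Countable E] :
    ∃ ρ : 𝓛 →ₐ[K] Module.End K (V × (List E ⊕ ℕ) →₀ K),
      (∀ v u x, ρ (vx v) (.single (u, x) 1) = if u = v then .single (u, x) 1 else 0) ∧
      ∀ e u w, ρ (ed e) (.single (u, .inl w) 1) =
        if u = r e then .single (s e, .inl (e :: w)) 1 else 0 := by
  have hθ : ∀ v, ∀ _ : Nonempty {e // s e = v}, _ :=
    fun v h => exists_prepend_equiv (fun e => s e = v)
  choose θ hθ using hθ
  let φ : LPAGen V E → Module.End K (V × (List E ⊕ ℕ) →₀ K)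
    | .vertex v => Finsupp.linearCombination K fun p => if p.1 = v then .single p 1 else 0
    | .edge e => Finsupp.linearCombination K fun p =>
        if p.1 = r e then .single (s e, θ (s e) ⟨e, rfl⟩ (⟨e, rfl⟩, p.2)) 1 else 0
    | .ghost e => Finsupp.linearCombination K fun p =>
        if p.1 = s e then
          if ((θ (s e) ⟨e, rfl⟩).symm p.2).1 = ⟨e, rfl⟩ then
            .single (r e, ((θ (s e) ⟨e, rfl⟩).symm p.2).2) 1 else 0
        else 0
  have hv : ∀ v u x, φ (.vertex v) (.single (u, x) 1) = if u = v then .single (u, x) 1 else 0 :=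
    fun v u x => by simp [φ]
  have he : ∀ e u x, φ (.edge e) (.single (u, x) 1) =
      if u = r e then .single (s e, θ (s e) ⟨e, rfl⟩ (⟨e, rfl⟩, x)) 1 else 0 :=
    fun v u x => by simp [φ]
  have hg : ∀ e u x, φ (.ghost e) (.single (u, x) 1) = if u = s e then
          if ((θ (s e) ⟨e, rfl⟩).symm x).1 = ⟨e, rfl⟩ then
            .single (r e, ((θ (s e) ⟨e, rfl⟩).symm x).2) 1 else 0
        else 0 :=
    fun v u x => by simp [φ]
  have hext : ∀ f g : Module.End K (V × (List E ⊕ ℕ) →₀ K),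
      (∀ u x, f (.single (u, x) 1) = g (.single (u, x) 1)) → f = g := fun f g h =>
    Finsupp.lhom_ext' fun p => LinearMap.ext_ring (h p.1 p.2)
  have hrel : ∀ ⦃a b⦄, LPARel K s r a b → FreeAlgebra.lift K φ a = FreeAlgebra.lift K φ b := by
    intro a b h
    refine hext _ _ fun u x => ?_
    cases h with
    | vertex_self v =>
      simp only [map_mul, FreeAlgebra.lift_ι_apply, Module.End.mul_apply, hv]
      split_ifs with h <;> simp [hv, h]
    | vertex_ne hvw =>
      simp only [map_mul, map_zero, FreeAlgebra.lift_ι_apply, Module.End.mul_apply, hv]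
      split_ifs with h
      · subst h
        simp [hv, Ne.symm hvw]
      · simp
    | edge_left e =>
      simp only [map_mul, FreeAlgebra.lift_ι_apply, Module.End.mul_apply, he]
      split_ifs with h <;> simp [hv]
    | edge_right e =>
      simp only [map_mul, FreeAlgebra.lift_ι_apply, Module.End.mul_apply, hv, he]
      split_ifs with h <;> simp [he, h]
    | ghost_left e =>
      simp only [map_mul, FreeAlgebra.lift_ι_apply, Module.End.mul_apply, hg]
      split_ifs with h <;> simp [hv]
    | ghost_right e =>
      simp only [map_mul, FreeAlgebra.lift_ι_apply, Module.End.mul_apply, hv, hg]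
      by_cases h : u = s e <;> simp [hg, h]
    | ck1_self e =>
      simp only [map_mul, FreeAlgebra.lift_ι_apply, Module.End.mul_apply, hv, he]
      split_ifs with h <;> simp [hg, h]
    | @ck1_ne e f hef =>
      simp only [map_mul, map_zero, FreeAlgebra.lift_ι_apply, Module.End.mul_apply, he]
      split_ifs with h
      · rw [hg]
        split_ifs with h1 h2
        · exfalso
          have key : ∀ (v v' : V) (e' f' : E) (hv : s e' = v) (hv' : s f' = v') (_ : v = v') y,
            ((θ v ⟨e', hv⟩).symm (θ v' ⟨f', hv'⟩ (⟨f', hv'⟩, y))).1 = ⟨e', hv⟩ → e' = f' := by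
            rintro v _ e' f' hv hv' rfl y h
            rw [Equiv.symm_apply_apply] at h
            exact (congrArg Subtype.val h).symm
          exact hef (key _ _ e f rfl rfl h1.symm x h2)
        · rfl
        · rfl
      · simp
    | ck2 v hfin hne =>
      simp only [map_sum, map_mul, FreeAlgebra.lift_ι_apply, LinearMap.sum_apply,
        Module.End.mul_apply, hv]
      split_ifs with h
      · subst h
        obtain ⟨e₁, he₁⟩ := hne
        obtain ⟨⟨⟨e₀, h₀⟩, y⟩, rfl⟩ := (θ u ⟨e₁, he₁⟩).surjective x
        subst h₀
        rw [Finset.sum_eq_single e₀]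
        · simp [hg, he]
        · intro e hes hne'
          have hes' : s e = s e₀ := by simpa using hes
          rw [hg, if_pos hes'.symm, if_neg, map_zero]
          intro h2
          have key : ∀ (v v' : V) (e' f' : E) (hv : s e' = v) (hv' : s f' = v') (_ : v = v') y,
            ((θ v ⟨e', hv⟩).symm (θ v' ⟨f', hv'⟩ (⟨f', hv'⟩, y))).1 = ⟨e', hv⟩ → e' = f' := by
            rintro v _ e' f' hv hv' rfl y h
            rw [Equiv.symm_apply_apply] at h
            exact (congrArg Subtype.val h).symm
          exact hne' (key _ _ e e₀ rfl rfl hes' y h2)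
        · simp
      · refine (Finset.sum_eq_zero fun e hes => ?_).symm
        have hes' : s e = v := by simpa using hes
        rw [hg, if_neg (fun h' => h (h'.trans hes')), map_zero]
    | unit =>
      simp [hv]
  refine ⟨RingQuot.liftAlgHom K ⟨FreeAlgebra.lift K φ, hrel⟩, ?_, ?_⟩
  · intro v u x
    simpa [vertexEl, gen] using hv v u x
  · intro e u w
    simpa [edgeEl, gen, hθ] using he e u (.inl w)

lemma exists_word_representation [Countable E] :
    ∃ ρ : 𝓛 →ₐ[K] Module.End K (V × (List E ⊕ ℕ) →₀ K),
      (∀ v u x, ρ (vx v) (.single (u, x) 1) = if u = v then .single (u, x) 1 else 0) ∧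
      ∀ (v u : V) (w : FreeMonoid E), ρ (vx v * wd w) (.single (u, .inl []) 1) =
        if IsPath s r v u w.toList then .single (v, .inl w.toList) 1 else 0 := by
  obtain ⟨ρ, hv, he⟩ := exists_representation K s r
  refine ⟨ρ, hv, fun v u w => ?_⟩
  induction w using FreeMonoid.inductionOn' generalizing v with
  | one =>
    simp only [map_one, mul_one, hv, FreeMonoid.toList_one, IsPath]
    by_cases h : u = v
    · simp [h]
    · simp [h, Ne.symm h]
  | of_mul e w ih =>
    rw [map_mul (word K s r), word_of, ← mul_assoc, vertex_mul_edge]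
    have h1 : ed e * wd w = ed e * (vx (r e) * wd w) := by
      rw [← mul_assoc, edge_mul_range]
    by_cases h : v = s e
    · subst h
      rw [if_pos rfl, h1, map_mul, Module.End.mul_apply, ih]
      by_cases hp : IsPath s r (r e) u w.toList
      · simp [hp, IsPath, he]
      · simp [hp, IsPath]
    · simp [h, Ne.symm h, IsPath]

end Representation

section Coefficients

local notation "𝓛" => LPA K s r
local notation "vx" => vertexEl K s r
local notation "ed" => edgeEl K s r
local notation "gh" => ghostEl K s r
local notation "wd" => word K s r
local notation "𝓙" => longPaths K s r
local notation "𝓐" => MonoidAlgebra K (FreeMonoid E)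

/-- The formal linear combinations of paths from `u` to `v`. -/
noncomputable def pathSpan (K : Type) [Field K] {V E : Type} (s r : E → V) (u v : V) :
    Submodule K (MonoidAlgebra K (FreeMonoid E)) :=
  Submodule.span K {a | ∃ w : FreeMonoid E, IsPath s r u v w.toList ∧
    MonoidAlgebra.single w 1 = a}

lemma isPath_of_coeff_ne_zero {K : Type} [Field K] {V E : Type} {s r : E → V} {u v : V}
    {a : MonoidAlgebra K (FreeMonoid E)} (ha : a ∈ pathSpan K s r u v) {w : FreeMonoid E}
    (hw : a.coeff w ≠ 0) : IsPath s r u v w.toList := by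
  contrapose! hw
  induction ha using Submodule.span_induction with
  | mem a ha =>
    obtain ⟨w', h, rfl⟩ := ha
    rw [MonoidAlgebra.coeff_single, Finsupp.single_apply, if_neg]
    rintro rfl
    exact hw h
  | zero => simp
  | add x y _ _ hx hy => simp [hx, hy]
  | smul c x _ hx => simp [hx]

lemma mem_pathSpan {K : Type} [Field K] {V E : Type} {s r : E → V} {u v : V}
    {a : MonoidAlgebra K (FreeMonoid E)}
    (h : ∀ w, a.coeff w ≠ 0 → IsPath s r u v w.toList) : a ∈ pathSpan K s r u v := by
  rw [← MonoidAlgebra.sum_coeff_single a]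
  refine Submodule.sum_mem _ fun w hw => ?_
  have : MonoidAlgebra.single w (a.coeff w) = a.coeff w • MonoidAlgebra.single w (1 : K) := by
    simp
  rw [this]
  exact Submodule.smul_mem _ _ (Submodule.subset_span ⟨w, h w (by simpa using hw), rfl⟩)

lemma mul_mem_pathSpan {K : Type} [Field K] {V E : Type} {s r : E → V} {u v w : V}
    {a b : MonoidAlgebra K (FreeMonoid E)} (ha : a ∈ pathSpan K s r u v)
    (hb : b ∈ pathSpan K s r v w) : a * b ∈ pathSpan K s r u w := by
  have h1 : pathSpan K s r u v * pathSpan K s r v w ≤ pathSpan K s r u w := by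
    unfold pathSpan
    rw [Submodule.span_mul_span, Submodule.span_le]
    rintro _ ⟨_, ⟨p, hp, rfl⟩, _, ⟨q, hq, rfl⟩, rfl⟩
    refine Submodule.subset_span ⟨p * q, ?_, by simp [MonoidAlgebra.single_mul_single]⟩
    simpa using hp.append hq
  exact h1 (Submodule.mul_mem_mul ha hb)

lemma one_mem_pathSpan {K : Type} [Field K] {V E : Type} {s r : E → V} (u : V) :
    (1 : MonoidAlgebra K (FreeMonoid E)) ∈ pathSpan K s r u u :=
  Submodule.subset_span ⟨1, rfl, rfl⟩

/-- The evaluation of formal linear combinations of words in the Leavitt path algebra. -/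
noncomputable def evalWords : MonoidAlgebra K (FreeMonoid E) →ₐ[K] LPA K s r :=
  MonoidAlgebra.lift K (LPA K s r) (FreeMonoid E) (word K s r)

local notation "ev" => evalWords K s r

lemma evalWords_single (w : FreeMonoid E) (c : K) : ev (.single w c) = c • wd w := by
  simp [evalWords]

variable {K s r} in
lemma vertex_mul_evalWords {u v : V} {a : 𝓐} (ha : a ∈ pathSpan K s r u v) :
    vx u * ev a = ev a * vx v := by
  induction ha using Submodule.span_induction with
  | mem a ha =>
    obtain ⟨w, h, rfl⟩ := ha
    simpa [evalWords_single] using vertex_mul_word_of_isPath K s r h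
  | zero => simp
  | add x y _ _ hx hy => simp [hx, hy, mul_add, add_mul]
  | smul c x _ hx => simp [hx]

lemma exists_evalWords_eq {x : 𝓛} (hx : x ∈ 𝓙 0) (u v : V) :
    ∃ a ∈ pathSpan K s r u v, vx u * ev a = vx u * x * vx v := by
  induction hx using Submodule.span_induction with
  | mem x hx =>
    obtain ⟨w, u', h, rfl⟩ := hx
    rw [← mul_assoc, mul_assoc, vertex_mul]
    by_cases hv : u' = v
    · subst hv
      rw [if_pos rfl, vertex_mul_word_mul_vertex]
      by_cases hp : IsPath s r u u' w.toList
      · exact ⟨.single w 1, Submodule.subset_span ⟨w, hp, rfl⟩, by simp [hp, evalWords_single]⟩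
      · exact ⟨0, zero_mem _, by simp [hp]⟩
    · exact ⟨0, zero_mem _, by simp [hv]⟩
  | zero => exact ⟨0, zero_mem _, by simp⟩
  | add x y _ _ hx hy =>
    obtain ⟨a, ha, ha'⟩ := hx
    obtain ⟨b, hb, hb'⟩ := hy
    exact ⟨a + b, add_mem ha hb, by simp [ha', hb', mul_add, add_mul]⟩
  | smul c x _ hx =>
    obtain ⟨a, ha, ha'⟩ := hx
    exact ⟨c • a, Submodule.smul_mem _ _ ha, by simp [ha']⟩

lemma eq_zero_of_vertex_mul_evalWords [Countable E] {u v : V} {a : 𝓐}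
    (ha : a ∈ pathSpan K s r u v) (h : vx u * ev a = 0) : a = 0 := by
  obtain ⟨ρ, -, hρ⟩ := exists_word_representation K s r
  have key : ∀ w : FreeMonoid E,
      ρ (vx u * ev a) (.single (v, .inl []) 1) (u, .inl w.toList) = a.coeff w := by
    clear h
    intro w
    induction ha using Submodule.span_induction with
    | mem a ha =>
      obtain ⟨w', h, rfl⟩ := ha
      rw [evalWords_single, one_smul, hρ, if_pos h, MonoidAlgebra.coeff_single,
        Finsupp.single_apply, Finsupp.single_apply]
      simp
    | zero => simp
    | add x y _ _ hx hy =>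
      rw [map_add (evalWords K s r), mul_add, map_add, LinearMap.add_apply, Finsupp.add_apply,
        hx, hy]
      simp
    | smul c x _ hx =>
      rw [map_smul (evalWords K s r), mul_smul_comm, map_smul, LinearMap.smul_apply,
        Finsupp.smul_apply, hx]
      simp
  rw [← MonoidAlgebra.coeff_eq_zero]
  ext w
  rw [← key, h]
  simp

/-- The coefficients at the trivial paths. -/
lemma exists_vertexCoeff [Countable E] : ∃ ε : V → 𝓛 →ₗ[K] K,
    ∀ u v (w : FreeMonoid E), ε u (wd w * vx v) = if w = 1 ∧ u = v then 1 else 0 := by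
  obtain ⟨ρ, hv, hρ⟩ := exists_word_representation K s r
  refine ⟨fun u => Finsupp.lapply (u, .inl []) ∘ₗ
    LinearMap.applyₗ (.single (u, .inl []) (1 : K)) ∘ₗ ρ.toLinearMap, fun u v w => ?_⟩
  have h1 : wd w * vx v = (∑ a, vx a) * wd w * vx v := by rw [sum_vertex, one_mul]
  have h2 : ∀ a, ρ (vx a * wd w * vx v) (.single (u, .inl []) 1) (u, .inl []) =
      if a = u then (if w = 1 ∧ u = v then 1 else 0) else 0 := by
    intro a
    rw [map_mul, Module.End.mul_apply, hv]
    by_cases huv : u = v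
    · subst huv
      rw [if_pos rfl, hρ]
      by_cases hw : w = 1
      · subst hw
        by_cases hau : a = u
        · simp [IsPath, hau]
        · simp [IsPath, hau]
      · have : w.toList ≠ [] := fun h => hw (FreeMonoid.toList.injective h)
        split_ifs <;> simp_all
    · simp [huv]
  rw [h1, Finset.sum_mul, Finset.sum_mul, map_sum]
  simp only [LinearMap.comp_apply, AlgHom.toLinearMap_apply, LinearMap.applyₗ_apply_apply,
    Finsupp.lapply_apply, h2]
  simp

/-- The coefficient of a trivial path. -/
noncomputable def vertexCoeff [Countable E] : V → LPA K s r →ₗ[K] K :=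
  (exists_vertexCoeff K s r).choose

local notation "ε" => vertexCoeff K s r

variable [Countable E]

lemma vertexCoeff_word (u v : V) (w : FreeMonoid E) :
    ε u (wd w * vx v) = if w = 1 ∧ u = v then 1 else 0 :=
  (exists_vertexCoeff K s r).choose_spec u v w

lemma vertexCoeff_vertex (u v : V) : ε u (vx v) = if u = v then 1 else 0 := by
  simpa using vertexCoeff_word K s r u v 1

lemma vertexCoeff_mul (u : V) {x y : 𝓛} (hx : x ∈ 𝓙 0) (hy : y ∈ 𝓙 0) :
    ε u (x * y) = ε u x * ε u y := by
  induction hx using Submodule.span_induction with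
  | mem x hx =>
    obtain ⟨w, v, -, rfl⟩ := hx
    induction hy using Submodule.span_induction with
    | mem y hy =>
      obtain ⟨w', v', -, rfl⟩ := hy
      rw [vertexCoeff_word, vertexCoeff_word, mul_assoc, ← mul_assoc (vx v),
        vertex_mul_word_mul_vertex]
      split_ifs with hp h1 h2 h2 h2 h2 <;>
        try rw [vertex_mul_word_of_isPath K s r hp, ← mul_assoc, ← map_mul, vertexCoeff_word]
      · simp [h1.1, h2.1, h2.2]
      · rw [if_neg, mul_zero]
        rintro ⟨h3, h4⟩
        exact h2 ⟨by simpa [h1.1] using h3, h4⟩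
      · rw [if_neg, zero_mul]
        rintro ⟨h3, h4⟩
        obtain ⟨rfl, rfl⟩ := h2
        simp only [mul_one] at h3
        have hp' : v = u := hp
        exact h1 ⟨h3, hp'.symm⟩
      · rw [if_neg, zero_mul]
        rintro ⟨h3, h4⟩
        refine h2 ⟨?_, h4⟩
        have := congrArg FreeMonoid.length h3
        simp only [FreeMonoid.length_mul, FreeMonoid.length_one] at this
        exact FreeMonoid.length_eq_zero.1 (by omega)
      · exfalso
        obtain ⟨⟨_, rfl⟩, rfl, rfl⟩ := And.intro ‹w = 1 ∧ u = v› h2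
        exact hp rfl
      all_goals simp
    | zero => simp
    | add x y _ _ hx hy => simp [hx, hy, mul_add]
    | smul c x _ hx => simp [hx]; ring
  | zero => simp
  | add x y _ _ hx hy => simp [hx, hy, add_mul]
  | smul c x _ hx => simp [hx]; ring

lemma sub_vertexCoeff_mem {x : 𝓛} (hx : x ∈ 𝓙 0) :
    x - ∑ u, ε u x • vx u ∈ posPaths K s r := by
  induction hx using Submodule.span_induction with
  | mem x hx =>
    obtain ⟨w, v, -, rfl⟩ := hx
    simp only [vertexCoeff_word]
    by_cases hw : w = 1
    · simp [hw]
    · simp only [hw, false_and, if_false, zero_smul, Finset.sum_const_zero, sub_zero]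
      refine Submodule.subset_span ⟨w, v, ?_, rfl⟩
      exact Nat.one_le_iff_ne_zero.2 fun h => hw (FreeMonoid.length_eq_zero.1 h)
  | zero => simp
  | add x y _ _ hx hy =>
    have h : x + y - ∑ u, ε u (x + y) • vx u =
        (x - ∑ u, ε u x • vx u) + (y - ∑ u, ε u y • vx u) := by
      simp only [map_add, add_smul, Finset.sum_add_distrib]
      abel
    rw [h]
    exact add_mem hx hy
  | smul c x _ hx =>
    have h : c • x - ∑ u, ε u (c • x) • vx u = c • (x - ∑ u, ε u x • vx u) := by
      simp only [map_smul, smul_eq_mul, mul_smul, smul_sub, Finset.smul_sum]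
    rw [h]
    exact Submodule.smul_mem _ _ hx

end Coefficients

section MatrixEquivalence

variable {R : Type} [Ring R] {ι κ μ ι' κ' : Type} [Fintype ι] [Fintype κ] [Fintype μ]
  [Fintype ι'] [Fintype κ']

/-- Murray–von Neumann equivalence of square matrices with arbitrary finite index types. -/
def MvN (p : Matrix ι ι R) (q : Matrix κ κ R) : Prop :=
  ∃ (x : Matrix ι κ R) (y : Matrix κ ι R), x * y = p ∧ y * x = q

lemma MvN.refl {p : Matrix ι ι R} (hp : p * p = p) : MvN p p := ⟨p, p, hp, hp⟩

lemma MvN.symm {p : Matrix ι ι R} {q : Matrix κ κ R} (h : MvN p q) : MvN q p := by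
  obtain ⟨x, y, h1, h2⟩ := h
  exact ⟨y, x, h2, h1⟩

lemma MvN.trans {p : Matrix ι ι R} {q : Matrix κ κ R} {o : Matrix μ μ R} (h : MvN p q)
    (h' : MvN q o) (hp : p * p = p) (ho : o * o = o) : MvN p o := by
  obtain ⟨x, y, rfl, rfl⟩ := h
  obtain ⟨z, t, h1, rfl⟩ := h'
  refine ⟨x * z, t * y, ?_, ?_⟩
  · rw [Matrix.mul_assoc, ← Matrix.mul_assoc z, h1]
    simpa only [Matrix.mul_assoc] using hp
  · rw [Matrix.mul_assoc, ← Matrix.mul_assoc y, ← h1]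
    simpa only [Matrix.mul_assoc] using ho

lemma MvN.exists_normalized {p : Matrix ι ι R} {q : Matrix κ κ R} (h : MvN p q)
    (hp : p * p = p) (hq : q * q = q) : ∃ (x : Matrix ι κ R) (y : Matrix κ ι R),
      x * y = p ∧ y * x = q ∧ p * x = x ∧ x * q = x ∧ q * y = y ∧ y * p = y := by
  obtain ⟨x, y, h1, h2⟩ := h
  have h3 : p * x = x * q := by rw [← h1, ← h2, Matrix.mul_assoc]
  have h4 : q * y = y * p := by rw [← h1, ← h2, Matrix.mul_assoc]
  refine ⟨p * x, q * y, ?_, ?_, ?_, ?_, ?_, ?_⟩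
  · rw [h4, Matrix.mul_assoc, ← Matrix.mul_assoc x, h1, hp, hp]
  · rw [h3, Matrix.mul_assoc, ← Matrix.mul_assoc y, h2, hq, hq]
  · rw [← Matrix.mul_assoc, hp]
  · rw [Matrix.mul_assoc, ← h3, ← Matrix.mul_assoc, hp]
  · rw [← Matrix.mul_assoc, hq]
  · rw [Matrix.mul_assoc, ← h4, ← Matrix.mul_assoc, hq]

lemma MvN.fromBlocks {p : Matrix ι ι R} {q : Matrix κ κ R} {p' : Matrix ι' ι' R}
    {q' : Matrix κ' κ' R} (h : MvN p p') (h' : MvN q q') :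
    MvN (Matrix.fromBlocks p 0 0 q) (Matrix.fromBlocks p' 0 0 q') := by
  obtain ⟨x, y, rfl, rfl⟩ := h
  obtain ⟨z, t, rfl, rfl⟩ := h'
  exact ⟨Matrix.fromBlocks x 0 0 z, Matrix.fromBlocks y 0 0 t,
    by simp [Matrix.fromBlocks_multiply], by simp [Matrix.fromBlocks_multiply]⟩

lemma mvN_submatrix {p : Matrix ι ι R} (hp : p * p = p) (e : κ ≃ ι) :
    MvN p (p.submatrix e e) := by
  refine ⟨p.submatrix id e, p.submatrix e id, ?_, ?_⟩
  · rw [Matrix.submatrix_mul_equiv, hp, Matrix.submatrix_id_id]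
  · have := Matrix.submatrix_mul_equiv p p e (Equiv.refl ι) e
    rw [hp] at this
    exact this

end MatrixEquivalence

section VertexMatrices

set_option linter.unusedSectionVars false

local notation "𝓛" => LPA K s r
local notation "vx" => vertexEl K s r
local notation "ed" => edgeEl K s r
local notation "gh" => ghostEl K s r
local notation "𝓙" => longPaths K s r

variable {ι κ μ : Type}

/-- The diagonal idempotent matrix attached to a family of vertices. -/
noncomputable def vertexDiag (v : ι → V) : Matrix ι ι (LPA K s r) :=
  Matrix.of fun i j => if i = j then vertexEl K s r (v i) else 0

local notation "𝓓" => vertexDiag K s r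

lemma vertexDiag_apply (v : ι → V) (i j : ι) : 𝓓 v i j = if i = j then vx (v i) else 0 := rfl

lemma vertexDiag_mul_apply [Fintype ι] (v : ι → V) (X : Matrix ι κ 𝓛) (i : ι) (j : κ) :
    (𝓓 v * X) i j = vx (v i) * X i j := by
  simp [Matrix.mul_apply, vertexDiag_apply]

lemma mul_vertexDiag_apply [Fintype κ] (v : κ → V) (X : Matrix ι κ 𝓛) (i : ι) (j : κ) :
    (X * 𝓓 v) i j = X i j * vx (v j) := by
  simp [Matrix.mul_apply, vertexDiag_apply]

lemma vertexDiag_mul_self [Fintype ι] (v : ι → V) : 𝓓 v * 𝓓 v = 𝓓 v := by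
  ext i j
  rw [vertexDiag_mul_apply, vertexDiag_apply]
  split_ifs <;> simp [vertex_mul_self]

lemma vertexDiag_submatrix (v : ι → V) (e : κ ≃ ι) : (𝓓 v).submatrix e e = 𝓓 (v ∘ e) := by
  ext i j
  simp [vertexDiag_apply]

lemma fromBlocks_vertexDiag (v : ι → V) (w : κ → V) :
    Matrix.fromBlocks (𝓓 v) 0 0 (𝓓 w) = 𝓓 (Sum.elim v w) := by
  ext (i | i) (j | j) <;> simp [vertexDiag_apply]

/-- The number of occurrences of each vertex in a family. -/
noncomputable def count {V : Type} [Fintype ι] (v : ι → V) : V →₀ ℕ :=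
  ∑ i, Finsupp.single (v i) 1

lemma count_apply {V : Type} [Fintype ι] (v : ι → V) (u : V) :
    count v u = Fintype.card {i // v i = u} := by
  simp [count, Finsupp.finsetSum_apply, Finsupp.single_apply, Fintype.card_subtype]

lemma exists_equiv_of_count_eq {V : Type} [Fintype ι] [Fintype κ] {v : ι → V} {w : κ → V}
    (h : count v = count w) : ∃ e : ι ≃ κ, w ∘ e = v := by
  have h1 : ∀ u, Nonempty ({i // v i = u} ≃ {i // w i = u}) := fun u => by
    rw [← Fintype.card_eq, ← count_apply, ← count_apply, h]
  have e := fun u => (h1 u).some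
  exact ⟨Equiv.ofFiberEquiv e, funext fun i => Equiv.ofFiberEquiv_map e i⟩

lemma mvN_of_count_eq [Fintype ι] [Fintype κ] {v : ι → V} {w : κ → V}
    (h : count v = count w) : MvN (𝓓 v) (𝓓 w) := by
  obtain ⟨e, rfl⟩ := exists_equiv_of_count_eq h
  rw [← vertexDiag_submatrix]
  exact (mvN_submatrix (vertexDiag_mul_self K s r w) e).symm

/-- The class of a vertex in the graph monoid. -/
noncomputable def vertexClass {V E : Type} (s r : E → V) (u : V) : GraphMonoid s r :=
  (addConGen (GMRel s r)).mk' (Finsupp.single u 1)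

/-- The class of a family of vertices in the graph monoid. -/
noncomputable def familyClass {V E : Type} (s r : E → V) [Fintype ι] (v : ι → V) :
    GraphMonoid s r :=
  ∑ i, vertexClass s r (v i)

lemma mk_count {V E : Type} (s r : E → V) [Fintype ι] (v : ι → V) :
    (addConGen (GMRel s r)).mk' (count v) = familyClass s r v := by
  simp only [count, familyClass, vertexClass, map_sum]

lemma familyClass_eq_of_count_eq {V E : Type} (s r : E → V) [Fintype ι] [Fintype κ] {v : ι → V}
    {w : κ → V} (h : count v = count w) : familyClass s r v = familyClass s r w := by
  rw [← mk_count, ← mk_count, h]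

/-- The labels of the pieces into which the vertex `u` is decomposed: the edges starting at `u`
if `b` holds and `u` is not a sink, and only the trivial label otherwise. -/
def IsLabel {V E : Type} (s : E → V) (b : Prop) (u : V) : Option E → Prop
  | some e => b ∧ s e = u
  | none => b → IsSink s u

lemma isLabel_some {V E : Type} {s : E → V} {b : Prop} {u : V} {e : E} :
    IsLabel s b u (some e) ↔ b ∧ s e = u := Iff.rfl

lemma isLabel_none {V E : Type} {s : E → V} {b : Prop} {u : V} :
    IsLabel s b u none ↔ (b → IsSink s u) := Iff.rfl

/-- The vertex of a label at `u`. -/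
def labelVertex {V E : Type} (r : E → V) (u : V) : Option E → V
  | some e => r e
  | none => u

/-- The element of a label at `u`. -/
def labelEl (u : V) : Option E → LPA K s r
  | some e => edgeEl K s r e
  | none => vertexEl K s r u

/-- The adjoint of the element of a label at `u`. -/
def labelGhost (u : V) : Option E → LPA K s r
  | some e => ghostEl K s r e
  | none => vertexEl K s r u

variable {s} in
lemma IsLabel.vertex_mul_labelEl {b : Prop} {u : V} {x : Option E} (h : IsLabel s b u x) :
    vx u * labelEl K s r u x = labelEl K s r u x := by
  cases x with
  | none => exact vertex_mul_self K s r u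
  | some e => rw [← h.2]; exact source_mul_edge K s r e

lemma labelEl_mul_vertex (u : V) (x : Option E) :
    labelEl K s r u x * vx (labelVertex r u x) = labelEl K s r u x := by
  cases x with
  | none => exact vertex_mul_self K s r u
  | some e => exact edge_mul_range K s r e

lemma vertex_mul_labelGhost (u : V) (x : Option E) :
    vx (labelVertex r u x) * labelGhost K s r u x = labelGhost K s r u x := by
  cases x with
  | none => exact vertex_mul_self K s r u
  | some e => exact range_mul_ghost K s r e

variable {s} in
lemma IsLabel.labelGhost_mul_labelEl {b : Prop} {u : V} {x y : Option E} (hx : IsLabel s b u x)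
    (hy : IsLabel s b u y) : labelGhost K s r u x * labelEl K s r u y =
      if x = y then vx (labelVertex r u x) else 0 := by
  cases x with
  | none =>
    cases y with
    | none => simpa [labelGhost, labelEl, labelVertex] using vertex_mul_self K s r u
    | some f => exact absurd hy.2 (hx hy.1 f)
  | some e =>
    cases y with
    | none => exact absurd hx.2 (hy hx.1 e)
    | some f =>
      simp only [labelGhost, labelEl, labelVertex, Option.some.injEq]
      exact ghost_mul_edge K s r e f

lemma mul_labelEl_mem {u : V} {x : Option E} (h : IsLabel s True u x) {n : ℕ} {y : 𝓛}
    (hy : y ∈ 𝓙 n) : y * labelEl K s r u x ∈ 𝓙 (n + 1) := by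
  cases x with
  | none => exact paths_mul_sink K s r (h trivial) _ (longPaths_anti K s r (Nat.zero_le n) hy)
  | some e => exact longPaths_mul_edge K s r hy e

variable [Fintype E]

lemma isLabel_sum_eq {M : Type} [AddCommMonoid M] (s : E → V) (b : Prop) (u : V)
    (f : Option E → M) : ∑ x : {x // IsLabel s b u x}, f x =
      if b ∧ ¬ IsSink s u then ∑ e ∈ (Set.toFinite {e : E | s e = u}).toFinset, f (some e)
      else f none := by
  rw [← Finset.sum_subtype (Finset.univ.filter (IsLabel s b u)) (by simp) f, Finset.sum_filter,
    Fintype.sum_option]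
  simp only [isLabel_some, isLabel_none]
  by_cases h : b ∧ ¬ IsSink s u
  · rw [if_pos h, if_neg (fun h' => h.2 (h' h.1)), zero_add, ← Finset.sum_filter]
    refine Finset.sum_congr ?_ fun _ _ => rfl
    ext e
    simp [h.1]
  · rw [if_neg h, if_pos (by tauto), Finset.sum_eq_zero, add_zero]
    rintro e -
    rw [if_neg]
    rintro ⟨h3, h4⟩
    exact h ⟨h3, fun h5 => h5 e h4⟩

lemma nonempty_of_not_isSink {u : V} (h : ¬ IsSink s u) : {e : E | s e = u}.Nonempty := by
  simpa [IsSink, Set.Nonempty] using h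

lemma sum_labelEl_mul_labelGhost (b : Prop) (u : V) :
    ∑ x : {x // IsLabel s b u x}, labelEl K s r u x * labelGhost K s r u x = vx u := by
  rw [isLabel_sum_eq s b u fun x => labelEl K s r u x * labelGhost K s r u x]
  split_ifs with h
  · exact (vertex_eq_sum K s r u _ (nonempty_of_not_isSink s h.2)).symm
  · exact vertex_mul_self K s r u

lemma vertexClass_eq_sum (s r : E → V) (b : Prop) (u : V) :
    vertexClass s r u = ∑ x : {x // IsLabel s b u x}, vertexClass s r (labelVertex r u x) := by
  rw [isLabel_sum_eq s b u fun x => vertexClass s r (labelVertex r u x)]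
  split_ifs with h
  · simp only [vertexClass, labelVertex, ← map_sum]
    exact (AddCon.eq _).2 (AddConGen.Rel.of _ _ (GMRel.ck u _ (nonempty_of_not_isSink s h.2)))
  · rfl

/-- The index type of a partial decomposition of a family of vertices. -/
abbrev LabelIndex {V E : Type} (s : E → V) (b : ι → Prop) (v : ι → V) : Type :=
  Σ i, {x // IsLabel s (b i) (v i) x}

/-- The family of vertices of a partial decomposition. -/
def labelFamily {V E : Type} (s r : E → V) (b : ι → Prop) (v : ι → V) :
    LabelIndex s b v → V :=
  fun x => labelVertex r (v x.1) x.2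

/-- The matrix of a partial decomposition. -/
noncomputable def labelMatrix (b : ι → Prop) (v : ι → V) :
    Matrix ι (LabelIndex s b v) (LPA K s r) :=
  Matrix.of fun i x => if i = x.1 then labelEl K s r (v x.1) x.2 else 0

/-- The inverse of the matrix of a partial decomposition. -/
noncomputable def labelMatrixInv (b : ι → Prop) (v : ι → V) :
    Matrix (LabelIndex s b v) ι (LPA K s r) :=
  Matrix.of fun x i => if x.1 = i then labelGhost K s r (v x.1) x.2 else 0

lemma mul_labelMatrix_apply [Fintype ι] (b : ι → Prop) (v : ι → V) (X : Matrix κ ι 𝓛) (k : κ)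
    (x : LabelIndex s b v) :
    (X * labelMatrix K s r b v) k x = X k x.1 * labelEl K s r (v x.1) x.2 := by
  simp [Matrix.mul_apply, labelMatrix]

lemma labelMatrixInv_mul_apply [Fintype ι] (b : ι → Prop) (v : ι → V) (X : Matrix ι κ 𝓛)
    (x : LabelIndex s b v) (k : κ) :
    (labelMatrixInv K s r b v * X) x k = labelGhost K s r (v x.1) x.2 * X x.1 k := by
  simp [Matrix.mul_apply, labelMatrixInv]

lemma labelMatrix_mul_labelMatrixInv [Fintype ι] (b : ι → Prop) (v : ι → V) :
    labelMatrix K s r b v * labelMatrixInv K s r b v = 𝓓 v := by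
  ext i j
  rw [Matrix.mul_apply, Fintype.sum_sigma, vertexDiag_apply]
  simp only [labelMatrix, labelMatrixInv, Matrix.of_apply]
  rw [Finset.sum_eq_single i]
  · simp only [if_true]
    by_cases h : i = j
    · subst h
      simpa using sum_labelEl_mul_labelGhost K s r (b i) (v i)
    · simp [h]
  · intro k _ hk
    simp [Ne.symm hk]
  · simp

lemma labelMatrixInv_mul_labelMatrix [Fintype ι] (b : ι → Prop) (v : ι → V) :
    labelMatrixInv K s r b v * labelMatrix K s r b v = 𝓓 (labelFamily s r b v) := by
  ext ⟨i, x⟩ ⟨j, y⟩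
  rw [labelMatrixInv_mul_apply, vertexDiag_apply]
  by_cases h : i = j
  · subst h
    simp only [labelMatrix, Matrix.of_apply, if_true]
    rw [x.2.labelGhost_mul_labelEl K r y.2]
    simp [labelFamily, Subtype.ext_iff]
  · simp [labelMatrix, h]

lemma vertexDiag_mul_labelMatrix [Fintype ι] (b : ι → Prop) (v : ι → V) :
    𝓓 v * labelMatrix K s r b v = labelMatrix K s r b v := by
  ext i ⟨j, x⟩
  rw [vertexDiag_mul_apply]
  by_cases h : i = j
  · subst h
    simpa [labelMatrix] using x.2.vertex_mul_labelEl K r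
  · simp [labelMatrix, h]

lemma labelMatrix_mul_vertexDiag [Fintype ι] (b : ι → Prop) (v : ι → V) :
    labelMatrix K s r b v * 𝓓 (labelFamily s r b v) = labelMatrix K s r b v := by
  ext i ⟨j, x⟩
  rw [mul_vertexDiag_apply]
  by_cases h : i = j
  · subst h
    simpa [labelMatrix, labelFamily] using labelEl_mul_vertex K s r (v i) x
  · simp [labelMatrix, h]

lemma vertexDiag_mul_labelMatrixInv [Fintype ι] (b : ι → Prop) (v : ι → V) :
    𝓓 (labelFamily s r b v) * labelMatrixInv K s r b v = labelMatrixInv K s r b v := by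
  ext ⟨j, x⟩ i
  rw [vertexDiag_mul_apply]
  by_cases h : j = i
  · subst h
    simpa [labelMatrixInv, labelFamily] using vertex_mul_labelGhost K s r (v j) x
  · simp [labelMatrixInv, h]

lemma familyClass_labelFamily (s r : E → V) [Fintype ι] (b : ι → Prop) (v : ι → V) :
    familyClass s r (labelFamily s r b v) = familyClass s r v := by
  unfold familyClass
  rw [Fintype.sum_sigma]
  exact Finset.sum_congr rfl fun i _ => (vertexClass_eq_sum s r (b i) (v i)).symm

/-- Every family of vertices can be decomposed along long paths. -/
lemma exists_long_decomposition [Fintype ι] (v : ι → V) (n : ℕ) :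
    ∃ (κ : Type) (_ : Fintype κ) (w : κ → V) (T : Matrix ι κ 𝓛) (T' : Matrix κ ι 𝓛),
      T * T' = 𝓓 v ∧ T' * T = 𝓓 w ∧ 𝓓 v * T = T ∧ T * 𝓓 w = T ∧ 𝓓 w * T' = T' ∧ T' * 𝓓 v = T' ∧
      (∀ i j, T i j ∈ 𝓙 n) ∧ familyClass s r w = familyClass s r v := by
  induction n with
  | zero =>
    refine ⟨ι, inferInstance, v, 𝓓 v, 𝓓 v, ?_⟩
    simp only [vertexDiag_mul_self, true_and, and_true]
    intro i j
    rw [vertexDiag_apply]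
    split_ifs
    · exact vertex_mem_paths K s r _
    · exact zero_mem _
  | succ n ih =>
    obtain ⟨κ, _, w, T, T', h1, h2, h3, h4, h5, h6, h7, h8⟩ := ih
    refine ⟨LabelIndex s (fun _ => True) w, inferInstance, labelFamily s r _ w,
      T * labelMatrix K s r _ w, labelMatrixInv K s r _ w * T', ?_, ?_, ?_, ?_, ?_, ?_, ?_, ?_⟩
    · rw [Matrix.mul_assoc, ← Matrix.mul_assoc (labelMatrix K s r _ w),
        labelMatrix_mul_labelMatrixInv, h5, h1]
    · rw [Matrix.mul_assoc, ← Matrix.mul_assoc T', h2, vertexDiag_mul_labelMatrix,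
        labelMatrixInv_mul_labelMatrix]
    · rw [← Matrix.mul_assoc, h3]
    · rw [Matrix.mul_assoc, labelMatrix_mul_vertexDiag]
    · rw [← Matrix.mul_assoc, vertexDiag_mul_labelMatrixInv]
    · rw [Matrix.mul_assoc, h6]
    · intro i x
      rw [mul_labelMatrix_apply]
      exact mul_labelEl_mem K s r x.2.2 (h7 _ _)
    · rw [familyClass_labelFamily, h8]

end VertexMatrices

section ClassesToMatrices

local notation "𝓓" => vertexDiag K s r

variable {ι κ : Type} [Fintype ι] [Fintype κ]

/-- The standard family of vertices with given multiplicities. -/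
def standardFamily {V : Type} (α : V →₀ ℕ) : (Σ u, Fin (α u)) → V := Sigma.fst

lemma count_standardFamily (α : V →₀ ℕ) : count (standardFamily α) = α := by
  simp only [count, standardFamily, Fintype.sum_sigma, Finset.sum_const, Finset.card_univ,
    Fintype.card_fin, Finsupp.smul_single, smul_eq_mul, mul_one]
  exact Finsupp.univ_sum_single α

lemma count_sumElim {V : Type} (v : ι → V) (w : κ → V) :
    count (Sum.elim v w) = count v + count w := by
  simp [count, Fintype.sum_sum_type]

lemma familyClass_sumElim {V E : Type} (s r : E → V) (v : ι → V) (w : κ → V) :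
    familyClass s r (Sum.elim v w) = familyClass s r v + familyClass s r w := by
  simp [familyClass, Fintype.sum_sum_type]

lemma MvN.trans_vertexDiag {μ : Type} [Fintype μ] {v : ι → V} {w : κ → V} {t : μ → V}
    (h : MvN (𝓓 v) (𝓓 w)) (h' : MvN (𝓓 w) (𝓓 t)) : MvN (𝓓 v) (𝓓 t) :=
  h.trans h' (vertexDiag_mul_self K s r v) (vertexDiag_mul_self K s r t)

/-- The congruence given by equivalence of the standard diagonal idempotents. -/
def equivalenceCon : AddCon (V →₀ ℕ) where
  r α β := MvN (𝓓 (standardFamily α)) (𝓓 (standardFamily β))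
  iseqv := ⟨fun _ => MvN.refl (vertexDiag_mul_self K s r _), MvN.symm,
    fun h h' => h.trans_vertexDiag K s r h'⟩
  add' {α β γ δ} h h' := by
    have h1 : ∀ α β : V →₀ ℕ, MvN (𝓓 (standardFamily (α + β)))
        (𝓓 (Sum.elim (standardFamily α) (standardFamily β))) := fun α β =>
      mvN_of_count_eq K s r (by rw [count_sumElim]; simp only [count_standardFamily])
    refine (h1 α γ).trans_vertexDiag K s r (MvN.trans_vertexDiag K s r ?_ (h1 β δ).symm)
    rw [← fromBlocks_vertexDiag, ← fromBlocks_vertexDiag]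
    exact h.fromBlocks h'

lemma mvN_of_familyClass_eq [Fintype E] {v : ι → V} {w : κ → V}
    (h : familyClass s r v = familyClass s r w) : MvN (𝓓 v) (𝓓 w) := by
  rw [← mk_count, ← mk_count] at h
  have h1 : addConGen (GMRel s r) ≤ equivalenceCon K s r := by
    refine AddCon.addConGen_le.2 ?_
    rintro _ _ ⟨u, hfin, hne⟩
    refine (mvN_of_count_eq K s r (w := fun _ : Unit => u) ?_).trans_vertexDiag K s r
      (MvN.trans_vertexDiag K s r ⟨_, _, labelMatrix_mul_labelMatrixInv K s r (fun _ => True) _,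
        labelMatrixInv_mul_labelMatrix K s r _ _⟩ (mvN_of_count_eq K s r ?_))
    · rw [count_standardFamily]
      simp [count]
    · rw [count_standardFamily, count, Fintype.sum_sigma, Fintype.sum_unique]
      have := isLabel_sum_eq s True u fun x => Finsupp.single (labelVertex r u x) 1
      rw [if_pos ⟨trivial, fun h => hne.elim fun e he => h e he⟩] at this
      exact this
  have h2 : MvN _ _ := h1 ((AddCon.eq _).1 h)
  refine (mvN_of_count_eq K s r ?_).trans_vertexDiag K s r
    (h2.trans_vertexDiag K s r (mvN_of_count_eq K s r ?_)) <;> rw [count_standardFamily]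

end ClassesToMatrices

section WeakAlgorithm

variable {K : Type} [Field K] {V E : Type} {s r : E → V}

local notation "𝓐" => MonoidAlgebra K (FreeMonoid E)

/-- One more than the maximal length of a word in the support, and zero for the zero element. -/
def wordDegree (a : MonoidAlgebra K (FreeMonoid E)) : ℕ :=
  a.coeff.support.sup fun w => w.length + 1

lemma wordDegree_le_iff {a : 𝓐} {n : ℕ} :
    wordDegree a ≤ n ↔ ∀ w, a.coeff w ≠ 0 → w.length < n := by
  simp only [wordDegree, Finset.sup_le_iff, Finsupp.mem_support_iff]
  rfl

lemma length_lt_wordDegree {a : 𝓐} {w : FreeMonoid E} (h : a.coeff w ≠ 0) :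
    w.length < wordDegree a :=
  wordDegree_le_iff.1 le_rfl w h

lemma wordDegree_eq_zero {a : 𝓐} : wordDegree a = 0 ↔ a = 0 := by
  rw [← Nat.le_zero, wordDegree_le_iff, ← MonoidAlgebra.coeff_eq_zero, Finsupp.ext_iff]
  simp

lemma exists_length_add_one_eq {a : 𝓐} (h : a ≠ 0) :
    ∃ w, a.coeff w ≠ 0 ∧ w.length + 1 = wordDegree a := by
  obtain ⟨w, hw, h1⟩ := Finset.exists_mem_eq_sup a.coeff.support
    (by simpa [Finsupp.support_nonempty_iff] using h) fun w => w.length + 1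
  exact ⟨w, by simpa using hw, h1.symm⟩

lemma induction_single_mul {P : 𝓐 → Prop} (g : 𝓐) (h0 : P 0) (hadd : ∀ x y, P x → P y → P (x + y))
    (h : ∀ w, g.coeff w ≠ 0 → P (.single w (g.coeff w))) : P g := by
  rw [← MonoidAlgebra.sum_coeff_single g]
  exact Finset.sum_induction _ P hadd h0 fun w hw => h w (by simpa using hw)

lemma coeff_mul_eq_zero {g a : 𝓐} {x : FreeMonoid E}
    (h : wordDegree g + wordDegree a < x.length + 2) : (g * a).coeff x = 0 := by
  refine induction_single_mul (P := fun g => (g * a).coeff x = 0) g (by simp)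
    (fun y z hy hz => by simp [add_mul, hy, hz]) fun w hw => ?_
  by_contra h1
  by_cases h2 : ∃ d, w * d = x
  · obtain ⟨d, rfl⟩ := h2
    rw [MonoidAlgebra.coeff_single_mul_mul] at h1
    have h3 := length_lt_wordDegree hw
    have h4 := length_lt_wordDegree (right_ne_zero_of_mul h1)
    rw [FreeMonoid.length_mul] at h
    omega
  · exact h1 (MonoidAlgebra.coeff_single_mul_of_forall_mul_ne _ _ fun d hd => h2 ⟨d, hd⟩)

/-- Removal of a suffix: the part of `a` in the words ending with `q`, with `q` removed. -/
noncomputable def stripSuffix (q : FreeMonoid E) (a : MonoidAlgebra K (FreeMonoid E)) :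
    MonoidAlgebra K (FreeMonoid E) :=
  .ofCoeff (a.coeff.comapDomain (· * q) (mul_left_injective q).injOn)

lemma coeff_stripSuffix (q : FreeMonoid E) (a : 𝓐) (p : FreeMonoid E) :
    (stripSuffix q a).coeff p = a.coeff (p * q) := rfl

lemma stripSuffix_mem {u v w : V} {q : FreeMonoid E} {a : 𝓐} (ha : a ∈ pathSpan K s r u w)
    (hq : IsPath s r v w q.toList) : stripSuffix q a ∈ pathSpan K s r u v := by
  refine mem_pathSpan fun p hp => ?_
  refine IsPath.of_append_right (isPath_of_coeff_ne_zero ha hp) hq ?_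
  by_cases h : q.toList = []
  · rw [h] at hq
    exact Or.inr hq
  · exact Or.inl h

lemma coeff_mul_stripSuffix {g a : 𝓐} {p q : FreeMonoid E} (h : wordDegree g ≤ p.length + 1) :
    (g * stripSuffix q a).coeff p = (g * a).coeff (p * q) := by
  refine induction_single_mul
    (P := fun g => (g * stripSuffix q a).coeff p = (g * a).coeff (p * q)) g (by simp)
    (fun y z hy hz => by simp [add_mul, hy, hz]) fun w hw => ?_
  have h1 : w.toList.length ≤ p.toList.length :=
    Nat.lt_succ_iff.1 ((length_lt_wordDegree hw).trans_le h)
  by_cases h2 : ∃ d, w * d = p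
  · obtain ⟨d, rfl⟩ := h2
    rw [mul_assoc, MonoidAlgebra.coeff_single_mul_mul, MonoidAlgebra.coeff_single_mul_mul,
      coeff_stripSuffix]
  · rw [MonoidAlgebra.coeff_single_mul_of_forall_mul_ne _ _ fun d hd => h2 ⟨d, hd⟩,
      MonoidAlgebra.coeff_single_mul_of_forall_mul_ne]
    intro d hd
    have h3 : w.toList ++ d.toList = p.toList ++ q.toList := congrArg FreeMonoid.toList hd
    obtain ⟨t, ht⟩ := List.prefix_of_prefix_length_le ⟨_, h3⟩ (List.prefix_append _ _) h1
    exact h2 ⟨FreeMonoid.ofList t, FreeMonoid.toList.injective ht⟩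

variable {ι κ : Type} [Fintype κ]

/-- The maximal degree of the entries of a column. -/
noncomputable def columnDegree (G : Matrix κ ι (MonoidAlgebra K (FreeMonoid E))) (i : ι) : ℕ :=
  Finset.univ.sup fun j => wordDegree (G j i)

lemma wordDegree_le_columnDegree (G : Matrix κ ι 𝓐) (j : κ) (i : ι) :
    wordDegree (G j i) ≤ columnDegree G i :=
  Finset.le_sup (f := fun j => wordDegree (G j i)) (Finset.mem_univ j)

lemma columnDegree_eq_zero {G : Matrix κ ι 𝓐} {i : ι} :
    columnDegree G i = 0 ↔ ∀ j, G j i = 0 := by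
  rw [← Nat.le_zero, columnDegree, Finset.sup_le_iff]
  simp [wordDegree_eq_zero]

variable [Fintype ι]

lemma exists_column_of_dependence {G : Matrix κ ι 𝓐} {v : ι → V} {u : V} {a : ι → 𝓐}
    (ha : ∀ i, a i ∈ pathSpan K s r (v i) u) (h : ∀ j, ∑ i, G j i * a i = 0)
    (hne : ∃ i, (∃ j, G j i ≠ 0) ∧ a i ≠ 0) :
    ∃ i₀, ∃ b : ι → 𝓐, (∀ i, b i ∈ pathSpan K s r (v i) (v i₀)) ∧ b i₀ = 1 ∧
      ∀ j, wordDegree (∑ i, G j i * b i) < columnDegree G i₀ := by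
  set I : Finset ι := Finset.univ.filter fun i => (∃ j, G j i ≠ 0) ∧ a i ≠ 0 with hI
  have hInon : I.Nonempty := by
    obtain ⟨i, hi⟩ := hne
    exact ⟨i, by simpa [hI] using hi⟩
  obtain ⟨i₁, hi₁, hmax₁⟩ := I.exists_max_image
    (fun i => columnDegree G i + wordDegree (a i)) hInon
  obtain ⟨i₀, hi₀, hmax₀⟩ := (I.filter fun i => columnDegree G i + wordDegree (a i) =
    columnDegree G i₁ + wordDegree (a i₁)).exists_max_image (columnDegree G)
    ⟨i₁, by simp [hi₁]⟩
  rw [Finset.mem_filter] at hi₀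
  obtain ⟨hi₀I, hi₀D⟩ := hi₀
  have hi₀' : (∃ j, G j i₀ ≠ 0) ∧ a i₀ ≠ 0 := by simpa [hI] using hi₀I
  obtain ⟨q, hq, hqd⟩ := exists_length_add_one_eq hi₀'.2
  have hpos : 0 < columnDegree G i₀ := by
    rw [Nat.pos_iff_ne_zero, Ne, columnDegree_eq_zero]
    push Not
    exact hi₀'.1
  set c := (a i₀).coeff q with hc
  let b : ι → 𝓐 := fun i =>
    if columnDegree G i ≤ columnDegree G i₀ then c⁻¹ • stripSuffix q (a i) else 0
  have hqp : IsPath s r (v i₀) u q.toList := isPath_of_coeff_ne_zero (ha i₀) hq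
  refine ⟨i₀, b, fun i => ?_, ?_, fun j => ?_⟩
  · simp only [b]
    split_ifs
    · exact Submodule.smul_mem _ _ (stripSuffix_mem (ha i) hqp)
    · exact zero_mem _
  · simp only [b, le_refl, if_true]
    rw [← MonoidAlgebra.coeff_inj]
    ext p
    rw [MonoidAlgebra.coeff_smul, Finsupp.smul_apply, coeff_stripSuffix, MonoidAlgebra.one_def,
      MonoidAlgebra.coeff_single, Finsupp.single_apply]
    split_ifs with hp
    · subst hp
      rw [one_mul, smul_eq_mul, inv_mul_cancel₀ hq]
    · rw [smul_eq_zero]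
      refine Or.inr ?_
      by_contra h1
      have h2 := length_lt_wordDegree h1
      rw [FreeMonoid.length_mul] at h2
      exact hp (FreeMonoid.length_eq_zero.1 (by omega)).symm
  · refine lt_of_le_of_lt ((wordDegree_le_iff (n := columnDegree G i₀ - 1)).2 fun p hp => ?_)
      (Nat.sub_lt hpos one_pos)
    by_contra hlen
    apply hp
    have key : ∀ i, (G j i * b i).coeff p = c⁻¹ * (G j i * a i).coeff (p * q) := by
      intro i
      by_cases h1 : columnDegree G i ≤ columnDegree G i₀
      · simp only [b, if_pos h1]
        rw [mul_smul_comm, MonoidAlgebra.coeff_smul, Finsupp.smul_apply, coeff_mul_stripSuffix,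
          smul_eq_mul]
        have := wordDegree_le_columnDegree G j i
        omega
      · simp only [b, if_neg h1]
        rw [mul_zero, MonoidAlgebra.coeff_zero, Finsupp.zero_apply, eq_comm, mul_eq_zero]
        refine Or.inr ?_
        by_cases h2 : i ∈ I
        · apply coeff_mul_eq_zero
          have h3 := hmax₁ i h2
          have h4 : columnDegree G i + wordDegree (a i) ≠
              columnDegree G i₁ + wordDegree (a i₁) := fun h4 =>
            h1 (hmax₀ i (Finset.mem_filter.2 ⟨h2, h4⟩))
          have h5 := wordDegree_le_columnDegree G j i
          rw [FreeMonoid.length_mul]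
          omega
        · have h3 : (∀ j, G j i = 0) ∨ a i = 0 := by
            simp only [hI, Finset.mem_filter, Finset.mem_univ, true_and] at h2
            by_contra! h3
            exact h2 h3
          rcases h3 with h3 | h3 <;> simp [h3]
    rw [MonoidAlgebra.coeff_sum, Finsupp.finsetSum_apply, Finset.sum_congr rfl fun i _ => key i,
      ← Finset.mul_sum, ← Finsupp.finsetSum_apply, ← MonoidAlgebra.coeff_sum, h j]
    simp

/-- The weak algorithm: columns of a matrix of paths can be reduced by an invertible matrix of
paths to independent columns and zero columns. -/
theorem exists_column_reduction (v : ι → V) (w : κ → V) (G : Matrix κ ι 𝓐)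
    (hG : ∀ j i, G j i ∈ pathSpan K s r (w j) (v i)) :
    ∃ U U' : Matrix ι ι 𝓐, (∀ i j, U i j ∈ pathSpan K s r (v i) (v j)) ∧
      (∀ i j, U' i j ∈ pathSpan K s r (v i) (v j)) ∧ U * U' = 1 ∧ U' * U = 1 ∧
      ∀ (u : V) (a : ι → 𝓐), (∀ i, a i ∈ pathSpan K s r (v i) u) →
        (∀ j, ∑ i, (G * U) j i * a i = 0) → ∀ i, (∀ j, (G * U) j i = 0) ∨ a i = 0 := by
  induction hN : ∑ i, columnDegree G i using Nat.strong_induction_on generalizing G with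
  | _ N ih =>
  have hone : ∀ i j, (1 : Matrix ι ι 𝓐) i j ∈ pathSpan K s r (v i) (v j) := by
    intro i j
    rw [Matrix.one_apply]
    split_ifs with h
    · rw [h]
      exact one_mem_pathSpan _
    · exact zero_mem _
  by_cases hdep : ∀ (u : V) (a : ι → 𝓐), (∀ i, a i ∈ pathSpan K s r (v i) u) →
      (∀ j, ∑ i, G j i * a i = 0) → ∀ i, (∀ j, G j i = 0) ∨ a i = 0
  · exact ⟨1, 1, hone, hone, by simp, by simp, by simpa using hdep⟩
  push Not at hdep
  obtain ⟨u, a, ha, h, hne⟩ := hdep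
  obtain ⟨i₀, b, hb, hb₀, hdeg⟩ := exists_column_of_dependence ha h hne
  let M : Matrix ι ι 𝓐 := Matrix.of fun i j => if j = i₀ ∧ i ≠ i₀ then b i else 0
  have hM : ∀ i j, M i j ∈ pathSpan K s r (v i) (v j) := by
    intro i j
    simp only [M, Matrix.of_apply]
    split_ifs with h1
    · rw [h1.1]
      exact hb i
    · exact zero_mem _
  have hMM : M * M = 0 := by
    ext1 i j
    rw [Matrix.mul_apply]
    refine Finset.sum_eq_zero fun k _ => ?_
    simp only [M, Matrix.of_apply]
    by_cases hk : k = i₀ <;> simp [hk]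
  have hGM : ∀ j i, (G * (1 + M : Matrix ι ι 𝓐)) j i = if i = i₀ then ∑ k, G j k * b k else G j i := by
    intro j i
    rw [Matrix.mul_add, Matrix.mul_one, Matrix.add_apply, Matrix.mul_apply]
    split_ifs with hi
    · subst hi
      rw [← Finset.add_sum_erase _ (fun k => G j k * b k) (Finset.mem_univ i),
        ← Finset.add_sum_erase _ (fun k => G j k * M k i) (Finset.mem_univ i), hb₀]
      have h1 : M i i = 0 := by simp [M]
      rw [h1, mul_zero, zero_add, mul_one]
      refine congrArg _ (Finset.sum_congr rfl fun k hk => ?_)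
      simp [M, Finset.ne_of_mem_erase hk]
    · simp [M, hi]
  have hG' : ∀ j i, (G * (1 + M : Matrix ι ι 𝓐)) j i ∈ pathSpan K s r (w j) (v i) := by
    intro j i
    rw [hGM]
    split_ifs with hi
    · rw [hi]
      exact sum_mem fun k _ => mul_mem_pathSpan (hG j k) (hb k)
    · exact hG j i
  have hlt : ∑ i, columnDegree (G * (1 + M)) i < N := by
    rw [← hN]
    have h1 : columnDegree (G * (1 + M)) i₀ < columnDegree G i₀ := by
      obtain ⟨_, ⟨j₀, _⟩, _⟩ := hne
      refine (Finset.sup_lt_iff ((Nat.zero_le _).trans_lt (hdeg j₀))).2 fun j _ => ?_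
      rw [hGM, if_pos rfl]
      exact hdeg j
    refine Finset.sum_lt_sum (fun i _ => ?_) ⟨i₀, Finset.mem_univ _, h1⟩
    by_cases hi : i = i₀
    · rw [hi]
      exact h1.le
    · simp [columnDegree, hGM, hi]
  obtain ⟨U, U', hU, hU', h1, h2, h3⟩ := ih _ hlt (G * (1 + M)) hG' rfl
  have hmul : ∀ {A B : Matrix ι ι 𝓐}, (∀ i j, A i j ∈ pathSpan K s r (v i) (v j)) →
      (∀ i j, B i j ∈ pathSpan K s r (v i) (v j)) →
      ∀ i j, (A * B) i j ∈ pathSpan K s r (v i) (v j) := by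
    intro A B hA hB i j
    rw [Matrix.mul_apply]
    exact sum_mem fun k _ => mul_mem_pathSpan (hA i k) (hB k j)
  have hM1 : (1 + M) * (1 - M) = 1 := by
    rw [add_mul, mul_sub, mul_sub, hMM]
    simp
  have hM2 : (1 - M) * (1 + M) = 1 := by
    rw [sub_mul, mul_add, mul_add, hMM]
    simp
  refine ⟨(1 + M) * U, U' * (1 - M), hmul (fun i j => add_mem (hone i j) (hM i j)) hU,
    hmul hU' fun i j => sub_mem (hone i j) (hM i j), ?_, ?_, ?_⟩
  · rw [Matrix.mul_assoc, ← Matrix.mul_assoc U, h1, Matrix.one_mul, hM1]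
  · rw [Matrix.mul_assoc, ← Matrix.mul_assoc (1 - M), hM2, Matrix.one_mul, h2]
  · simpa only [Matrix.mul_assoc] using h3

end WeakAlgorithm

section Diagonalization

local notation "𝓛" => LPA K s r
local notation "vx" => vertexEl K s r
local notation "𝓙" => longPaths K s r
local notation "𝓓" => vertexDiag K s r
local notation "𝓐" => MonoidAlgebra K (FreeMonoid E)
local notation "ev" => evalWords K s r

variable {ι κ μ : Type}

set_option linter.unusedSectionVars false

/-- The evaluation of a matrix of formal combinations of words, with prescribed sources. -/
noncomputable def evalMatrix (v : ι → V) (G : Matrix ι κ (MonoidAlgebra K (FreeMonoid E))) :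
    Matrix ι κ (LPA K s r) :=
  Matrix.of fun i j => vertexEl K s r (v i) * evalWords K s r (G i j)

lemma evalMatrix_apply (v : ι → V) (G : Matrix ι κ 𝓐) (i : ι) (j : κ) :
    evalMatrix K s r v G i j = vx (v i) * ev (G i j) := rfl

lemma vertexDiag_mul_evalMatrix [Fintype ι] (v : ι → V) (G : Matrix ι κ 𝓐) :
    𝓓 v * evalMatrix K s r v G = evalMatrix K s r v G := by
  ext i j
  rw [vertexDiag_mul_apply, evalMatrix_apply, ← mul_assoc, vertex_mul_self]

lemma evalMatrix_mul [Fintype κ] {v : ι → V} {w : κ → V} {G : Matrix ι κ 𝓐}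
    (hG : ∀ i j, G i j ∈ pathSpan K s r (v i) (w j)) (H : Matrix κ μ 𝓐) :
    evalMatrix K s r v (G * H) = evalMatrix K s r v G * evalMatrix K s r w H := by
  ext i j
  rw [Matrix.mul_apply, evalMatrix_apply, Matrix.mul_apply, map_sum, Finset.mul_sum]
  refine Finset.sum_congr rfl fun k _ => ?_
  rw [evalMatrix_apply, evalMatrix_apply, map_mul, ← mul_assoc, ← mul_assoc,
    mul_assoc _ _ (vx (w k)), ← vertex_mul_evalWords (hG i k), ← mul_assoc, vertex_mul_self]

lemma evalMatrix_one (v : ι → V) : evalMatrix K s r v (1 : Matrix ι ι 𝓐) = 𝓓 v := by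
  ext i j
  rw [evalMatrix_apply, vertexDiag_apply, Matrix.one_apply]
  split_ifs <;> simp

lemma exists_evalMatrix_eq [Fintype ι] [Fintype κ] {v : ι → V} {w : κ → V} {X : Matrix ι κ 𝓛}
    (hX : ∀ i j, X i j ∈ 𝓙 0) (h : 𝓓 v * X = X) (h' : X * 𝓓 w = X) :
    ∃ G : Matrix ι κ 𝓐, (∀ i j, G i j ∈ pathSpan K s r (v i) (w j)) ∧
      evalMatrix K s r v G = X := by
  choose G hG hG' using fun i j => exists_evalWords_eq K s r (hX i j) (v i) (w j)
  refine ⟨Matrix.of G, hG, ?_⟩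
  ext i j
  rw [evalMatrix_apply, Matrix.of_apply, hG', ← vertexDiag_mul_apply, h, ← mul_vertexDiag_apply, h']

lemma eq_zero_of_evalMatrix_eq_zero [Countable E] {v : ι → V} {w : κ → V} {G : Matrix ι κ 𝓐}
    (hG : ∀ i j, G i j ∈ pathSpan K s r (v i) (w j)) (h : evalMatrix K s r v G = 0) : G = 0 := by
  ext1 i j
  exact eq_zero_of_vertex_mul_evalWords K s r (hG i j) (by rw [← evalMatrix_apply, h]; rfl)

lemma exists_forall_den [Finite ι] (c : ι → 𝓛) : ∃ n, ∀ i, Den K s r n (c i) := by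
  cases nonempty_fintype ι
  choose n hn using fun i => exists_den K s r (c i)
  exact ⟨Finset.univ.sup n, fun i => (hn i).mono (Finset.le_sup (Finset.mem_univ i))⟩

variable [Fintype E] [Fintype ι] [Fintype κ]

lemma eq_zero_of_independent_columns {v : ι → V} {w : κ → V} {H : Matrix ι κ 𝓐}
    (hH : ∀ i j, H i j ∈ pathSpan K s r (v i) (w j))
    (hind : ∀ (u : V) (a : κ → 𝓐), (∀ j, a j ∈ pathSpan K s r (w j) u) →
      (∀ i, ∑ j, H i j * a j = 0) → ∀ j, (∀ i, H i j = 0) ∨ a j = 0)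
    {c : Matrix κ μ 𝓛} (hc : 𝓓 w * c = c) (h : evalMatrix K s r v H * c = 0) {j : κ}
    (hj : ¬ ∀ i, H i j = 0) (k : μ) : c j k = 0 := by
  obtain ⟨n, hn⟩ := exists_forall_den K s r fun j => c j k
  have key : ∀ u, c j k * vx u = 0 := by
    intro u
    obtain ⟨τ, _, t, T, T', h1, -, -, h4, -, -, h7, -⟩ :=
      exists_long_decomposition K s r (fun _ : Unit => u) n
    let X : Matrix κ τ 𝓛 := c.submatrix id (fun _ : Unit => k) * T
    have hX : ∀ i l, X i l = c i k * T () l := fun i l => by simp [X, Matrix.mul_apply]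
    obtain ⟨a, ha, haX⟩ := exists_evalMatrix_eq K s r (v := w) (w := t) (X := X)
      (fun i l => by rw [hX]; exact hn i _ (h7 () l)) (by
        have h5 : 𝓓 w * c.submatrix id (fun _ : Unit => k) = c.submatrix id fun _ => k := by
          conv_rhs => rw [← hc]
          rfl
        rw [← Matrix.mul_assoc, h5]) (by rw [Matrix.mul_assoc, h4])
    have h8 : H * a = 0 := by
      refine eq_zero_of_evalMatrix_eq_zero K s r (v := v) (w := t) (fun i l => ?_) ?_
      · rw [Matrix.mul_apply]
        exact sum_mem fun m _ => mul_mem_pathSpan (hH i m) (ha m l)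
      · have h9 : evalMatrix K s r v H * c.submatrix id (fun _ : Unit => k) =
            (evalMatrix K s r v H * c).submatrix id fun _ => k := rfl
        rw [evalMatrix_mul K s r hH, haX, ← Matrix.mul_assoc, h9, h]
        simp
    have h9 : ∀ l, X j l = 0 := by
      intro l
      have h10 := hind (t l) (fun m => a m l) (fun m => ha m l)
        (fun i => by rw [← Matrix.mul_apply, h8]; rfl) j
      rw [← haX, evalMatrix_apply, h10.resolve_left hj, map_zero, mul_zero]
    have h10 : c j k * vx u = (X * T') j () := by
      rw [Matrix.mul_assoc, h1, mul_vertexDiag_apply, Matrix.submatrix_apply, id]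
    rw [h10, Matrix.mul_apply]
    exact Finset.sum_eq_zero fun l _ => by rw [h9, zero_mul]
  rw [← mul_one (c j k), ← sum_vertex K s r, Finset.mul_sum]
  exact Finset.sum_eq_zero fun u _ => key u

lemma mvN_conj {R : Type} [Ring R] {p : Matrix ι ι R} (hp : p * p = p) {A : Matrix ι κ R}
    {B : Matrix κ ι R} (h : A * B * p = p) : MvN p (B * p * A) := by
  refine ⟨p * A, B * p, ?_, ?_⟩
  · rw [Matrix.mul_assoc, ← Matrix.mul_assoc A, h, hp]
  · rw [Matrix.mul_assoc, ← Matrix.mul_assoc p, hp, Matrix.mul_assoc]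

lemma conj_mul_conj {R : Type} [Ring R] {p : Matrix ι ι R} (hp : p * p = p) {A : Matrix ι κ R}
    {B : Matrix κ ι R} (h : A * B * p = p) : B * p * A * (B * p * A) = B * p * A := by
  have : B * p * A * (B * p * A) = B * (p * (A * B * p)) * A := by simp only [Matrix.mul_assoc]
  rw [this, h, hp]

/-- Restriction of a diagonal idempotent to a subset of the indices. -/
lemma mvN_restrict (w : κ → V) (Z : κ → Prop) :
    MvN (Matrix.of fun i j => if i = j ∧ Z i then vx (w i) else 0)
      (𝓓 fun j : {j // Z j} => w j) := by
  refine ⟨Matrix.of fun i j => if i = j.1 then vx (w i) else 0,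
    Matrix.of fun j i => if j.1 = i then vx (w i) else 0, ?_, ?_⟩
  · ext i j
    rw [Matrix.mul_apply, Matrix.of_apply]
    simp only [Matrix.of_apply]
    by_cases hi : Z i
    · rw [Finset.sum_eq_single ⟨i, hi⟩]
      · by_cases h : i = j
        · subst h
          simp [hi, vertex_mul_self]
        · simp [h]
      · intro k _ hk
        rw [if_neg, zero_mul]
        exact fun h => hk (Subtype.ext h.symm)
      · simp
    · rw [if_neg fun h => hi h.2]
      refine Finset.sum_eq_zero fun k _ => ?_
      rw [if_neg, zero_mul]
      rintro rfl
      exact hi k.2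
  · ext i j
    rw [Matrix.mul_apply, vertexDiag_apply]
    simp only [Matrix.of_apply]
    rw [Finset.sum_eq_single i.1]
    · by_cases h : i = j
      · subst h
        simp [vertex_mul_self]
      · have : i.1 ≠ j.1 := fun h' => h (Subtype.ext h')
        simp [h, this]
    · intro k _ hk
      simp [Ne.symm hk]
    · simp

lemma exists_mvN_vertexDiag_of_le {v : ι → V} {p : Matrix ι ι 𝓛} (hp : p * p = p)
    (h : 𝓓 v * p = p) :
    ∃ (κ : Type) (_ : Fintype κ) (w : κ → V), MvN p (𝓓 w) := by
  obtain ⟨n, hn⟩ := exists_forall_den K s r fun x : ι × ι => (𝓓 v - p) x.1 x.2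
  obtain ⟨κ, _, w, T, T', h1, h2, h3, h4, h5, h6, h7, -⟩ := exists_long_decomposition K s r v n
  have hq : 𝓓 v * (𝓓 v - p) = 𝓓 v - p := by rw [mul_sub, h, vertexDiag_mul_self]
  obtain ⟨G, hG, hGX⟩ := exists_evalMatrix_eq K s r (v := v) (w := w) (X := (𝓓 v - p) * T)
    (fun i j => by
      rw [Matrix.mul_apply]
      exact sum_mem fun k _ => hn (i, k) _ (h7 k j))
    (by rw [← Matrix.mul_assoc, hq]) (by rw [Matrix.mul_assoc, h4])
  obtain ⟨U, U', hU, hU', hUU', hU'U, hind⟩ := exists_column_reduction w v G hG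
  set S := evalMatrix K s r w U
  set S' := evalMatrix K s r w U'
  have hSS' : S * S' = 𝓓 w := by rw [← evalMatrix_mul K s r hU, hUU', evalMatrix_one]
  have hS'S : S' * S = 𝓓 w := by rw [← evalMatrix_mul K s r hU', hU'U, evalMatrix_one]
  have hS : 𝓓 w * S = S := vertexDiag_mul_evalMatrix K s r w U
  have hS' : 𝓓 w * S' = S' := vertexDiag_mul_evalMatrix K s r w U'
  have hGU : ∀ i j, (G * U) i j ∈ pathSpan K s r (v i) (w j) := fun i j => by
    rw [Matrix.mul_apply]
    exact sum_mem fun k _ => mul_mem_pathSpan (hG i k) (hU k j)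
  have hAB : T * S * (S' * T') = 𝓓 v := by
    rw [Matrix.mul_assoc, ← Matrix.mul_assoc S, hSS', h5, h1]
  have hBA : S' * T' * (T * S) = 𝓓 w := by
    rw [Matrix.mul_assoc, ← Matrix.mul_assoc T', h2, hS, hS'S]
  have hABp : T * S * (S' * T') * p = p := by rw [hAB, h]
  have hY : evalMatrix K s r v (G * U) = (𝓓 v - p) * (T * S) := by
    rw [evalMatrix_mul K s r hG, hGX, Matrix.mul_assoc]
  set A := T * S
  set B := S' * T'
  have hA : 𝓓 v * A = A := by rw [← Matrix.mul_assoc, h3]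
  have hB : 𝓓 w * B = B := by rw [← Matrix.mul_assoc, hS']
  set Z : κ → Prop := fun j => ∀ i, (G * U) i j = 0
  set D : Matrix κ κ 𝓛 := Matrix.of fun i j => if i = j ∧ Z i then vx (w i) else 0 with hD
  have hf1 : 𝓓 w * (B * p * A) = B * p * A := by
    rw [← Matrix.mul_assoc (𝓓 w) (B * p), ← Matrix.mul_assoc (𝓓 w) B, hB]
  have hf2 : evalMatrix K s r v (G * U) * (B * p * A) = 0 := by
    have : evalMatrix K s r v (G * U) * (B * p * A) = (𝓓 v - p) * (A * B * p) * A := by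
      rw [hY]
      simp only [Matrix.mul_assoc]
    rw [this, hABp, sub_mul, h, hp, sub_self, Matrix.zero_mul]
  have hDf : D * (B * p * A) = B * p * A := by
    ext i j
    have hDi : ∀ X : Matrix κ κ 𝓛, (D * X) i j = if Z i then vx (w i) * X i j else 0 := by
      intro X
      rw [Matrix.mul_apply, Finset.sum_eq_single i]
      · simp [hD]
      · intro k _ hk
        simp [hD, Ne.symm hk]
      · simp
    rw [hDi]
    split_ifs with hi
    · rw [← vertexDiag_mul_apply, hf1]
    · exact (eq_zero_of_independent_columns K s r hGU hind hf1 hf2 hi j).symm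
  have hwD : 𝓓 w * D = D := by
    ext i j
    rw [vertexDiag_mul_apply, hD, Matrix.of_apply]
    split_ifs <;> simp [vertex_mul_self]
  have hYD : evalMatrix K s r v (G * U) * D = 0 := by
    ext i j
    rw [Matrix.mul_apply]
    refine Finset.sum_eq_zero fun k _ => ?_
    rw [hD, Matrix.of_apply]
    split_ifs with hk
    · rw [evalMatrix_apply, hk.2 i]
      simp
    · rw [mul_zero]
  have hfD : B * p * A * D = D := by
    have h8 : p * (A * D) = A * D := by
      rw [hY, Matrix.mul_assoc, Matrix.sub_mul, ← Matrix.mul_assoc, hA, sub_eq_zero] at hYD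
      exact hYD.symm
    rw [Matrix.mul_assoc, Matrix.mul_assoc, h8, ← Matrix.mul_assoc, hBA, hwD]
  have hDD : D * D = D := by
    have h9 : D * (B * p * A * D) = B * p * A * D := by rw [← Matrix.mul_assoc, hDf]
    rwa [hfD] at h9
  have hDZ : MvN D (𝓓 fun j : {j // Z j} => w j) := by
    convert mvN_restrict K s r w Z
  refine ⟨_, inferInstance, fun j : {j // Z j} => w j, ?_⟩
  refine (mvN_conj hp hABp).trans (MvN.trans ⟨D, B * p * A, hDf, hfD⟩ hDZ
    (conj_mul_conj hp hABp) (vertexDiag_mul_self K s r _)) hp (vertexDiag_mul_self K s r _)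

/-- Every idempotent matrix is equivalent to a diagonal matrix of vertices. -/
theorem exists_mvN_vertexDiag {p : Matrix ι ι 𝓛} (hp : p * p = p) :
    ∃ (κ : Type) (_ : Fintype κ) (w : κ → V), MvN p (𝓓 w) := by
  let x : Matrix ι (ι × V) 𝓛 := Matrix.of fun i j => if i = j.1 then vx j.2 else 0
  let y : Matrix (ι × V) ι 𝓛 := Matrix.of fun j i => if j.1 = i then vx j.2 else 0
  have hxy : x * y = 1 := by
    ext i j
    rw [Matrix.mul_apply, Fintype.sum_prod_type, Matrix.one_apply]
    simp only [x, y, Matrix.of_apply]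
    rw [Finset.sum_eq_single i]
    · by_cases h : i = j
      · simp [h, vertex_mul_self, sum_vertex]
      · simp [h]
    · intro k _ hk
      simp [Ne.symm hk]
    · simp
  have hyx : y * x = 𝓓 (Prod.snd : ι × V → V) := by
    ext ⟨i, u⟩ ⟨j, u'⟩
    rw [Matrix.mul_apply, vertexDiag_apply]
    simp only [x, y, Matrix.of_apply]
    rw [Finset.sum_eq_single i]
    · by_cases h : i = j
      · simp [h, vertex_mul]
      · simp [h]
    · intro k _ hk
      simp [Ne.symm hk]
    · simp
  have hxyp : x * y * p = p := by rw [hxy, Matrix.one_mul]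
  obtain ⟨κ, _, w, h⟩ := exists_mvN_vertexDiag_of_le K s r (v := (Prod.snd : ι × V → V))
    (conj_mul_conj hp hxyp)
    (by rw [← hyx, Matrix.mul_assoc y x, ← Matrix.mul_assoc x, ← Matrix.mul_assoc x, hxyp,
      Matrix.mul_assoc])
  exact ⟨κ, inferInstance, w, (mvN_conj hp hxyp).trans h hp (vertexDiag_mul_self K s r _)⟩

end Diagonalization

section MatricesToClasses

local notation "𝓛" => LPA K s r
local notation "vx" => vertexEl K s r
local notation "ed" => edgeEl K s r
local notation "gh" => ghostEl K s r
local notation "𝓙" => longPaths K s r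
local notation "𝓓" => vertexDiag K s r
local notation "ε" => vertexCoeff K s r

set_option linter.unusedSectionVars false

lemma edge_mem_posPaths (e : E) : ed e ∈ posPaths K s r :=
  Submodule.subset_span ⟨FreeMonoid.of e, r e, by simp, by
    rw [word_of, edge_mul_range]⟩

variable {K s r} in
lemma Den.sum {ι : Type} {t : Finset ι} {n : ℕ} {f : ι → 𝓛} (h : ∀ i ∈ t, Den K s r n (f i)) :
    Den K s r n (∑ i ∈ t, f i) :=
  Finset.sum_induction f (Den K s r n) (fun _ _ => Den.add)
    (fun y _ => by rw [zero_mul]; exact zero_mem _) h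

variable {K s r} in
lemma Den.mul_algebraMap {n : ℕ} {x : 𝓛} (hx : Den K s r n x) (a : K) :
    Den K s r n (x * algebraMap K 𝓛 a) := fun y hy => by
  rw [mul_assoc, ← Algebra.smul_def]
  exact hx _ (Submodule.smul_mem _ _ hy)

variable {K s r} in
lemma Den.mul_posPaths {n : ℕ} {x y : 𝓛} (hx : Den K s r (n + 1) x) (hy : y ∈ posPaths K s r) :
    Den K s r n (x * y) := fun z hz => by
  rw [mul_assoc]
  exact hx _ (posPaths_mul_longPaths K s r hy hz)

variable {ι κ : Type} [Fintype ι] [Fintype κ]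

/-- Mutually inverse matrices implementing the equivalence of two families of vertices. -/
structure InversePair (w : κ → V) (v : ι → V) (X : Matrix κ ι (LPA K s r))
    (Y : Matrix ι κ (LPA K s r)) : Prop where
  mul_eq : X * Y = vertexDiag K s r w
  mul_eq' : Y * X = vertexDiag K s r v
  left : vertexDiag K s r w * X = X
  right : X * vertexDiag K s r v = X
  left' : vertexDiag K s r v * Y = Y
  right' : Y * vertexDiag K s r w = Y

variable [Countable E]

lemma map_vertexCoeff_vertexDiag (u : V) (v : ι → V) :
    (𝓓 v).map (ε u) = Matrix.diagonal fun i => if v i = u then (1 : K) else 0 := by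
  ext i j
  rw [Matrix.map_apply, vertexDiag_apply, Matrix.diagonal_apply]
  by_cases h : i = j
  · simp [h, vertexCoeff_vertex, eq_comm]
  · simp [h]

lemma map_vertexCoeff_mul (u : V) {μ : Type} {X : Matrix κ ι 𝓛} {Y : Matrix ι μ 𝓛}
    (hX : ∀ i j, X i j ∈ 𝓙 0) (hY : ∀ i j, Y i j ∈ 𝓙 0) :
    (X * Y).map (ε u) = X.map (ε u) * Y.map (ε u) := by
  ext i j
  rw [Matrix.map_apply, Matrix.mul_apply, map_sum, Matrix.mul_apply]
  exact Finset.sum_congr rfl fun k _ => vertexCoeff_mul K s r u (hX i k) (hY k j)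

lemma vertexCoeff_eq_zero (u : V) {x : 𝓛} (hx : x ∈ posPaths K s r) : ε u x = 0 := by
  induction hx using Submodule.span_induction with
  | mem x hx =>
    obtain ⟨w, v, h, rfl⟩ := hx
    rw [vertexCoeff_word, if_neg]
    rintro ⟨rfl, -⟩
    simp at h
  | zero => exact map_zero _
  | add x y _ _ hx hy => rw [map_add, hx, hy, add_zero]
  | smul a x _ hx => rw [map_smul, hx, smul_zero]

lemma rank_map_vertexCoeff (u : V) (v : ι → V) : ((𝓓 v).map (ε u)).rank = count v u := by
  rw [map_vertexCoeff_vertexDiag, Matrix.rank_diagonal, count_apply]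
  refine Fintype.card_congr (Equiv.subtypeEquivRight fun i => ?_)
  simp

variable {K s r}

lemma InversePair.symm {w : κ → V} {v : ι → V} {X : Matrix κ ι 𝓛} {Y : Matrix ι κ 𝓛}
    (h : InversePair K s r w v X Y) : InversePair K s r v w Y X :=
  ⟨h.mul_eq', h.mul_eq, h.left', h.right', h.left, h.right⟩

lemma InversePair.count_le {w : κ → V} {v : ι → V} {X : Matrix κ ι 𝓛} {Y : Matrix ι κ 𝓛}
    (h : InversePair K s r w v X Y) (hX : ∀ i j, X i j ∈ 𝓙 0) (hY : ∀ i j, Y i j ∈ 𝓙 0) (u : V) :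
    count w u ≤ count v u := by
  rw [← rank_map_vertexCoeff K s r, ← rank_map_vertexCoeff K s r]
  have h1 : X * (𝓓 v * Y) = 𝓓 w := by rw [h.left', h.mul_eq]
  have hD : ∀ i j, 𝓓 v i j ∈ 𝓙 0 := fun i j => by
    rw [vertexDiag_apply]
    split_ifs
    exacts [vertex_mem_paths K s r _, zero_mem _]
  rw [← h1, map_vertexCoeff_mul K s r u hX (by rwa [h.left']), map_vertexCoeff_mul K s r u hD hY]
  exact (Matrix.rank_mul_le_right _ _).trans (Matrix.rank_mul_le_left _ _)

lemma InversePair.count_eq {w : κ → V} {v : ι → V} {X : Matrix κ ι 𝓛} {Y : Matrix ι κ 𝓛}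
    (h : InversePair K s r w v X Y) (hX : ∀ i j, X i j ∈ 𝓙 0) (hY : ∀ i j, Y i j ∈ 𝓙 0) :
    count w = count v :=
  Finsupp.ext fun u => (h.count_le hX hY u).antisymm (h.symm.count_le hY hX u)

lemma InversePair.mem_of_surjective {w : κ → V} {v : ι → V} {X : Matrix κ ι 𝓛}
    {Y : Matrix ι κ 𝓛} (h : InversePair K s r w v X Y) (hX : ∀ i j, X i j ∈ 𝓙 0)
    (hsurj : ∀ j, ∃ c : ι → K, ∀ k, ∑ i, ε (w j) (X k i) * c i = if k = j then 1 else 0)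
    (i : ι) (j : κ) : Y i j ∈ 𝓙 0 := by
  choose c hc using hsurj
  let C : Matrix ι κ 𝓛 := Matrix.of fun i j => c j i • vx (w j)
  have hC : ∀ i j, C i j ∈ 𝓙 0 := fun i j => Submodule.smul_mem _ _ (vertex_mem_paths K s r _)
  have hN : ∀ k j, (𝓓 w - X * C) k j ∈ posPaths K s r := by
    intro k j
    have hmem : (𝓓 w - X * C) k j ∈ 𝓙 0 := by
      rw [Matrix.sub_apply, vertexDiag_apply, Matrix.mul_apply]
      refine sub_mem ?_ (sum_mem fun l _ => paths_mul_longPaths K s r (hX k l) (hC l j))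
      split_ifs
      exacts [vertex_mem_paths K s r _, zero_mem _]
    have h0 : ∀ u, ε u ((𝓓 w - X * C) k j) = 0 := by
      intro u
      have h1 : ∀ l, ε u (X k l * C l j) = if u = w j then ε (w j) (X k l) * c j l else 0 := by
        intro l
        rw [vertexCoeff_mul K s r u (hX k l) (hC l j)]
        simp only [C, Matrix.of_apply, map_smul, vertexCoeff_vertex]
        split_ifs with h
        · simp [h]
        · simp
      rw [Matrix.sub_apply, map_sub, Matrix.mul_apply, map_sum, Finset.sum_congr rfl fun l _ => h1 l,
        vertexDiag_apply]
      by_cases h2 : u = w j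
      · simp only [h2, if_true, hc]
        split_ifs with h3
        · simp [h3, vertexCoeff_vertex]
        · simp
      · simp only [h2, if_false, Finset.sum_const_zero, sub_zero]
        split_ifs with h3
        · rw [vertexCoeff_vertex, h3, if_neg h2]
        · simp
    have := sub_vertexCoeff_mem K s r hmem
    rwa [Finset.sum_eq_zero fun u _ => by rw [h0, zero_smul], sub_zero] at this
  have hYN : Y = 𝓓 v * C + Y * (𝓓 w - X * C) := by
    rw [Matrix.mul_sub, h.right', ← Matrix.mul_assoc, h.mul_eq']
    abel
  have hDC : ∀ i j, (𝓓 v * C) i j ∈ 𝓙 0 := fun i j => by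
    rw [vertexDiag_mul_apply]
    exact paths_mul_longPaths K s r (vertex_mem_paths K s r _) (hC i j)
  obtain ⟨n, hn⟩ := exists_forall_den K s r fun x : ι × κ => Y x.1 x.2
  have key : ∀ i j, Den K s r 0 (Y i j) := by
    replace hn : ∀ i j, Den K s r n (Y i j) := fun i j => hn (i, j)
    induction n with
    | zero => exact hn
    | succ n ih =>
      refine ih fun i j => ?_
      rw [hYN, Matrix.add_apply, Matrix.mul_apply]
      exact ((den_of_mem K s r (hDC i j)).mono (Nat.zero_le _)).add
        (Den.sum fun k _ => (hn i k).mul_posPaths (hN k j))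
  exact (key i j).mem

lemma InversePair.exists_combination {w : κ → V} {v : ι → V} {X : Matrix κ ι 𝓛}
    {Y : Matrix ι κ 𝓛} (h : InversePair K s r w v X Y) (hX : ∀ i j, X i j ∈ 𝓙 0) (j : κ)
    (hj : ¬ ∃ c : ι → K, ∀ k, ∑ i, ε (w j) (X k i) * c i = if k = j then 1 else 0) :
    ∃ c : κ → K, c j ≠ 0 ∧ (∀ k, c k ≠ 0 → w k = w j) ∧
      ∀ i, ∑ k, c k • X k i ∈ posPaths K s r := by
  let M : Matrix κ ι K := X.map (ε (w j))
  have hnot : (Pi.single j 1 : κ → K) ∉ LinearMap.range M.mulVecLin := by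
    rintro ⟨c, hc⟩
    refine hj ⟨c, fun k => ?_⟩
    have := congrFun hc k
    rw [Pi.single_apply] at this
    rw [← this]
    rfl
  obtain ⟨f, hf, hfM⟩ := Submodule.exists_le_ker_of_notMem hnot
  have hw : ∀ u k i, w k ≠ u → ε u (X k i) = 0 := by
    intro u k i hk
    have h1 : X k i = vx (w k) * X k i := by rw [← vertexDiag_mul_apply, h.left]
    rw [h1, vertexCoeff_mul K s r u (vertex_mem_paths K s r _) (hX k i), vertexCoeff_vertex,
      if_neg (Ne.symm hk), zero_mul]
  have hfX : ∀ i, ∑ k, f (Pi.single k 1) * ε (w j) (X k i) = 0 := by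
    intro i
    have h1 : f (M.mulVecLin (Pi.single i 1)) = 0 := hfM ⟨_, rfl⟩
    have h2 : M.mulVecLin (Pi.single i 1) = ∑ k, M k i • (Pi.single k 1 : κ → K) := by
      ext k
      simp [Finset.sum_apply, Pi.single_apply]
    rw [h2, map_sum] at h1
    rw [← h1]
    refine Finset.sum_congr rfl fun k _ => ?_
    rw [map_smul, smul_eq_mul, mul_comm]
    rfl
  refine ⟨fun k => if w k = w j then f (Pi.single k 1) else 0, by simpa using hf, fun k hk => ?_,
    fun i => ?_⟩
  · by_contra h1
    simp [h1] at hk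
  · have hmem : ∑ k, (if w k = w j then f (Pi.single k 1) else 0) • X k i ∈ 𝓙 0 :=
      sum_mem fun k _ => Submodule.smul_mem _ _ (hX k i)
    have h0 : ∀ u, ε u (∑ k, (if w k = w j then f (Pi.single k 1) else 0) • X k i) = 0 := by
      intro u
      rw [map_sum]
      by_cases hu : u = w j
      · rw [← hfX i, hu]
        refine Finset.sum_congr rfl fun k _ => ?_
        rw [map_smul, smul_eq_mul]
        split_ifs with hk
        · rfl
        · rw [hw _ _ _ hk, mul_zero, mul_zero]
      · refine Finset.sum_eq_zero fun k _ => ?_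
        rw [map_smul]
        split_ifs with hk
        · rw [hw u k i (by rw [hk]; exact Ne.symm hu), smul_zero]
        · rw [zero_smul]
    have := sub_vertexCoeff_mem K s r hmem
    simp only [h0, zero_smul, Finset.sum_const_zero, sub_zero] at this
    exact this

lemma exists_elementary_inverse {c : κ → K} {j : κ} (hj : c j ≠ 0) :
    ∃ g' : Matrix κ κ K, (1 : Matrix κ κ K).updateRow j c * g' = 1 ∧
      g' * (1 : Matrix κ κ K).updateRow j c = 1 ∧
      ∀ l k, g' l k ≠ 0 → l = k ∨ l = j ∧ c k ≠ 0 := by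
  let c' : κ → K := fun k => if k = j then (c j)⁻¹ else -(c k / c j)
  have h : (1 : Matrix κ κ K).updateRow j c * (1 : Matrix κ κ K).updateRow j c' = 1 := by
    rw [Matrix.updateRow_mul, Matrix.one_mul]
    have h1 : Matrix.vecMul c ((1 : Matrix κ κ K).updateRow j c') = (1 : Matrix κ κ K) j := by
      ext k
      rw [Matrix.vecMul, dotProduct, ← Finset.add_sum_erase _ _ (Finset.mem_univ j),
        Matrix.updateRow_self, Finset.sum_congr rfl (g := fun l => if l = k then c l else 0)]
      · rw [Finset.sum_ite_eq', Matrix.one_apply]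
        by_cases hk : k = j
        · simp [c', hk, hj]
        · simp only [c', if_neg hk, Ne.symm hk, if_false, Finset.mem_erase, Finset.mem_univ, hk,
            ne_eq, not_false_eq_true, and_self, if_true]
          field_simp
          ring
      · intro l hl
        rw [Matrix.updateRow_ne (Finset.ne_of_mem_erase hl), Matrix.one_apply]
        split_ifs <;> simp
    rw [h1]
    ext l k
    by_cases hl : l = j
    · rw [hl, Matrix.updateRow_self]
    · rw [Matrix.updateRow_ne hl, Matrix.updateRow_ne hl]
  refine ⟨_, h, mul_eq_one_comm.1 h, fun l k hlk => ?_⟩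
  by_cases hl : l = j
  · subst hl
    rw [Matrix.updateRow_self] at hlk
    by_cases hk : k = l
    · exact .inl hk.symm
    · refine .inr ⟨rfl, fun h0 => hlk ?_⟩
      simp [c', hk, h0]
  · rw [Matrix.updateRow_ne hl, Matrix.one_apply] at hlk
    exact .inl (by_contra fun h => hlk (if_neg h))

lemma InversePair.conj {w : κ → V} {v : ι → V} {X : Matrix κ ι 𝓛} {Y : Matrix ι κ 𝓛}
    (h : InversePair K s r w v X Y) {g g' : Matrix κ κ 𝓛} (hgg' : g * g' = 1) (hg'g : g' * g = 1)
    (hg : g * 𝓓 w = 𝓓 w * g) : InversePair K s r w v (g * X) (Y * g') := by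
  have hg' : g' * 𝓓 w = 𝓓 w * g' := by
    have h1 : g' * (g * 𝓓 w) * g' = g' * (𝓓 w * g) * g' := by rw [hg]
    rw [← Matrix.mul_assoc, hg'g, Matrix.one_mul, Matrix.mul_assoc, Matrix.mul_assoc, hgg',
      Matrix.mul_one] at h1
    exact h1.symm
  refine ⟨?_, ?_, ?_, ?_, ?_, ?_⟩
  · rw [Matrix.mul_assoc, ← Matrix.mul_assoc X, h.mul_eq, ← hg', ← Matrix.mul_assoc, hgg',
      Matrix.one_mul]
  · rw [Matrix.mul_assoc, ← Matrix.mul_assoc g', hg'g, Matrix.one_mul, h.mul_eq']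
  · rw [← Matrix.mul_assoc, ← hg, Matrix.mul_assoc, h.left]
  · rw [Matrix.mul_assoc, h.right]
  · rw [← Matrix.mul_assoc, h.left']
  · rw [Matrix.mul_assoc, hg', ← Matrix.mul_assoc, h.right']

lemma InversePair.expand [Fintype E] {w : κ → V} {v : ι → V} {X : Matrix κ ι 𝓛} {Y : Matrix ι κ 𝓛}
    (h : InversePair K s r w v X Y) (b : κ → Prop) :
    InversePair K s r (labelFamily s r b w) v (labelMatrixInv K s r b w * X)
      (Y * labelMatrix K s r b w) := by
  refine ⟨?_, ?_, ?_, ?_, ?_, ?_⟩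
  · rw [Matrix.mul_assoc, ← Matrix.mul_assoc X, h.mul_eq, vertexDiag_mul_labelMatrix,
      labelMatrixInv_mul_labelMatrix]
  · rw [Matrix.mul_assoc, ← Matrix.mul_assoc _ _ X, labelMatrix_mul_labelMatrixInv, h.left, h.mul_eq']
  · rw [← Matrix.mul_assoc, vertexDiag_mul_labelMatrixInv]
  · rw [Matrix.mul_assoc, h.right]
  · rw [← Matrix.mul_assoc, h.left']
  · rw [Matrix.mul_assoc, labelMatrix_mul_vertexDiag]

lemma sum_pow_label_lt [Fintype E] {w : κ → V} {j : κ} (hj : ¬ IsSink s (w j)) {n : κ → ℕ}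
    (hn : n j ≠ 0) :
    ∑ x : LabelIndex s (· = j) w,
        (Fintype.card E + 1) ^ (if x.1 = j then n x.1 - 1 else n x.1) <
      ∑ k, (Fintype.card E + 1) ^ n k := by
  rw [Fintype.sum_sigma]
  have h1 : ∀ k, k ≠ j → ∑ x : {x // IsLabel s (k = j) (w k) x},
      (Fintype.card E + 1) ^ (if k = j then n k - 1 else n k) = (Fintype.card E + 1) ^ n k := by
    intro k hk
    rw [if_neg hk, isLabel_sum_eq s (k = j) (w k) fun _ => (Fintype.card E + 1) ^ n k,
      if_neg fun h => hk h.1]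
  have h2 : ∑ x : {x // IsLabel s (j = j) (w j) x},
      (Fintype.card E + 1) ^ (if j = j then n j - 1 else n j) < (Fintype.card E + 1) ^ n j := by
    rw [if_pos rfl, isLabel_sum_eq s (j = j) (w j) fun _ => (Fintype.card E + 1) ^ (n j - 1),
      if_pos ⟨rfl, hj⟩, Finset.sum_const, smul_eq_mul]
    calc _ ≤ Fintype.card E * (Fintype.card E + 1) ^ (n j - 1) :=
          Nat.mul_le_mul_right _ (Finset.card_le_univ _)
      _ < (Fintype.card E + 1) * (Fintype.card E + 1) ^ (n j - 1) :=
          Nat.mul_lt_mul_of_pos_right (Nat.lt_succ_self _) (by positivity)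
      _ = _ := by rw [← pow_succ', Nat.sub_add_cancel (Nat.one_le_iff_ne_zero.2 hn)]
  refine Finset.sum_lt_sum (fun k _ => ?_) ⟨j, Finset.mem_univ j, h2⟩
  by_cases hk : k = j
  · subst hk
    exact h2.le
  · exact (h1 k hk).le

lemma InversePair.exists_reduction [Fintype E] {w : κ → V} {v : ι → V} {X : Matrix κ ι 𝓛}
    {Y : Matrix ι κ 𝓛} (h : InversePair K s r w v X Y) (hX : ∀ i j, X i j ∈ 𝓙 0) {n : κ → ℕ}
    (hY : ∀ i j, Den K s r (n j) (Y i j)) {j₀ : κ}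
    (hj₀ : ¬ ∃ c : ι → K, ∀ k, ∑ i, ε (w j₀) (X k i) * c i = if k = j₀ then 1 else 0) :
    ∃ (j : κ) (X' : Matrix κ ι 𝓛) (Y' : Matrix ι κ 𝓛), InversePair K s r w v X' Y' ∧
      (∀ i, X' j i ∈ posPaths K s r) ∧ (∀ i k, X' i k ∈ 𝓙 0) ∧
      (∀ i k, Den K s r (n k) (Y' i k)) ∧ ¬ IsSink s (w j) ∧ n j ≠ 0 := by
  obtain ⟨c, hcj₀, hcw, hc⟩ := h.exists_combination hX j₀ hj₀
  obtain ⟨j, hj, hmin⟩ := Finset.exists_min_image (Finset.univ.filter fun k => c k ≠ 0) n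
    ⟨j₀, by simpa using hcj₀⟩
  replace hj : c j ≠ 0 := by simpa using hj
  replace hmin : ∀ k, c k ≠ 0 → n j ≤ n k := fun k hk => hmin k (by simpa using hk)
  have hbad : ¬ (n j = 0 ∨ IsSink s (w j)) := by
    intro hor
    have hmem : ∀ i, Y i j ∈ 𝓙 0 := fun i =>
      mem_of_den_mul_vertex K s r (hY i j) (by rw [← mul_vertexDiag_apply, h.right']) hor
    have h1 : ∑ i, (∑ k, c k • X k i) * Y i j = c j • vx (w j) := by
      simp only [Finset.sum_mul, smul_mul_assoc]
      rw [Finset.sum_comm]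
      simp only [← Finset.smul_sum, ← Matrix.mul_apply, h.mul_eq, vertexDiag_apply]
      simp
    have h2 := congrArg (ε (w j)) h1
    rw [map_smul, vertexCoeff_vertex, if_pos rfl, map_sum, Finset.sum_eq_zero] at h2
    · exact hj (by simpa using h2.symm)
    · intro i _
      rw [vertexCoeff_mul K s r _ (sum_mem fun k _ => Submodule.smul_mem _ _ (hX k i)) (hmem i),
        vertexCoeff_eq_zero K s r _ (hc i), zero_mul]
  obtain ⟨g', hgg', hg'g, hg'⟩ := exists_elementary_inverse hj
  set g := (1 : Matrix κ κ K).updateRow j c with hg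
  let G : Matrix κ κ 𝓛 := g.map (algebraMap K 𝓛)
  let G' : Matrix κ κ 𝓛 := g'.map (algebraMap K 𝓛)
  have hGX : ∀ k i, (G * X) k i = if k = j then ∑ l, c l • X l i else X k i := by
    intro k i
    rw [Matrix.mul_apply]
    simp only [G, Matrix.map_apply, ← Algebra.smul_def]
    split_ifs with hk
    · simp [hk, hg]
    · simp [hg, Matrix.updateRow_ne hk, Matrix.one_apply]
  refine ⟨j, G * X, Y * G', h.conj ?_ ?_ ?_, ?_, ?_, ?_, fun h' => hbad (.inr h'),
    fun h' => hbad (.inl h')⟩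
  · rw [← Matrix.map_mul, hgg', Matrix.map_one _ (map_zero _) (map_one _)]
  · rw [← Matrix.map_mul, hg'g, Matrix.map_one _ (map_zero _) (map_one _)]
  · ext k l
    have hGkl : G k l = algebraMap K 𝓛 (g k l) := rfl
    rw [mul_vertexDiag_apply, vertexDiag_mul_apply, hGkl, ← Algebra.commutes (g k l) (vx (w k))]
    by_cases hkl : w k = w l
    · rw [hkl]
    · have : g k l = 0 := by
        by_cases hk : k = j
        · rw [hg, hk, Matrix.updateRow_self]
          by_contra hcl
          rw [hk, hcw j hj, hcw l hcl] at hkl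
          exact hkl rfl
        · rw [hg, Matrix.updateRow_ne hk, Matrix.one_apply, if_neg]
          rintro rfl
          exact hkl rfl
      rw [this, map_zero, zero_mul, zero_mul]
  · intro i
    rw [hGX, if_pos rfl]
    exact hc i
  · intro k i
    rw [hGX]
    split_ifs
    · exact sum_mem fun l _ => Submodule.smul_mem _ _ (hX l i)
    · exact hX k i
  · intro i k
    rw [Matrix.mul_apply]
    refine Den.sum fun l _ => ?_
    by_cases hl : g' l k = 0
    · intro y _
      simp [G', hl]
    · refine Den.mul_algebraMap ((hY i l).mono ?_) _
      rcases hg' l k hl with rfl | ⟨rfl, hk⟩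
      · exact le_rfl
      · exact hmin k hk

lemma InversePair.familyClass_eq_of_den [Fintype E] {v : ι → V} (N : ℕ) :
    ∀ {κ : Type} [Fintype κ] {w : κ → V} {X : Matrix κ ι 𝓛} {Y : Matrix ι κ 𝓛} {n : κ → ℕ},
      InversePair K s r w v X Y → (∀ i j, X i j ∈ 𝓙 0) → (∀ i j, Den K s r (n j) (Y i j)) →
      ∑ k, (Fintype.card E + 1) ^ n k = N → familyClass s r w = familyClass s r v := by
  induction N using Nat.strong_induction_on with
  | _ N ih =>
    intro κ _ w X Y n h hX hY hN
    by_cases hsurj : ∀ j, ∃ c : ι → K, ∀ k, ∑ i, ε (w j) (X k i) * c i = if k = j then 1 else 0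
    · exact familyClass_eq_of_count_eq s r (h.count_eq hX (h.mem_of_surjective hX hsurj))
    obtain ⟨j₀, hj₀⟩ := not_forall.1 hsurj
    obtain ⟨j, X', Y', h', hj, hX', hY', hsink, hnj⟩ := h.exists_reduction hX hY hj₀
    rw [← familyClass_labelFamily s r (· = j) w]
    refine ih _ (hN ▸ sum_pow_label_lt hsink hnj) (h'.expand (· = j)) ?_ ?_ rfl
    · rintro ⟨k, x, hx⟩ i
      rw [labelMatrixInv_mul_apply]
      cases x with
      | some e =>
        obtain rfl : k = j := hx.1
        exact ghost_mul_longPaths K s r e (posPaths_le K s r (hj i))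
      | none => exact paths_mul_longPaths K s r (vertex_mem_paths K s r _) (hX' k i)
    · rintro i ⟨k, x, hx⟩
      rw [mul_labelMatrix_apply]
      dsimp only
      cases x with
      | some e =>
        obtain rfl : k = j := hx.1
        rw [if_pos rfl]
        refine Den.mul_posPaths ?_ (edge_mem_posPaths K s r e)
        rw [Nat.sub_add_cancel (Nat.one_le_iff_ne_zero.2 hnj)]
        exact hY' i k
      | none =>
        have hk : k ≠ j := by
          rintro rfl
          exact hsink (hx rfl)
        have h1 : Y' i k * vx (w k) = Y' i k := by rw [← mul_vertexDiag_apply, h'.right']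
        rw [if_neg hk]
        exact h1.symm ▸ hY' i k

/-- Families of vertices with equivalent diagonal matrices have the same class. -/
theorem familyClass_eq_of_mvN [Fintype E] {v : ι → V} {w : κ → V} (h : MvN (𝓓 v) (𝓓 w)) :
    familyClass s r v = familyClass s r w := by
  obtain ⟨Y, X, h1, h2, h3, h4, h5, h6⟩ :=
    h.exists_normalized (vertexDiag_mul_self K s r v) (vertexDiag_mul_self K s r w)
  obtain ⟨m, hm⟩ := exists_forall_den K s r fun x : κ × ι => X x.1 x.2
  obtain ⟨τ, _, t, T, T', g1, g2, g3, g4, g5, g6, g7, g8⟩ := exists_long_decomposition K s r v m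
  have hp : InversePair K s r w t (X * T) (T' * Y) := by
    refine ⟨?_, ?_, ?_, ?_, ?_, ?_⟩
    · rw [Matrix.mul_assoc, ← Matrix.mul_assoc T, g1, h3, h2]
    · rw [Matrix.mul_assoc, ← Matrix.mul_assoc Y, h1, g3, g2]
    · rw [← Matrix.mul_assoc, h5]
    · rw [Matrix.mul_assoc, g4]
    · rw [← Matrix.mul_assoc, g5]
    · rw [Matrix.mul_assoc, h4]
  obtain ⟨n, hn⟩ := exists_forall_den K s r fun x : τ × κ => (T' * Y) x.1 x.2
  rw [← g8]
  refine (InversePair.familyClass_eq_of_den _ hp (fun i j => ?_) (n := fun _ => n)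
    (fun i j => hn (i, j)) rfl).symm
  rw [Matrix.mul_apply]
  exact sum_mem fun k _ => hm (i, k) _ (g7 k j)

end MatricesToClasses

section GraphMonoidClass

variable [Fintype E]

local notation "𝓓" => vertexDiag K s r

/-- The class of an idempotent matrix in the graph monoid. -/
noncomputable def idemClass {ι : Type} [Fintype ι] (p : {e : Matrix ι ι (LPA K s r) // e * e = e}) :
    GraphMonoid s r :=
  @familyClass _ V E s r (exists_mvN_vertexDiag K s r p.2).choose_spec.choose
    (exists_mvN_vertexDiag K s r p.2).choose_spec.choose_spec.choose

variable {ι κ : Type} [Fintype ι] [Fintype κ]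

lemma idemClass_eq (p : {e : Matrix ι ι (LPA K s r) // e * e = e}) {w : κ → V}
    (h : MvN p.1 (𝓓 w)) : idemClass K s r p = familyClass s r w := by
  let _ := (exists_mvN_vertexDiag K s r p.2).choose_spec.choose
  have h1 := (exists_mvN_vertexDiag K s r p.2).choose_spec.choose_spec.choose_spec
  exact familyClass_eq_of_mvN
    (h1.symm.trans h (vertexDiag_mul_self K s r _) (vertexDiag_mul_self K s r _))

lemma idemClass_eq_iff (p : {e : Matrix ι ι (LPA K s r) // e * e = e})
    (q : {e : Matrix κ κ (LPA K s r) // e * e = e}) :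
    idemClass K s r p = idemClass K s r q ↔ MvN p.1 q.1 := by
  obtain ⟨τ, _, v, hv⟩ := exists_mvN_vertexDiag K s r p.2
  obtain ⟨σ, _, w, hw⟩ := exists_mvN_vertexDiag K s r q.2
  rw [idemClass_eq K s r p hv, idemClass_eq K s r q hw]
  refine ⟨fun h => ?_, fun h => ?_⟩
  · exact hv.trans ((mvN_of_familyClass_eq K s r h).trans hw.symm (vertexDiag_mul_self K s r _) q.2)
      p.2 q.2
  · exact familyClass_eq_of_mvN (hv.symm.trans (h.trans hw p.2 (vertexDiag_mul_self K s r _))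
      (vertexDiag_mul_self K s r _) (vertexDiag_mul_self K s r _))

lemma exists_idemClass_eq (a : GraphMonoid s r) :
    ∃ p : IdemMat (LPA K s r), idemClass K s r p.2 = a := by
  obtain ⟨α, rfl⟩ := AddCon.mk'_surjective a
  let e := (Fintype.equivFin (Σ u, Fin (α u))).symm
  refine ⟨⟨_, 𝓓 (standardFamily α ∘ e), vertexDiag_mul_self K s r _⟩, ?_⟩
  rw [idemClass_eq K s r (w := standardFamily α), ← mk_count, count_standardFamily]
  have h := mvN_submatrix (vertexDiag_mul_self K s r (standardFamily α)) e
  rw [vertexDiag_submatrix] at h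
  exact h.symm

lemma idemClass_blockSum (p q : IdemMat (LPA K s r))
    (h : blockSum p.2.1 q.2.1 * blockSum p.2.1 q.2.1 = blockSum p.2.1 q.2.1) :
    idemClass K s r ⟨blockSum p.2.1 q.2.1, h⟩ = idemClass K s r p.2 + idemClass K s r q.2 := by
  obtain ⟨τ, _, v, hv⟩ := exists_mvN_vertexDiag K s r p.2.2
  obtain ⟨σ, _, w, hw⟩ := exists_mvN_vertexDiag K s r q.2.2
  rw [idemClass_eq K s r p.2 hv, idemClass_eq K s r q.2 hw, ← familyClass_sumElim]
  refine idemClass_eq K s r _ ?_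
  have hpq : Matrix.fromBlocks p.2.1 0 0 q.2.1 * Matrix.fromBlocks p.2.1 0 0 q.2.1 =
      Matrix.fromBlocks p.2.1 0 0 q.2.1 := by
    simp [Matrix.fromBlocks_multiply, p.2.2, q.2.2]
  rw [← fromBlocks_vertexDiag]
  refine MvN.trans (mvN_submatrix hpq finSumFinEquiv.symm).symm (hv.fromBlocks hw) h ?_
  rw [fromBlocks_vertexDiag, vertexDiag_mul_self]

lemma idemClass_of_isEmpty [IsEmpty ι] (p : {e : Matrix ι ι (LPA K s r) // e * e = e}) :
    idemClass K s r p = 0 := by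
  rw [idemClass_eq K s r p (w := fun i : ι => isEmptyElim i)]
  · simp [familyClass]
  · exact ⟨0, 0, Subsingleton.elim _ _, Subsingleton.elim _ _⟩

end GraphMonoidClass

end LeavittPath


/-- **The Ara / Moreno / Pardo Realization Theorem.**  For a finite graph `E` and any
field `K`, there is a monoid isomorphism `𝒱(L_K(E)) ≅ M_E`: explicitly, there is a map
`Φ` from idempotent matrices over `L_K(E)` onto `M_E` which is surjective, identifies
exactly the Murray–von Neumann equivalent idempotents, and sends block-diagonal sums to
sums (and the empty idempotent to `0`); i.e. `Φ` induces a monoid isomorphism from the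
monoid `𝒱(L_K(E))` of equivalence classes of idempotent matrices onto `M_E`. -/
theorem realization_theorem (K V E : Type) [Field K] [Fintype V] [Fintype E]
    (s r : E → V) :
    ∃ Φ : IdemMat (LPA K s r) → GraphMonoid s r,
      Function.Surjective Φ ∧
      (∀ p q : IdemMat (LPA K s r), Φ p = Φ q ↔ MvNEq p q) ∧
      (∀ (p q : IdemMat (LPA K s r))
          (h : blockSum p.2.1 q.2.1 * blockSum p.2.1 q.2.1 = blockSum p.2.1 q.2.1),
        Φ ⟨p.1 + q.1, blockSum p.2.1 q.2.1, h⟩ = Φ p + Φ q) ∧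
      (∀ h : (0 : Matrix (Fin 0) (Fin 0) (LPA K s r)) * 0 = 0,
        Φ ⟨0, 0, h⟩ = 0) := by
  refine ⟨fun p => LeavittPath.idemClass K s r p.2, LeavittPath.exists_idemClass_eq K s r,
    fun p q => LeavittPath.idemClass_eq_iff K s r p.2 q.2,
    fun p q h => LeavittPath.idemClass_blockSum K s r p q h,
    fun h => LeavittPath.idemClass_of_isEmpty K s r _⟩
end
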